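/- Every polynomial map (f,g): ℝ² → ℝ² whose Jacobian determinant is nowhere zero and with deg f ≤ 5, deg g ≤ 6 is injective. -/

import Mathlib

open MvPolynomial

noncomputable def Jac (f g : MvPolynomial (Fin 2) ℝ) : MvPolynomial (Fin 2) ℝ :=
  pderiv 0 f * pderiv 1 g - pderiv 1 f * pderiv 0 g

open Filter Topology

/-- A map of the plane with everywhere invertible strict derivative. -/
def LocDiffeo (F : ℝ × ℝ → ℝ × ℝ) : Prop :=
  ∀ z, ∃ F' : (ℝ × ℝ) ≃L[ℝ] (ℝ × ℝ), HasStrictFDerivAt F (F' : (ℝ × ℝ) →L[ℝ] (ℝ × ℝ)) z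

/-- `a` and `b` are joined by an arc lifting the segment from `F a` to `F b`. -/
def SegLift (F : ℝ × ℝ → ℝ × ℝ) (a b : ℝ × ℝ) : Prop :=
  ∃ γ : C(unitInterval, ℝ × ℝ), γ 0 = a ∧ γ 1 = b ∧
    ∀ r : unitInterval, F (γ r) = AffineMap.lineMap (F a) (F b) (r : ℝ)

namespace LocDiffeo

variable {F : ℝ × ℝ → ℝ × ℝ}

theorem continuous (hF : LocDiffeo F) : Continuous F :=
  continuous_iff_continuousAt.2 fun z => by
    obtain ⟨F', h⟩ := hF z
    exact h.continuousAt

theorem isOpenMap (hF : LocDiffeo F) : IsOpenMap F := by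
  choose F' h using hF
  exact isOpenMap_of_hasStrictFDerivAt_equiv h

theorem exists_injOn (hF : LocDiffeo F) (z : ℝ × ℝ) : ∃ U ∈ 𝓝 z, Set.InjOn F U := by
  obtain ⟨F', h⟩ := hF z
  refine ⟨(h.toOpenPartialHomeomorph F).source,
    (h.toOpenPartialHomeomorph F).open_source.mem_nhds h.mem_toOpenPartialHomeomorph_source, ?_⟩
  exact (h.toOpenPartialHomeomorph F).injOn

theorem isLocallyInjective (hF : LocDiffeo F) : IsLocallyInjective F :=
  isLocallyInjective_iff_nhds.2 hF.exists_injOn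

theorem lift_const (hF : LocDiffeo F) {γ : C(unitInterval, ℝ × ℝ)}
    (h : ∀ r, F (γ r) = F (γ 0)) (r : unitInterval) : γ r = γ 0 := by
  have := IsSeparatedMap.eqOn_of_comp_eqOn (T2Space.isSeparatedMap F) hF.isLocallyInjective
    (isPreconnected_univ) γ.continuous.continuousOn
    (continuous_const (y := γ 0)).continuousOn (fun r _ => by simp [h r]) (Set.mem_univ 0) rfl
  exact this (Set.mem_univ r)

theorem _root_.SegLift.refl (F : ℝ × ℝ → ℝ × ℝ) (a : ℝ × ℝ) : SegLift F a a :=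
  ⟨ContinuousMap.const _ a, rfl, rfl, fun r => by simp⟩

theorem segLift_eq (hF : LocDiffeo F) {a b : ℝ × ℝ} (h : SegLift F a b) (hab : F a = F b) :
    a = b := by
  obtain ⟨γ, h0, h1, h⟩ := h
  have := hF.lift_const (γ := γ) (fun r => by rw [h, h0, hab]; simp) 1
  rw [← h0, ← h1, this]

theorem segLift_trans (hF : LocDiffeo F) {a b d : ℝ × ℝ} (hab : SegLift F a b)
    (hbd : SegLift F b d) (h1 : (F a).1 = (F b).1) (h2 : (F b).1 = (F d).1) : SegLift F a d := by
  classical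
  have key : ∀ a b, SegLift F a b → (F a).1 = (F b).1 → ∃ L : ℝ → ℝ × ℝ,
      ContinuousOn L (Set.uIcc (F a).2 (F b).2) ∧ L (F a).2 = a ∧ L (F b).2 = b ∧
      ∀ v ∈ Set.uIcc (F a).2 (F b).2, F (L v) = ((F a).1, v) := by
    intro a b hab h1
    by_cases he : (F a).2 = (F b).2
    · have : a = b := hF.segLift_eq hab (Prod.ext h1 he)
      subst this
      refine ⟨fun _ => a, continuousOn_const, rfl, rfl, ?_⟩
      intro v hv
      simp at hv
      simp [hv]
    · obtain ⟨γ, g0, g1, g⟩ := hab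
      have hne : (F b).2 - (F a).2 ≠ 0 := sub_ne_zero.2 (Ne.symm he)
      refine ⟨fun v => γ (Set.projIcc 0 1 zero_le_one ((v - (F a).2) / ((F b).2 - (F a).2))),
        ?_, ?_, ?_, ?_⟩
      · apply Continuous.continuousOn
        exact γ.continuous.comp (continuous_projIcc.comp (by fun_prop))
      · simp [← g0]
      · simp only [div_self hne]
        rw [Set.projIcc_right]; exact g1
      · intro v hv
        have hm : (v - (F a).2) / ((F b).2 - (F a).2) ∈ Set.Icc (0 : ℝ) 1 := by
          rcases lt_or_gt_of_ne he with h | h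
          · rw [Set.uIcc_of_le h.le] at hv
            exact ⟨div_nonneg (by linarith [hv.1]) (by linarith),
              (div_le_one (by linarith)).2 (by linarith [hv.2])⟩
          · rw [Set.uIcc_of_ge h.le] at hv
            exact ⟨div_nonneg_of_nonpos (by linarith [hv.2]) (by linarith),
              (div_le_one_of_neg (by linarith)).2 (by linarith [hv.1])⟩
        beta_reduce
        rw [Set.projIcc_of_mem _ hm, g]
        ext
        · simp [AffineMap.lineMap_apply, h1]
        · simp only [AffineMap.lineMap_apply, vsub_eq_sub, vadd_eq_add, smul_eq_mul, Prod.snd_add,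
            Prod.smul_snd, Prod.snd_sub]
          field_simp; ring
  obtain ⟨L1, c1, a1, b1, e1⟩ := key a b hab h1
  obtain ⟨L2, c2, a2, b2, e2⟩ := key b d hbd h2
  set u := (F a).2
  set v := (F b).2
  set w := (F d).2
  have hov : Set.EqOn L1 L2 (Set.uIcc u v ∩ Set.uIcc v w) := by
    refine IsSeparatedMap.eqOn_of_comp_eqOn (T2Space.isSeparatedMap F) hF.isLocallyInjective
      (s := Set.uIcc u v ∩ Set.uIcc v w) (a := v) ?_ (c1.mono Set.inter_subset_left)
      (c2.mono Set.inter_subset_right) ?_ ?_ ?_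
    · exact (Set.ordConnected_uIcc.inter Set.ordConnected_uIcc).isPreconnected
    · intro x hx
      simp [e1 x hx.1, e2 x hx.2, h1]
    · exact ⟨Set.right_mem_uIcc, Set.left_mem_uIcc⟩
    · rw [b1, a2]
  set L : ℝ → ℝ × ℝ := fun x => if x ∈ Set.uIcc u v then L1 x else L2 x with hL
  have hL1 : Set.EqOn L L1 (Set.uIcc u v) := fun x hx => by simp only [hL]; rw [if_pos hx]
  have hL2 : Set.EqOn L L2 (Set.uIcc v w) := fun x hx => by
    simp only [hL]
    split_ifs with h
    · exact hov ⟨h, hx⟩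
    · rfl
  have hLc : ContinuousOn L (Set.uIcc u v ∪ Set.uIcc v w) :=
    ContinuousOn.union_of_isClosed (c1.congr hL1) (c2.congr hL2) isClosed_Icc isClosed_Icc
  have hLF : ∀ x ∈ Set.uIcc u v ∪ Set.uIcc v w, F (L x) = ((F a).1, x) := by
    rintro x (hx | hx)
    · rw [hL1 hx, e1 x hx]
    · rw [hL2 hx, e2 x hx, h1]
  have hsub : Set.uIcc u w ⊆ Set.uIcc u v ∪ Set.uIcc v w := Set.uIcc_subset_uIcc_union_uIcc
  have hmem : ∀ r : unitInterval, AffineMap.lineMap u w (r : ℝ) ∈ Set.uIcc u w := by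
    intro r
    rw [← segment_eq_uIcc, segment_eq_image_lineMap]
    exact ⟨r, r.2, rfl⟩
  refine ⟨⟨fun r => L (AffineMap.lineMap u w (r : ℝ)), ?_⟩, ?_, ?_, ?_⟩
  · refine (hLc.mono hsub).comp_continuous ?_ hmem
    exact (AffineMap.lineMap_continuous).comp continuous_subtype_val
  · simp only [ContinuousMap.coe_mk, Set.Icc.coe_zero, AffineMap.lineMap_apply_zero]
    rw [hL1 Set.left_mem_uIcc, a1]
  · simp only [ContinuousMap.coe_mk, Set.Icc.coe_one, AffineMap.lineMap_apply_one]
    rw [hL2 Set.right_mem_uIcc, b2]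
  · intro r
    simp only [ContinuousMap.coe_mk]
    rw [hLF _ (hsub (hmem r))]
    ext
    · simp [AffineMap.lineMap_apply, h1, h2]
    · simp [AffineMap.lineMap_apply, u, w]

theorem segLift_eventually (hF : LocDiffeo F) {a b : ℝ × ℝ} (h : SegLift F a b) :
    ∀ᶠ p in 𝓝 (a, b), SegLift F p.1 p.2 := by
  obtain ⟨γ, g0, g1, g⟩ := h
  have hinj : Set.InjOn F (Set.range γ) := by
    rintro _ ⟨r, rfl⟩ _ ⟨s, rfl⟩ hrs
    by_cases hab : F a = F b
    · have := hF.lift_const (γ := γ) (fun r => by rw [g, g0, hab]; simp)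
      rw [this r, this s]
    · rw [g, g] at hrs
      have := AffineMap.lineMap_injective ℝ hab hrs
      rw [Subtype.ext this]
  have hK : IsCompact (Set.range γ) := isCompact_range γ.continuous
  obtain ⟨T, hT, hTi⟩ := hinj.exists_mem_nhdsSet hK
    (fun x _ => hF.continuous.continuousAt) (fun x _ => hF.exists_injOn x)
  obtain ⟨U, hUo, hKU, hUT⟩ := mem_nhdsSet_iff_exists.1 hT
  have hUi : Set.InjOn F U := hTi.mono hUT
  have hUF : IsOpen (F '' U) := hF.isOpenMap U hUo
  set S := Function.invFunOn F U
  have hSl : Set.LeftInvOn S F U := hUi.leftInvOn_invFunOn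
  have hSc : ContinuousOn S (F '' U) := by
    apply IsOpenMap.continuousOn_image_of_leftInvOn _ hSl
    exact hF.isOpenMap.domRestrict hUo
  have ev1 : ∀ᶠ p : (ℝ × ℝ) × (ℝ × ℝ) in 𝓝 (a, b), ∀ r ∈ Set.Icc (0 : ℝ) 1,
      AffineMap.lineMap (F p.1) (F p.2) r ∈ F '' U := by
    apply isCompact_Icc.eventually_forall_of_forall_eventually
    intro r hr
    have hc : Continuous fun z : ((ℝ × ℝ) × (ℝ × ℝ)) × ℝ =>
        (AffineMap.lineMap (F z.1.1) (F z.1.2) z.2 : ℝ × ℝ) := by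
      simp only [AffineMap.lineMap_apply, vsub_eq_sub, vadd_eq_add]
      have := hF.continuous
      fun_prop
    refine hc.continuousAt.eventually (hUF.mem_nhds ?_)
    have := g ⟨r, hr⟩
    simp only at this
    beta_reduce
    rw [← this]
    exact Set.mem_image_of_mem _ (hKU ⟨_, rfl⟩)
  have ev2 : ∀ᶠ p : (ℝ × ℝ) × (ℝ × ℝ) in 𝓝 (a, b), p.1 ∈ U :=
    continuous_fst.continuousAt.eventually (hUo.mem_nhds (hKU ⟨0, g0⟩))
  have ev3 : ∀ᶠ p : (ℝ × ℝ) × (ℝ × ℝ) in 𝓝 (a, b), p.2 ∈ U :=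
    continuous_snd.continuousAt.eventually (hUo.mem_nhds (hKU ⟨1, g1⟩))
  filter_upwards [ev1, ev2, ev3] with p h1 h2 h3
  refine ⟨⟨fun r => S (AffineMap.lineMap (F p.1) (F p.2) (r : ℝ)), ?_⟩, ?_, ?_, ?_⟩
  · exact hSc.comp_continuous (AffineMap.lineMap_continuous.comp continuous_subtype_val)
      (fun r => h1 r r.2)
  · simp [hSl h2]
  · simp [hSl h3]
  · intro r
    simp only [ContinuousMap.coe_mk]
    obtain ⟨x, hx, hxe⟩ := h1 r r.2
    rw [← hxe, hSl hx]

theorem segLift_of_tendsto (hF : LocDiffeo F) {K : Set (ℝ × ℝ)} (hK : IsCompact K)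
    {a b : ℕ → ℝ × ℝ} {a0 b0 : ℝ × ℝ} (ha : Tendsto a atTop (𝓝 a0)) (hb : Tendsto b atTop (𝓝 b0))
    (γ : ℕ → C(unitInterval, ℝ × ℝ)) (g0 : ∀ n, γ n 0 = a n) (g1 : ∀ n, γ n 1 = b n)
    (g : ∀ n, ∀ r : unitInterval, F (γ n r) = AffineMap.lineMap (F (a n)) (F (b n)) (r : ℝ))
    (gK : ∀ n r, γ n r ∈ K) : SegLift F a0 b0 := by
  have hFc := hF.continuous
  obtain ⟨δ, hδ, hinj⟩ : ∃ δ > 0, ∀ z ∈ K, ∀ w ∈ K, dist w z < δ → F z = F w → z = w := by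
    choose U hU hUi using hF.exists_injOn
    obtain ⟨δ, hδ, h⟩ := lebesgue_number_lemma_of_metric (s := K) (c := fun z => interior (U z)) hK
      (fun _ => isOpen_interior) (fun z _ => Set.mem_iUnion.2 ⟨z, mem_interior_iff_mem_nhds.2 (hU z)⟩)
    refine ⟨δ, hδ, fun z hz w hw hd he => ?_⟩
    obtain ⟨i, hi⟩ := h z hz
    exact hUi i (interior_subset (hi (Metric.mem_ball_self hδ))) (interior_subset (hi hd)) he
  have hcau : CauchySeq γ := by
    rw [Metric.cauchySeq_iff]
    intro ε0 hε0
    set ε := min (ε0 / 2) (δ / 4) with hε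
    have hεp : 0 < ε := by positivity
    have hεδ : ε < δ := by have := min_le_right (ε0 / 2) (δ / 4); linarith
    have hε0' : ε < ε0 := by have := min_le_left (ε0 / 2) (δ / 4); linarith
    obtain ⟨m, hm, hmin⟩ : ∃ m > 0, ∀ z ∈ K, ∀ w ∈ K, dist z w = ε → m ≤ dist (F z) (F w) := by
      set T : Set ((ℝ × ℝ) × (ℝ × ℝ)) := (K ×ˢ K) ∩ {p | dist p.1 p.2 = ε}
      have hT : IsCompact T := (hK.prod hK).inter_right
        (isClosed_eq (by fun_prop) continuous_const)
      rcases T.eq_empty_or_nonempty with he | hne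
      · refine ⟨1, one_pos, fun z hz w hw h => ?_⟩
        exact absurd (show (z, w) ∈ T from ⟨⟨hz, hw⟩, h⟩) (by simp [he])
      · obtain ⟨p, hp, hpm⟩ := hT.exists_isMinOn hne
          (f := fun p => dist (F p.1) (F p.2)) (by fun_prop)
        refine ⟨dist (F p.1) (F p.2), ?_, fun z hz w hw h => hpm (show (z, w) ∈ T from ⟨⟨hz, hw⟩, h⟩)⟩
        rw [gt_iff_lt, dist_pos]
        intro he
        have hd : dist p.1 p.2 = ε := hp.2
        have := hinj p.1 hp.1.1 p.2 hp.1.2 (by rw [dist_comm, hd]; exact hεδ) he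
        rw [this, dist_self] at hd
        exact hεp.ne hd
    obtain ⟨N1, hN1⟩ := Metric.cauchySeq_iff.1 ha.cauchySeq ε hεp
    obtain ⟨N2, hN2⟩ := Metric.cauchySeq_iff.1 ((hFc.tendsto a0).comp ha).cauchySeq m hm
    obtain ⟨N3, hN3⟩ := Metric.cauchySeq_iff.1 ((hFc.tendsto b0).comp hb).cauchySeq m hm
    refine ⟨max N1 (max N2 N3), fun i hi j hj => ?_⟩
    have hFd : ∀ r, dist (F (γ i r)) (F (γ j r)) < m := by
      intro r
      rw [g, g]
      have h2 := hN2 i (by omega) j (by omega)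
      have h3 := hN3 i (by omega) j (by omega)
      simp only [Function.comp] at h2 h3
      have hcv : Convex ℝ (Metric.ball (0 : ℝ × ℝ) m) := convex_ball _ _
      have := hcv.lineMap_mem (x := F (a i) - F (a j)) (y := F (b i) - F (b j))
        (by rwa [mem_ball_zero_iff, ← dist_eq_norm]) (by rwa [mem_ball_zero_iff, ← dist_eq_norm]) r.2
      rw [mem_ball_zero_iff] at this
      rw [dist_eq_norm]
      have he : (AffineMap.lineMap (F (a i)) (F (b i)) (r : ℝ) : ℝ × ℝ)
          - AffineMap.lineMap (F (a j)) (F (b j)) (r : ℝ)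
          = AffineMap.lineMap (F (a i) - F (a j)) (F (b i) - F (b j)) (r : ℝ) := by
        simp only [AffineMap.lineMap_apply, vsub_eq_sub, vadd_eq_add]
        module
      rw [he]
      exact this
    have hlt : ∀ r, dist (γ i r) (γ j r) < ε := by
      by_contra! hcon
      obtain ⟨r, hr⟩ := hcon
      have hcont : Continuous fun r => dist (γ i r) (γ j r) := by fun_prop
      have h0 : dist (γ i 0) (γ j 0) < ε := by
        rw [g0, g0]; exact hN1 i (by omega) j (by omega)
      obtain ⟨s, hs⟩ := mem_range_of_exists_le_of_exists_ge hcont ⟨0, h0.le⟩ ⟨r, hr⟩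
      exact absurd (hmin _ (gK i s) _ (gK j s) hs) (not_le.2 (hFd s))
    exact (ContinuousMap.dist_lt_iff hε0).2 fun r => (hlt r).trans hε0'
  obtain ⟨Γ, hΓ⟩ := cauchySeq_tendsto_of_complete hcau
  have hpt : ∀ r, Tendsto (fun n => γ n r) atTop (𝓝 (Γ r)) := fun r =>
    ((continuous_eval_const r).tendsto Γ).comp hΓ
  refine ⟨Γ, tendsto_nhds_unique (hpt 0) (by simpa [g0] using ha),
    tendsto_nhds_unique (hpt 1) (by simpa [g1] using hb), fun r => ?_⟩
  refine tendsto_nhds_unique ((hFc.tendsto _).comp (hpt r)) ?_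
  simp only [Function.comp_def, g]
  simp only [AffineMap.lineMap_apply, vsub_eq_sub, vadd_eq_add]
  have h2 := (hFc.tendsto a0).comp ha
  have h3 := (hFc.tendsto b0).comp hb
  exact ((h3.sub h2).const_smul _).add h2

end LocDiffeo

/-- Liftings of segments persist along pairs of paths lying on common level sets of the first
component. -/
def LevelStable (F : ℝ × ℝ → ℝ × ℝ) : Prop :=
  ∀ a b : ℝ → ℝ × ℝ, ContinuousOn a (Set.Icc 0 1) → ContinuousOn b (Set.Icc 0 1) →
    (∀ τ ∈ Set.Icc (0 : ℝ) 1, (F (a τ)).1 = (F (b τ)).1) →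
    SegLift F (a 0) (b 0) → SegLift F (a 1) (b 1)

/-- A continuous injective function on a segment can be inverted along the segment of values. -/
theorem exists_path_of_injOn {h : ℝ → ℝ} {s t p q : ℝ} (hc : ContinuousOn h (Set.Icc s t))
    (hi : Set.InjOn h (Set.Icc s t)) (hp : p ∈ Set.Icc s t) (hq : q ∈ Set.Icc s t) :
    ∃ φ : ℝ → ℝ, ContinuousOn φ (Set.Icc 0 1) ∧ φ 0 = p ∧ φ 1 = q ∧
      ∀ τ ∈ Set.Icc (0 : ℝ) 1, h (φ τ) = AffineMap.lineMap (h p) (h q) τ := by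
  set S := Function.invFunOn h (Set.Icc s t)
  have hSl : Set.LeftInvOn S h (Set.Icc s t) := hi.leftInvOn_invFunOn
  have hSc : ContinuousOn S (h '' Set.Icc s t) := by
    have hcl : IsClosedMap ((Set.Icc s t).domRestrict h) :=
      (continuousOn_iff_continuous_domRestrict.1 hc).isClosedMap
    rw [continuousOn_iff_isClosed]
    intro C hC
    refine ⟨h '' (C ∩ Set.Icc s t), ?_, ?_⟩
    · exact ((isCompact_Icc.inter_left hC).image_of_continuousOn
        (hc.mono Set.inter_subset_right)).isClosed
    · ext y
      constructor
      · rintro ⟨hy, x, hx, rfl⟩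
        refine ⟨⟨x, ⟨?_, hx⟩, rfl⟩, ⟨x, hx, rfl⟩⟩
        simpa [hSl hx] using hy
      · rintro ⟨⟨x, ⟨hxC, hx⟩, rfl⟩, hy⟩
        refine ⟨?_, hy⟩
        simpa [hSl hx] using hxC
  have hmem : ∀ τ ∈ Set.Icc (0 : ℝ) 1, AffineMap.lineMap (h p) (h q) τ ∈ h '' Set.Icc s t := by
    intro τ hτ
    have hconn : (h '' Set.Icc s t).OrdConnected := (isPreconnected_Icc.image h hc).ordConnected
    refine hconn.uIcc_subset ⟨p, hp, rfl⟩ ⟨q, hq, rfl⟩ ?_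
    rw [← segment_eq_uIcc, segment_eq_image_lineMap]
    exact ⟨τ, hτ, rfl⟩
  refine ⟨fun τ => S (AffineMap.lineMap (h p) (h q) τ), ?_, ?_, ?_, ?_⟩
  · exact hSc.comp AffineMap.lineMap_continuous.continuousOn hmem
  · simp [hSl hp]
  · simp [hSl hq]
  · intro τ hτ
    obtain ⟨x, hx, hxe⟩ := hmem τ hτ
    beta_reduce
    rw [← hxe, hSl hx]

namespace LocDiffeo

variable {F : ℝ × ℝ → ℝ × ℝ}

theorem segLift_extend (hN : LevelStable F) {α : ℝ → ℝ × ℝ} (hα : Continuous α) {h : ℝ → ℝ}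
    (hh : ∀ t, h t = (F (α t)).1) (hc : Continuous h) {s r r' t : ℝ} (hsr : s ≤ r) (hrt : r' ≤ t)
    (i1 : Set.InjOn h (Set.Icc s r)) (i2 : Set.InjOn h (Set.Icc r' t)) (hst : h s = h t)
    (hrr : h r = h r') (hJ : SegLift F (α r) (α r')) : SegLift F (α s) (α t) := by
  obtain ⟨φ, c1, a1, b1, e1⟩ := exists_path_of_injOn hc.continuousOn i1
    (Set.right_mem_Icc.2 hsr) (Set.left_mem_Icc.2 hsr)
  obtain ⟨ψ, c2, a2, b2, e2⟩ := exists_path_of_injOn hc.continuousOn i2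
    (Set.left_mem_Icc.2 hrt) (Set.right_mem_Icc.2 hrt)
  have := hN (α ∘ φ) (α ∘ ψ) (hα.comp_continuousOn c1) (hα.comp_continuousOn c2) ?_ ?_
  · simpa [b1, b2] using this
  · intro τ hτ
    simp only [Function.comp]
    rw [← hh, ← hh, e1 τ hτ, e2 τ hτ, hst, hrr]
  · simpa [a1, a2] using hJ

theorem segLift_of_levelStable (hF : LocDiffeo F) (hN : LevelStable F) {α : ℝ → ℝ × ℝ}
    (hα : Continuous α) {h : ℝ → ℝ} (hh : ∀ t, h t = (F (α t)).1) (hc : Continuous h)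
    (Z : Finset ℝ) (hZ : ∀ s t, s < t → h s = h t → ∃ z ∈ Z, s < z ∧ z < t) (n : ℕ) :
    ∀ s t, s < t → h s = h t → (Z.filter fun z => s < z ∧ z < t).card = n →
      SegLift F (α s) (α t) := by
  induction n using Nat.strong_induction_on with
  | _ n ih =>
  intro s t hst hhst hn
  have mono : ∀ s' t', s ≤ s' → t' ≤ t → (∃ z ∈ Z, s < z ∧ z < t ∧ ¬ (s' < z ∧ z < t')) →
      (Z.filter fun z => s' < z ∧ z < t').card < n := by
    rintro s' t' h1 h2 ⟨z, hz, hz1, hz2, hz3⟩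
    rw [← hn]
    apply Finset.card_lt_card
    rw [Finset.ssubset_iff_of_subset]
    · exact ⟨z, by simp [hz, hz1, hz2], by simp only [Finset.mem_filter, not_and]; tauto⟩
    · intro w hw
      simp only [Finset.mem_filter] at hw ⊢
      exact ⟨hw.1, by linarith [hw.2.1], by linarith [hw.2.2]⟩
  by_cases hu : ∃ u, s < u ∧ u < t ∧ h u = h s
  · obtain ⟨u, h1, h2, h3⟩ := hu
    obtain ⟨z, hz, z1, z2⟩ := hZ s u h1 h3.symm
    obtain ⟨w, hw, w1, w2⟩ := hZ u t h2 (h3.trans hhst)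
    have A1 := ih _ (mono s u le_rfl h2.le ⟨w, hw, by linarith, w2, by push Not; intro; linarith⟩)
      s u h1 h3.symm rfl
    have A2 := ih _ (mono u t h1.le le_rfl ⟨z, hz, z1, by linarith, by intro h; linarith [h.1]⟩)
      u t h2 (h3.trans hhst) rfl
    exact hF.segLift_trans A1 A2 (by rw [← hh, ← hh, h3]) (by rw [← hh, ← hh, h3, hhst])
  push Not at hu
  set W := Z.filter fun z => s < z ∧ z < t with hW
  have hWne : W.Nonempty := by
    obtain ⟨z, hz, z1, z2⟩ := hZ s t hst hhst
    exact ⟨z, by simp [hW, hz, z1, z2]⟩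
  set r := W.min' hWne
  set q := W.max' hWne
  have hr : r ∈ Z ∧ s < r ∧ r < t := Finset.mem_filter.1 (W.min'_mem hWne)
  have hq : q ∈ Z ∧ s < q ∧ q < t := Finset.mem_filter.1 (W.max'_mem hWne)
  have hrq : r ≤ q := W.min'_le_max' hWne
  have inj1 : Set.InjOn h (Set.Icc s r) := by
    have : ∀ x y, x ∈ Set.Icc s r → y ∈ Set.Icc s r → x < y → h x ≠ h y := by
      intro x y hx hy hxy he
      obtain ⟨z, hz, z1, z2⟩ := hZ x y hxy he
      have := W.min'_le z (by simp [hW, hz]; constructor <;> linarith [hx.1, hy.2, hr.2.2])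
      linarith [hy.2]
    intro x hx y hy he
    rcases lt_trichotomy x y with h | h | h
    · exact absurd he (this x y hx hy h)
    · exact h
    · exact absurd he.symm (this y x hy hx h)
  have inj2 : Set.InjOn h (Set.Icc q t) := by
    have : ∀ x y, x ∈ Set.Icc q t → y ∈ Set.Icc q t → x < y → h x ≠ h y := by
      intro x y hx hy hxy he
      obtain ⟨z, hz, z1, z2⟩ := hZ x y hxy he
      have := W.le_max' z (by simp [hW, hz]; constructor <;> linarith [hx.1, hy.2, hq.2.1])
      linarith [hx.1]
    intro x hx y hy he
    rcases lt_trichotomy x y with h | h | h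
    · exact absurd he (this x y hx hy h)
    · exact h
    · exact absurd he.symm (this y x hy hx h)
  have hsign : (∀ u, s < u → u < t → h s < h u) ∨ (∀ u, s < u → u < t → h u < h s) := by
    by_contra! hcon
    obtain ⟨⟨u, u1, u2, u3⟩, ⟨v, v1, v2, v3⟩⟩ := hcon
    have := (isPreconnected_Ioo (a := s) (b := t)).intermediate_value ⟨u1, u2⟩ ⟨v1, v2⟩
      hc.continuousOn ⟨u3, v3⟩
    obtain ⟨w, hw, hwe⟩ := this
    exact hu w hw.1 hw.2 hwe
  have lift : ∀ x y, s < x → x ≤ y → y < t → h x = h y → (∃ z ∈ Z, s < z ∧ z < t ∧ ¬ (x < z ∧ z < y)) →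
      SegLift F (α x) (α y) := by
    intro x y h1 h2 h3 h4 h5
    rcases h2.eq_or_lt with h2 | h2
    · rw [h2]; exact SegLift.refl F _
    · exact ih _ (mono x y h1.le h3.le h5) x y h2 h4 rfl
  have fin1 : ∀ y, q ≤ y → y ≤ t → h y = h r → SegLift F (α s) (α t) := by
    intro y y1 y2 y3
    have hyt : y < t := by
      rcases y2.eq_or_lt with h | h
      · rw [h, ← hhst] at y3
        exact absurd y3.symm (hu r hr.2.1 hr.2.2)
      · exact h
    exact segLift_extend hN hα hh hc hr.2.1.le y2 inj1
      (inj2.mono (Set.Icc_subset_Icc y1 le_rfl)) hhst y3.symm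
      (lift r y hr.2.1 (hrq.trans y1) hyt y3.symm
        ⟨r, hr.1, hr.2.1, hr.2.2, by intro h; linarith [h.1]⟩)
  have fin2 : ∀ y, s ≤ y → y ≤ r → h y = h q → SegLift F (α s) (α t) := by
    intro y y1 y2 y3
    have hys : s < y := by
      rcases y1.eq_or_lt with h | h
      · rw [← h] at y3
        exact absurd y3.symm (hu q hq.2.1 hq.2.2)
      · exact h
    exact segLift_extend hN hα hh hc y1 hq.2.2.le
      (inj1.mono (Set.Icc_subset_Icc le_rfl y2)) inj2 hhst y3
      (lift y q hys (y2.trans hrq) hq.2.2 y3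
        ⟨q, hq.1, hq.2.1, hq.2.2, by intro h; linarith [h.2]⟩)
  rcases hsign with hs | hs
  · have hsr := hs r hr.2.1 hr.2.2
    have hsq := hs q hq.2.1 hq.2.2
    rcases le_total (h r) (h q) with hle | hle
    · obtain ⟨y, hy, hye⟩ := intermediate_value_Icc' hq.2.2.le hc.continuousOn
        (show h r ∈ Set.Icc (h t) (h q) from ⟨by rw [← hhst]; exact hsr.le, hle⟩)
      exact fin1 y hy.1 hy.2 hye
    · obtain ⟨y, hy, hye⟩ := intermediate_value_Icc hr.2.1.le hc.continuousOn
        (show h q ∈ Set.Icc (h s) (h r) from ⟨hsq.le, hle⟩)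
      exact fin2 y hy.1 hy.2 hye
  · have hsr := hs r hr.2.1 hr.2.2
    have hsq := hs q hq.2.1 hq.2.2
    rcases le_total (h q) (h r) with hle | hle
    · obtain ⟨y, hy, hye⟩ := intermediate_value_Icc hq.2.2.le hc.continuousOn
        (show h r ∈ Set.Icc (h q) (h t) from ⟨hle, by rw [← hhst]; exact hsr.le⟩)
      exact fin1 y hy.1 hy.2 hye
    · obtain ⟨y, hy, hye⟩ := intermediate_value_Icc' hr.2.1.le hc.continuousOn
        (show h q ∈ Set.Icc (h r) (h s) from ⟨hle, hsq.le⟩)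
      exact fin2 y hy.1 hy.2 hye

/-- If lifted segments do not persist along level sets, some family of them escapes to infinity,
and tangencies with linear foliations escape as well. -/
theorem exists_unbounded_of_not_levelStable (hF : LocDiffeo F) (hN : ¬ LevelStable F) :
    ∃ (B : Set (ℝ × ℝ)) (M : ℝ), ¬ Bornology.IsBounded B ∧ (∀ z ∈ B, ‖F z‖ ≤ M) ∧
      ∀ l : (ℝ × ℝ) →L[ℝ] ℝ, ¬ BddAbove (l '' B) → ∀ N : ℝ, ∃ z ∈ B, N < l z ∧
        ∃ v : ℝ × ℝ, v ≠ 0 ∧ l v = 0 ∧ (fderiv ℝ F z v).1 = 0 := by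
  unfold LevelStable at hN
  push Not at hN
  obtain ⟨a, b, ha, hb, hab, hJ0, hJ1⟩ := hN
  have hFc := hF.continuous
  set Bd : Set ℝ := {τ ∈ Set.Icc (0 : ℝ) 1 | ¬ SegLift F (a τ) (b τ)} with hBd
  have hBc : IsCompact Bd := by
    refine isCompact_Icc.of_isClosed_subset ?_ (fun x hx => hx.1)
    rw [← isOpen_compl_iff, isOpen_iff_mem_nhds]
    intro τ hτ
    by_cases hI : τ ∈ Set.Icc (0 : ℝ) 1
    · have hJ : SegLift F (a τ) (b τ) := by
        by_contra h
        exact hτ ⟨hI, h⟩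
      have h1 : Tendsto (fun σ => (a σ, b σ)) (𝓝[Set.Icc 0 1] τ) (𝓝 (a τ, b τ)) :=
        (ha τ hI).prodMk_nhds (hb τ hI)
      have h2 := h1.eventually (hF.segLift_eventually hJ)
      rw [eventually_nhdsWithin_iff] at h2
      filter_upwards [h2] with σ hσ hc
      exact hc.2 (hσ hc.1)
    · filter_upwards [isClosed_Icc.isOpen_compl.mem_nhds hI] with σ hσ hc
      exact hσ hc.1
  obtain ⟨τ0, ⟨hτ0, hτJ⟩, hmin⟩ := hBc.exists_isLeast ⟨1, by simp, hJ1⟩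
  have hτpos : 0 < τ0 := by
    rcases hτ0.1.eq_or_lt with h | h
    · rw [← h] at hτJ; exact absurd hJ0 hτJ
    · exact h
  have hgood : ∀ σ : Set.Ico (0 : ℝ) τ0, SegLift F (a σ) (b σ) := by
    rintro ⟨σ, hσ⟩
    by_contra hc
    exact absurd (hmin ⟨⟨hσ.1, hσ.2.le.trans hτ0.2⟩, hc⟩) (not_le.2 hσ.2)
  choose γ g0 g1 g using hgood
  have hsub : ∀ σ : Set.Ico (0 : ℝ) τ0, (σ : ℝ) ∈ Set.Icc (0 : ℝ) 1 :=
    fun σ => ⟨σ.2.1, σ.2.2.le.trans hτ0.2⟩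
  obtain ⟨Ca, hCa⟩ := isCompact_Icc.exists_bound_of_continuousOn ha
  obtain ⟨Cb, hCb⟩ := isCompact_Icc.exists_bound_of_continuousOn hb
  obtain ⟨Da, hDa⟩ := isCompact_Icc.exists_bound_of_continuousOn (hFc.comp_continuousOn ha)
  obtain ⟨Db, hDb⟩ := isCompact_Icc.exists_bound_of_continuousOn (hFc.comp_continuousOn hb)
  refine ⟨{z | ∃ σ r, γ σ r = z}, max Da Db, ?_, ?_, ?_⟩
  · intro hbd
    obtain ⟨R, hR⟩ := hbd.subset_closedBall 0
    apply hτJ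
    set u : ℕ → ℝ := fun n => τ0 * (1 - 1 / ((n : ℝ) + 1)) with hu
    have hun : ∀ n, u n ∈ Set.Ico (0 : ℝ) τ0 := by
      intro n
      have h1 : 0 < 1 / ((n : ℝ) + 1) := by positivity
      have h2 : 1 / ((n : ℝ) + 1) ≤ 1 := by
        rw [div_le_one (by positivity)]
        linarith [Nat.cast_nonneg (α := ℝ) n]
      exact ⟨mul_nonneg hτpos.le (by linarith), by simp only [hu]; nlinarith⟩
    have hut : Tendsto u atTop (𝓝 τ0) := by
      have := (tendsto_one_div_add_atTop_nhds_zero_nat (𝕜 := ℝ)).const_sub 1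
      simpa [hu] using this.const_mul τ0
    have hut' : Tendsto u atTop (𝓝[Set.Icc 0 1] τ0) :=
      tendsto_nhdsWithin_iff.2 ⟨hut, Eventually.of_forall fun n => hsub ⟨u n, hun n⟩⟩
    exact hF.segLift_of_tendsto (isCompact_closedBall 0 R) ((ha τ0 hτ0).tendsto.comp hut')
      ((hb τ0 hτ0).tendsto.comp hut') (fun n => γ ⟨u n, hun n⟩) (fun n => g0 _) (fun n => g1 _)
      (fun n r => g _ r) (fun n r => hR ⟨_, _, rfl⟩)
  · rintro _ ⟨σ, r, rfl⟩
    rw [g]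
    have hcv : Convex ℝ (Metric.closedBall (0 : ℝ × ℝ) (max Da Db)) := convex_closedBall _ _
    have := hcv.lineMap_mem (x := F (a σ)) (y := F (b σ))
      (by rw [mem_closedBall_zero_iff]; exact (hDa σ (hsub σ)).trans (le_max_left _ _))
      (by rw [mem_closedBall_zero_iff]; exact (hDb σ (hsub σ)).trans (le_max_right _ _)) r.2
    rwa [mem_closedBall_zero_iff] at this
  · intro l hl N
    rw [not_bddAbove_iff] at hl
    obtain ⟨_, ⟨_, ⟨σ, r, rfl⟩, rfl⟩, hr⟩ := hl (max N (max (‖l‖ * Ca) (‖l‖ * Cb)))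
    have hlc : Continuous fun r => l (γ σ r) := by fun_prop
    obtain ⟨q, -, hq⟩ := isCompact_univ.exists_isMaxOn Set.univ_nonempty hlc.continuousOn
    have hqmax : ∀ s, l (γ σ s) ≤ l (γ σ q) := fun s => hq (Set.mem_univ s)
    have hbig : max N (max (‖l‖ * Ca) (‖l‖ * Cb)) < l (γ σ q) := hr.trans_le (hqmax r)
    obtain ⟨hb1, hb2⟩ := max_lt_iff.1 hbig
    obtain ⟨hb2, hb3⟩ := max_lt_iff.1 hb2
    have hla : l (a σ) ≤ ‖l‖ * Ca := by
      refine (le_abs_self _).trans ((l.le_opNorm _).trans ?_)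
      exact mul_le_mul_of_nonneg_left (hCa σ (hsub σ)) (norm_nonneg _)
    have hlb : l (b σ) ≤ ‖l‖ * Cb := by
      refine (le_abs_self _).trans ((l.le_opNorm _).trans ?_)
      exact mul_le_mul_of_nonneg_left (hCb σ (hsub σ)) (norm_nonneg _)
    have hq0 : q ≠ 0 := by
      rintro rfl
      rw [g0] at hb2
      linarith
    have hq1 : q ≠ 1 := by
      rintro rfl
      rw [g1] at hb3
      linarith
    have hqI : (q : ℝ) ∈ Set.Ioo (0 : ℝ) 1 :=
      ⟨unitInterval.pos_iff_ne_zero.2 hq0, unitInterval.lt_one_iff_ne_one.2 hq1⟩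
    obtain ⟨F', hF'⟩ := hF (γ σ q)
    have hne : F (b σ) ≠ F (a σ) := by
      intro he
      have := hF.lift_const (γ := γ σ) (fun r => by rw [g, g0, he]; simp) q
      rw [this, g0] at hb2
      linarith
    set w := F (b σ) - F (a σ) with hw
    refine ⟨γ σ q, ⟨σ, q, rfl⟩, hb1, F'.symm w, ?_, ?_, ?_⟩
    · simpa [hw, sub_eq_zero] using hne
    · set c : ℝ → ℝ × ℝ := fun s => hF'.localInverse F F' _ (AffineMap.lineMap (F (a σ)) (F (b σ)) s)
      have hcd : HasDerivAt c (F'.symm w) q := by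
        have h1 : HasDerivAt (fun s : ℝ => (AffineMap.lineMap (F (a σ)) (F (b σ)) s : ℝ × ℝ)) w q := by
          have h := AffineMap.hasDerivAt_lineMap (a := F (a σ)) (b := F (b σ)) (x := (q : ℝ))
          simpa [hw] using h
        have h2 := hF'.to_localInverse.hasFDerivAt
        rw [g σ q] at h2
        exact h2.comp_hasDerivAt (q : ℝ) h1
      have hld : HasDerivAt (fun s => l (c s)) (l (F'.symm w)) q :=
        l.hasFDerivAt.comp_hasDerivAt (q : ℝ) hcd
      refine IsLocalMax.hasDerivAt_eq_zero (a := (q : ℝ)) ?_ hld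
      have hcq : c q = γ σ q := by
        have := hF'.localInverse_apply_image
        rw [g σ q] at this
        exact this
      have hpc : Tendsto (fun s : ℝ => γ σ (Set.projIcc 0 1 zero_le_one s)) (𝓝 (q : ℝ)) (𝓝 (γ σ q)) := by
        have : Continuous (fun s : ℝ => γ σ (Set.projIcc 0 1 zero_le_one s)) :=
          (γ σ).continuous.comp continuous_projIcc
        have := this.tendsto (q : ℝ)
        simpa using this
      have e1 := hpc.eventually hF'.eventually_left_inverse
      filter_upwards [e1, Ioo_mem_nhds hqI.1 hqI.2] with s hs hsI
      have hsm : s ∈ Set.Icc (0 : ℝ) 1 := ⟨hsI.1.le, hsI.2.le⟩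
      rw [Set.projIcc_of_mem _ hsm] at hs
      have : c s = γ σ ⟨s, hsm⟩ := by
        rw [g] at hs
        exact hs
      simp only [this, hcq]
      exact hqmax _
    · rw [hF'.hasFDerivAt.fderiv]
      simp [hw, hab σ (hsub σ)]

/-- The escape alternative for a non-injective local diffeomorphism. -/
theorem exists_unbounded_of_not_injective (hF : LocDiffeo F) (hni : ¬ Function.Injective F)
    (hfin : ∀ p q : ℝ × ℝ, p ≠ q → F p = F q → ∃ Z : Finset ℝ, ∀ s t : ℝ, s < t →
      (F (AffineMap.lineMap p q s)).1 = (F (AffineMap.lineMap p q t)).1 → ∃ z ∈ Z, s < z ∧ z < t) :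
    ∃ (B : Set (ℝ × ℝ)) (M : ℝ), ¬ Bornology.IsBounded B ∧ (∀ z ∈ B, ‖F z‖ ≤ M) ∧
      ∀ l : (ℝ × ℝ) →L[ℝ] ℝ, ¬ BddAbove (l '' B) → ∀ N : ℝ, ∃ z ∈ B, N < l z ∧
        ∃ v : ℝ × ℝ, v ≠ 0 ∧ l v = 0 ∧ (fderiv ℝ F z v).1 = 0 := by
  refine hF.exists_unbounded_of_not_levelStable fun hN => ?_
  unfold Function.Injective at hni
  push Not at hni
  obtain ⟨p, q, hpq, hne⟩ := hni
  obtain ⟨Z, hZ⟩ := hfin p q hne hpq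
  have hα : Continuous fun t : ℝ => (AffineMap.lineMap p q t : ℝ × ℝ) :=
    AffineMap.lineMap_continuous
  have := hF.segLift_of_levelStable hN hα (fun _ => rfl)
    (continuous_fst.comp (hF.continuous.comp hα)) Z hZ _ 0 1 one_pos (by simp [hpq]) rfl
  simp only [AffineMap.lineMap_apply_zero, AffineMap.lineMap_apply_one] at this
  exact hne (hF.segLift_eq this hpq)

end LocDiffeo

/-- Evaluation of a bivariate polynomial. -/
noncomputable def ev (f : MvPolynomial (Fin 2) ℝ) (x y : ℝ) : ℝ := eval ![x, y] f

section ev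

variable (f g : MvPolynomial (Fin 2) ℝ) (x y c : ℝ)

@[simp] theorem ev_add : ev (f + g) x y = ev f x y + ev g x y := by simp [ev]
@[simp] theorem ev_sub : ev (f - g) x y = ev f x y - ev g x y := by simp [ev]
@[simp] theorem ev_mul : ev (f * g) x y = ev f x y * ev g x y := by simp [ev]
@[simp] theorem ev_pow (n : ℕ) : ev (f ^ n) x y = ev f x y ^ n := by simp [ev]
@[simp] theorem ev_C : ev (C c) x y = c := by simp [ev]
@[simp] theorem ev_zero : ev 0 x y = 0 := by simp [ev]
@[simp] theorem ev_one : ev 1 x y = 1 := by simp [ev]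
@[simp] theorem ev_X0 : ev (X 0) x y = x := by simp [ev]
@[simp] theorem ev_X1 : ev (X 1) x y = y := by simp [ev]

theorem ev_eq_eval (p : Fin 2 → ℝ) : ev f (p 0) (p 1) = eval p f := by
  unfold ev
  congr 1
  congr 1
  ext i; fin_cases i <;> rfl

variable {f g} in
theorem eq_of_ev_eq (h : ∀ x y, ev f x y = ev g x y) : f = g :=
  MvPolynomial.funext fun p => by rw [← ev_eq_eval, ← ev_eq_eval, h]

theorem ev_Jac : ev (Jac f g) x y =
    ev (pderiv 0 f) x y * ev (pderiv 1 g) x y - ev (pderiv 1 f) x y * ev (pderiv 0 g) x y := by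
  simp [Jac]

theorem hasStrictFDerivAt_ev (z : ℝ × ℝ) : HasStrictFDerivAt (fun z : ℝ × ℝ => ev f z.1 z.2)
    (ev (pderiv 0 f) z.1 z.2 • ContinuousLinearMap.fst ℝ ℝ ℝ +
      ev (pderiv 1 f) z.1 z.2 • ContinuousLinearMap.snd ℝ ℝ ℝ) z := by
  induction f using MvPolynomial.induction_on with
  | C a => simpa using hasStrictFDerivAt_const a z
  | add p q hp hq =>
    simp only [ev_add, map_add]
    refine (hp.add hq).congr_fderiv ?_
    ext <;> simp
  | mul_X p i hp =>
    fin_cases i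
    · simp only [ev_mul, Fin.zero_eta, ev_X0, pderiv_mul, pderiv_X, ev_add]
      refine (hp.mul (hasStrictFDerivAt_fst (p := z))).congr_fderiv ?_
      ext <;> simp [mul_comm, add_comm]
    · simp only [ev_mul, Fin.mk_one, ev_X1, pderiv_mul, pderiv_X, ev_add]
      refine (hp.mul (hasStrictFDerivAt_snd (p := z))).congr_fderiv ?_
      ext <;> simp [mul_comm, add_comm]

theorem exists_polynomial_line (p q : ℝ × ℝ) : ∃ P : Polynomial ℝ, ∀ t : ℝ,
    P.eval t = ev f (AffineMap.lineMap p q t).1 (AffineMap.lineMap p q t).2 := by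
  induction f using MvPolynomial.induction_on with
  | C a => exact ⟨Polynomial.C a, by simp⟩
  | add f g hf hg =>
    obtain ⟨P, hP⟩ := hf
    obtain ⟨Q, hQ⟩ := hg
    exact ⟨P + Q, by simp [hP, hQ]⟩
  | mul_X f i hf =>
    obtain ⟨P, hP⟩ := hf
    fin_cases i
    · exact ⟨P * (Polynomial.C p.1 + Polynomial.X * Polynomial.C (q.1 - p.1)), fun t => by
        rw [Polynomial.eval_mul, hP]
        simp [AffineMap.lineMap_apply, add_comm]⟩
    · exact ⟨P * (Polynomial.C p.2 + Polynomial.X * Polynomial.C (q.2 - p.2)), fun t => by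
        rw [Polynomial.eval_mul, hP]
        simp [AffineMap.lineMap_apply, add_comm]⟩

end ev

/-- The plane map with the given polynomial components. -/
noncomputable def planeMap (f g : MvPolynomial (Fin 2) ℝ) (z : ℝ × ℝ) : ℝ × ℝ :=
  (ev f z.1 z.2, ev g z.1 z.2)

/-- A counterexample to injectivity with nowhere vanishing Jacobian. -/
def Bad (f g : MvPolynomial (Fin 2) ℝ) : Prop :=
  (∀ x y, ev (Jac f g) x y ≠ 0) ∧ ¬ Function.Injective (planeMap f g)

theorem exists_equiv_of_det_ne_zero {a b c d : ℝ} (h : a * d - b * c ≠ 0) :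
    ∃ F' : (ℝ × ℝ) ≃L[ℝ] (ℝ × ℝ), (F' : (ℝ × ℝ) →L[ℝ] (ℝ × ℝ)) =
      (a • ContinuousLinearMap.fst ℝ ℝ ℝ + b • ContinuousLinearMap.snd ℝ ℝ ℝ).prod
        (c • ContinuousLinearMap.fst ℝ ℝ ℝ + d • ContinuousLinearMap.snd ℝ ℝ ℝ) := by
  set D := a * d - b * c with hD
  refine ⟨ContinuousLinearEquiv.equivOfInverse
    ((a • ContinuousLinearMap.fst ℝ ℝ ℝ + b • ContinuousLinearMap.snd ℝ ℝ ℝ).prod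
        (c • ContinuousLinearMap.fst ℝ ℝ ℝ + d • ContinuousLinearMap.snd ℝ ℝ ℝ))
    (((d / D) • ContinuousLinearMap.fst ℝ ℝ ℝ + (-b / D) • ContinuousLinearMap.snd ℝ ℝ ℝ).prod
      ((-c / D) • ContinuousLinearMap.fst ℝ ℝ ℝ + (a / D) • ContinuousLinearMap.snd ℝ ℝ ℝ))
      ?_ ?_, rfl⟩
  · rintro ⟨x, y⟩
    ext <;> simp <;> field_simp <;> rw [hD] <;> ring
  · rintro ⟨x, y⟩
    ext <;> simp <;> field_simp <;> rw [hD] <;> ring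

theorem hasStrictFDerivAt_planeMap (f g : MvPolynomial (Fin 2) ℝ) (z : ℝ × ℝ) :
    HasStrictFDerivAt (planeMap f g)
      ((ev (pderiv 0 f) z.1 z.2 • ContinuousLinearMap.fst ℝ ℝ ℝ +
        ev (pderiv 1 f) z.1 z.2 • ContinuousLinearMap.snd ℝ ℝ ℝ).prod
      (ev (pderiv 0 g) z.1 z.2 • ContinuousLinearMap.fst ℝ ℝ ℝ +
        ev (pderiv 1 g) z.1 z.2 • ContinuousLinearMap.snd ℝ ℝ ℝ)) z :=
  (hasStrictFDerivAt_ev f z).prodMk (hasStrictFDerivAt_ev g z)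

theorem locDiffeo_planeMap {f g : MvPolynomial (Fin 2) ℝ} (h : ∀ x y, ev (Jac f g) x y ≠ 0) :
    LocDiffeo (planeMap f g) := by
  intro z
  have hz := h z.1 z.2
  rw [ev_Jac] at hz
  obtain ⟨F', hF'⟩ := exists_equiv_of_det_ne_zero hz
  exact ⟨F', hF' ▸ hasStrictFDerivAt_planeMap f g z⟩

/-- A set on which `f` and `g` are bounded, containing tangencies of the level sets of `f` with
coordinate lines arbitrarily far away in every unbounded coordinate. -/
structure Escapes (f g : MvPolynomial (Fin 2) ℝ) (B : Set (ℝ × ℝ)) (M : ℝ) : Prop where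
  unbounded : (∀ N : ℝ, ∃ z ∈ B, N < |z.1|) ∨ ∀ N : ℝ, ∃ z ∈ B, N < |z.2|
  bound_left : ∀ z ∈ B, |ev f z.1 z.2| ≤ M
  bound_right : ∀ z ∈ B, |ev g z.1 z.2| ≤ M
  tangent_fst : (∀ N : ℝ, ∃ z ∈ B, N < |z.1|) →
    ∀ N : ℝ, ∃ z ∈ B, N < |z.1| ∧ ev (pderiv 1 f) z.1 z.2 = 0
  tangent_snd : (∀ N : ℝ, ∃ z ∈ B, N < |z.2|) →
    ∀ N : ℝ, ∃ z ∈ B, N < |z.2| ∧ ev (pderiv 0 f) z.1 z.2 = 0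

theorem Bad.exists_rolle {f g : MvPolynomial (Fin 2) ℝ} (h : Bad f g) {p q : ℝ × ℝ} (hpq : p ≠ q)
    (he : planeMap f g p = planeMap f g q) : ∃ Z : Finset ℝ, ∀ s t : ℝ, s < t →
      (planeMap f g (AffineMap.lineMap p q s)).1 = (planeMap f g (AffineMap.lineMap p q t)).1 →
      ∃ z ∈ Z, s < z ∧ z < t := by
  obtain ⟨P, hP⟩ := exists_polynomial_line f p q
  obtain ⟨Q, hQ⟩ := exists_polynomial_line g p q
  have hderiv : ∀ t, (planeMap f g) (AffineMap.lineMap p q t) = (P.eval t, Q.eval t) := by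
    intro t; simp [planeMap, hP, hQ]
  by_cases hd : P.derivative = 0
  · exfalso
    have h0 := hderiv 0
    have h1 := hderiv 1
    simp only [AffineMap.lineMap_apply_zero, AffineMap.lineMap_apply_one] at h0 h1
    have hQ01 : Q.eval 0 = Q.eval 1 := by
      have := h0.symm.trans (he.trans h1)
      simpa using (Prod.ext_iff.1 this).2
    obtain ⟨c, hc, hcd⟩ := exists_hasDerivAt_eq_zero (f := fun t => Q.eval t)
      (f' := fun t => Q.derivative.eval t) one_pos Q.continuous.continuousOn hQ01
      (fun x _ => Q.hasDerivAt x)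
    obtain ⟨F', hF'⟩ := locDiffeo_planeMap h.1 (AffineMap.lineMap p q c)
    have hα : HasDerivAt (fun s : ℝ => (AffineMap.lineMap p q s : ℝ × ℝ)) (q - p) c := by
      simpa using AffineMap.hasDerivAt_lineMap (a := p) (b := q) (x := c)
    have h1 := hF'.hasFDerivAt.comp_hasDerivAt c hα
    have h2 : HasDerivAt (fun t => (P.eval t, Q.eval t)) (P.derivative.eval c, Q.derivative.eval c) c :=
      (P.hasDerivAt c).prodMk (Q.hasDerivAt c)
    have h3 : (planeMap f g ∘ fun s : ℝ => (AffineMap.lineMap p q s : ℝ × ℝ)) =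
      fun t => (P.eval t, Q.eval t) := _root_.funext hderiv
    rw [h3] at h1
    have h4 := h1.unique h2
    rw [hcd, hd, Polynomial.eval_zero] at h4
    have h5 : F' (q - p) = 0 := h4
    rw [map_eq_zero_iff F' F'.injective, sub_eq_zero] at h5
    exact hpq h5.symm
  · refine ⟨P.derivative.roots.toFinset, fun s t hst hv => ?_⟩
    rw [hderiv, hderiv] at hv
    obtain ⟨c, hc, hcd⟩ := exists_hasDerivAt_eq_zero (f := fun t => P.eval t)
      (f' := fun t => P.derivative.eval t) hst P.continuous.continuousOn hv
      (fun x _ => P.hasDerivAt x)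
    exact ⟨c, by simp [hd, hcd], hc.1, hc.2⟩

theorem Bad.exists_escapes {f g : MvPolynomial (Fin 2) ℝ} (h : Bad f g) :
    ∃ B M, Escapes f g B M := by
  obtain ⟨B, M, h1, h2, h3⟩ := (locDiffeo_planeMap h.1).exists_unbounded_of_not_injective h.2
    (fun p q hpq he => h.exists_rolle hpq he)
  have hfd : ∀ z v, (fderiv ℝ (planeMap f g) z v).1 =
      ev (pderiv 0 f) z.1 z.2 * v.1 + ev (pderiv 1 f) z.1 z.2 * v.2 := by
    intro z v
    rw [(hasStrictFDerivAt_planeMap f g z).hasFDerivAt.fderiv]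
    simp
  refine ⟨B, M, ?_, ?_, ?_, ?_, ?_⟩
  · by_contra! hcon
    obtain ⟨⟨N1, hN1⟩, N2, hN2⟩ := hcon
    refine h1 ((Metric.isBounded_iff_subset_closedBall 0).2 ⟨max N1 N2, fun z hz => ?_⟩)
    rw [mem_closedBall_zero_iff, Prod.norm_def]
    exact max_le_max (hN1 z hz) (hN2 z hz)
  · intro z hz
    exact (le_max_left _ _).trans (h2 z hz)
  · intro z hz
    exact (le_max_right _ _).trans (h2 z hz)
  · intro hu N
    have hl : ∃ l : (ℝ × ℝ) →L[ℝ] ℝ, ¬ BddAbove (l '' B) ∧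
        (l = ContinuousLinearMap.fst ℝ ℝ ℝ ∨ l = - ContinuousLinearMap.fst ℝ ℝ ℝ) := by
      by_contra! hcon
      have hb1 : BddAbove (ContinuousLinearMap.fst ℝ ℝ ℝ '' B) := by
        by_contra hb; exact (hcon _ hb).1 rfl
      have hb2 : BddAbove ((-ContinuousLinearMap.fst ℝ ℝ ℝ) '' B) := by
        by_contra hb; exact (hcon _ hb).2 rfl
      obtain ⟨C1, hC1⟩ := hb1
      obtain ⟨C2, hC2⟩ := hb2
      obtain ⟨z, hz, hzN⟩ := hu (max C1 C2)
      have e1 : z.1 ≤ C1 := hC1 ⟨z, hz, rfl⟩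
      have e2 : -z.1 ≤ C2 := hC2 ⟨z, hz, rfl⟩
      exact absurd hzN (not_lt.2 (abs_le'.2 ⟨e1.trans (le_max_left _ _), e2.trans (le_max_right _ _)⟩))
    obtain ⟨l, hlb, hl⟩ := hl
    obtain ⟨z, hz, hzN, v, hv0, hlv, hdv⟩ := h3 l hlb N
    have hv1 : v.1 = 0 ∧ N < |z.1| := by
      rcases hl with rfl | rfl
      · exact ⟨hlv, hzN.trans_le (le_abs_self _)⟩
      · exact ⟨by simpa using hlv, hzN.trans_le (neg_le_abs _)⟩
    refine ⟨z, hz, hv1.2, ?_⟩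
    have hv2 : v.2 ≠ 0 := fun h0 => hv0 (Prod.ext hv1.1 h0)
    rw [hfd, hv1.1, mul_zero, zero_add] at hdv
    exact (mul_eq_zero.1 hdv).resolve_right hv2
  · intro hu N
    have hl : ∃ l : (ℝ × ℝ) →L[ℝ] ℝ, ¬ BddAbove (l '' B) ∧
        (l = ContinuousLinearMap.snd ℝ ℝ ℝ ∨ l = - ContinuousLinearMap.snd ℝ ℝ ℝ) := by
      by_contra! hcon
      have hb1 : BddAbove (ContinuousLinearMap.snd ℝ ℝ ℝ '' B) := by
        by_contra hb; exact (hcon _ hb).1 rfl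
      have hb2 : BddAbove ((-ContinuousLinearMap.snd ℝ ℝ ℝ) '' B) := by
        by_contra hb; exact (hcon _ hb).2 rfl
      obtain ⟨C1, hC1⟩ := hb1
      obtain ⟨C2, hC2⟩ := hb2
      obtain ⟨z, hz, hzN⟩ := hu (max C1 C2)
      have e1 : z.2 ≤ C1 := hC1 ⟨z, hz, rfl⟩
      have e2 : -z.2 ≤ C2 := hC2 ⟨z, hz, rfl⟩
      exact absurd hzN (not_lt.2 (abs_le'.2 ⟨e1.trans (le_max_left _ _), e2.trans (le_max_right _ _)⟩))
    obtain ⟨l, hlb, hl⟩ := hl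
    obtain ⟨z, hz, hzN, v, hv0, hlv, hdv⟩ := h3 l hlb N
    have hv1 : v.2 = 0 ∧ N < |z.2| := by
      rcases hl with rfl | rfl
      · exact ⟨hlv, hzN.trans_le (le_abs_self _)⟩
      · exact ⟨by simpa using hlv, hzN.trans_le (neg_le_abs _)⟩
    refine ⟨z, hz, hv1.2, ?_⟩
    have hv2 : v.1 ≠ 0 := fun h0 => hv0 (Prod.ext h0 hv1.1)
    rw [hfd, hv1.1, mul_zero, add_zero] at hdv
    exact (mul_eq_zero.1 hdv).resolve_right hv2

/-- The weight of an exponent vector, for the weights `-p` of the first variable and `q` of the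
second. -/
def wt (p q : ℤ) (d : Fin 2 →₀ ℕ) : ℤ := q * d 1 - p * d 0

/-- The part of weight `e` of a polynomial, restricted to the line `y = ε`. -/
noncomputable def lead (p q e : ℤ) (ε : ℝ) (f : MvPolynomial (Fin 2) ℝ) : Polynomial ℝ :=
  ∑ d ∈ f.support, if wt p q d = e then Polynomial.monomial (d 0) (coeff d f * ε ^ d 1) else 0

/-- The Euler operator of the weights `-p`, `q`. -/
noncomputable def euler (p q : ℤ) (f : MvPolynomial (Fin 2) ℝ) : MvPolynomial (Fin 2) ℝ :=
  C (q : ℝ) * (X 1 * pderiv 1 f) - C (p : ℝ) * (X 0 * pderiv 0 f)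

section weights

variable {p q a b e : ℤ} {ε σ : ℝ} {f g : MvPolynomial (Fin 2) ℝ}

theorem lead_eq_sum {S : Finset (Fin 2 →₀ ℕ)} (h : f.support ⊆ S) : lead p q e ε f =
    ∑ d ∈ S, if wt p q d = e then Polynomial.monomial (d 0) (coeff d f * ε ^ d 1) else 0 :=
  Finset.sum_subset h fun d _ hd => by simp [notMem_support_iff.1 hd]

theorem tendsto_lead {ι : Type*} {l : Filter ι} {t s : ι → ℝ} {s0 : ℝ}
    (hw : ∀ d ∈ f.support, wt p q d ≤ e) (ht0 : ∀ᶠ n in l, 0 < t n) (ht : Tendsto t l (𝓝 0))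
    (hs : Tendsto s l (𝓝 s0)) :
    Tendsto (fun n => t n ^ e * ev f (s n * t n ^ p) (ε * t n ^ (-q))) l
      (𝓝 ((lead p q e ε f).eval s0)) := by
  have h1 : ∀ᶠ n in l, ∑ d ∈ f.support, coeff d f * ε ^ d 1 * s n ^ d 0 * t n ^ (e - wt p q d).toNat =
      t n ^ e * ev f (s n * t n ^ p) (ε * t n ^ (-q)) := by
    filter_upwards [ht0] with n hn
    unfold ev
    rw [eval_eq', Finset.mul_sum]
    refine Finset.sum_congr rfl fun d hd => ?_
    have hz : t n ^ (e - wt p q d).toNat = t n ^ e * (t n ^ p) ^ d 0 * (t n ^ (-q)) ^ d 1 := by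
      have hpos : 0 ≤ e - wt p q d := by linarith [hw d hd]
      rw [← zpow_natCast, Int.toNat_of_nonneg hpos, ← zpow_natCast (t n ^ p), ← zpow_mul,
        ← zpow_natCast (t n ^ (-q)), ← zpow_mul, ← zpow_add₀ hn.ne', ← zpow_add₀ hn.ne']
      congr 1
      simp only [wt]; ring
    rw [hz]
    simp [Fin.prod_univ_two, mul_pow]
    ring
  refine Tendsto.congr' h1 ?_
  unfold lead
  rw [Polynomial.eval_finsetSum]
  refine tendsto_finsetSum _ fun d hd => ?_
  have h2 := (((hs.pow (d 0)).const_mul (coeff d f * ε ^ d 1))).mul (ht.pow (e - wt p q d).toNat)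
  convert h2 using 2
  split_ifs with h
  · simp [h]
  · have : (e - wt p q d).toNat ≠ 0 := by
      have := hw d hd
      omega
    simp [this]

theorem coeff_X_mul_pderiv (i : Fin 2) (d : Fin 2 →₀ ℕ) :
    coeff d (X i * pderiv i f) = d i * coeff d f := by
  induction f using MvPolynomial.induction_on' with
  | monomial u a =>
    rw [X_mul_pderiv_monomial]
    rw [coeff_smul, coeff_monomial]
    split_ifs with h
    · simp [h]
    · simp
  | add f g hf hg => simp only [map_add, mul_add, coeff_add, hf, hg]

theorem coeff_euler (d : Fin 2 →₀ ℕ) : coeff d (euler p q f) = wt p q d * coeff d f := by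
  simp only [euler, coeff_sub, coeff_C_mul, coeff_X_mul_pderiv, wt]
  push_cast
  ring

theorem support_X_mul_pderiv (i : Fin 2) : (X i * pderiv i f).support ⊆ f.support := by
  intro d hd
  rw [mem_support_iff, coeff_X_mul_pderiv] at hd
  exact mem_support_iff.2 (right_ne_zero_of_mul hd)

theorem support_euler : (euler p q f).support ⊆ f.support := by
  intro d hd
  rw [mem_support_iff, coeff_euler] at hd
  exact mem_support_iff.2 (right_ne_zero_of_mul hd)

theorem lead_euler : lead p q e ε (euler p q f) = Polynomial.C (e : ℝ) * lead p q e ε f := by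
  rw [lead_eq_sum support_euler, lead, Finset.mul_sum]
  refine Finset.sum_congr rfl fun d _ => ?_
  split_ifs with h
  · rw [coeff_euler, h, Polynomial.C_mul_monomial, mul_assoc]
  · simp

theorem lead_X_mul_pderiv : lead p q e ε (X 0 * pderiv 0 f) =
    Polynomial.X * Polynomial.derivative (lead p q e ε f) := by
  rw [lead_eq_sum (support_X_mul_pderiv 0), lead, Polynomial.derivative_sum, Finset.mul_sum]
  refine Finset.sum_congr rfl fun d _ => ?_
  split_ifs with h
  · rw [coeff_X_mul_pderiv, Polynomial.derivative_monomial]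
    rcases Nat.eq_zero_or_pos (d 0) with h0 | h0
    · simp [h0]
    · rw [Polynomial.X_mul_monomial, Nat.sub_add_cancel h0]
      congr 1
      ring
  · simp

theorem coeff_lead (hq : 1 ≤ q) {d : Fin 2 →₀ ℕ} (hd : wt p q d = e) :
    (lead p q e ε f).coeff (d 0) = coeff d f * ε ^ d 1 := by
  classical
  rw [lead, Polynomial.finsetSum_coeff, Finset.sum_eq_single d]
  · simp [hd]
  · intro u _ hu
    split_ifs with h
    · rw [Polynomial.coeff_monomial, if_neg]
      intro h0
      apply hu
      have h1 : q * (u 1 : ℤ) = q * d 1 := by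
        simp only [wt] at h hd
        rw [h0] at h
        linarith
      have h2 : (u 1 : ℤ) = d 1 := mul_left_cancel₀ (by omega) h1
      ext i; fin_cases i
      · exact h0
      · exact_mod_cast h2
    · simp
  · intro h
    simp [notMem_support_iff.1 h]

theorem coeff_lead_of_forall_ne {i : ℕ} (h : ∀ j : ℕ, q * j - p * i ≠ e) :
    (lead p q e ε f).coeff i = 0 := by
  rw [lead, Polynomial.finsetSum_coeff]
  refine Finset.sum_eq_zero fun d _ => ?_
  split_ifs with hd
  · rw [Polynomial.coeff_monomial, if_neg]
    rintro rfl
    exact h (d 1) hd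
  · simp

/-- The leading weighted part of the Jacobian has weakly constant sign. -/
theorem lead_jac_nonneg (hJ : ∀ x y, 0 < σ * ev (Jac f g) x y) (hq : 1 ≤ q)
    (hf : ∀ d ∈ f.support, wt p q d ≤ a) (hg : ∀ d ∈ g.support, wt p q d ≤ b)
    (s : ℝ) : 0 ≤ σ * ε * (b * (lead p q a ε f).derivative.eval s * (lead p q b ε g).eval s -
      a * (lead p q a ε f).eval s * (lead p q b ε g).derivative.eval s) := by
  set A := lead p q a ε f
  set G := lead p q b ε g
  have main : ∀ s : ℝ, s ≠ 0 → 0 ≤ σ * ε * (b * A.derivative.eval s * G.eval s -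
      a * A.eval s * G.derivative.eval s) := by
    intro s hs
    set t : ℕ → ℝ := fun n => 1 / ((n : ℝ) + 1)
    have htp : ∀ n, 0 < t n := fun n => by positivity
    have ht0 : ∀ᶠ n in atTop, 0 < t n := Eventually.of_forall htp
    have ht : Tendsto t atTop (𝓝 0) := tendsto_one_div_add_atTop_nhds_zero_nat
    have l1 := tendsto_lead (ε := ε) (f := X 0 * pderiv 0 f)
      (fun d hd => hf d (support_X_mul_pderiv 0 hd)) ht0 ht (tendsto_const_nhds (x := s))
    have l2 := tendsto_lead (ε := ε) (f := X 0 * pderiv 0 g)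
      (fun d hd => hg d (support_X_mul_pderiv 0 hd)) ht0 ht (tendsto_const_nhds (x := s))
    have l3 := tendsto_lead (ε := ε) (f := euler p q f)
      (fun d hd => hf d (support_euler hd)) ht0 ht (tendsto_const_nhds (x := s))
    have l4 := tendsto_lead (ε := ε) (f := euler p q g)
      (fun d hd => hg d (support_euler hd)) ht0 ht (tendsto_const_nhds (x := s))
    rw [lead_X_mul_pderiv] at l1 l2
    rw [lead_euler] at l3 l4
    have l5 := ((l1.mul l4).sub (l3.mul l2)).const_mul (σ * ε * s)
    have h0 := ge_of_tendsto l5 (b := 0) (Eventually.of_forall fun n => ?_)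
    · simp only [Polynomial.eval_mul, Polynomial.eval_X, Polynomial.eval_C] at h0
      have h1 : 0 < s ^ 2 := by positivity
      refine nonneg_of_mul_nonneg_right (a := s ^ 2) ?_ h1
      refine h0.trans_eq ?_
      ring
    · set x := s * t n ^ p
      set y := ε * t n ^ (-q)
      have hJxy := hJ x y
      rw [ev_Jac] at hJxy
      have hqr : (0 : ℝ) ≤ q := by exact_mod_cast (by omega : (0 : ℤ) ≤ q)
      have hta : 0 < t n ^ a := zpow_pos (htp n) a
      have htb : 0 < t n ^ b := zpow_pos (htp n) b
      have htpp : 0 < t n ^ p := zpow_pos (htp n) p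
      have htq : 0 < t n ^ (-q) := zpow_pos (htp n) (-q)
      have : 0 ≤ t n ^ a * t n ^ b * t n ^ p * t n ^ (-q) * q * (s ^ 2 * ε ^ 2) *
        (σ * (ev (pderiv 0 f) x y * ev (pderiv 1 g) x y - ev (pderiv 1 f) x y * ev (pderiv 0 g) x y)) := by
        positivity
      refine this.trans_eq ?_
      simp only [euler, ev_sub, ev_mul, ev_C, ev_X0, ev_X1]
      simp only [x, y]
      ring
  have hcl : IsClosed {s : ℝ | 0 ≤ σ * ε * (b * A.derivative.eval s * G.eval s -
      a * A.eval s * G.derivative.eval s)} :=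
    isClosed_le continuous_const (by fun_prop)
  have hd : Dense ({0}ᶜ : Set ℝ) := dense_compl_singleton 0
  have := hcl.closure_subset_iff.2 (show ({0}ᶜ : Set ℝ) ⊆ _ from fun s hs => main s hs)
  exact this (hd s)

theorem lead_neg_one (hp : p = 1 ∨ p = -1) : lead p 1 e (-1) f =
    Polynomial.C ((-1) ^ e) * (lead p 1 e 1 f).comp (-Polynomial.X) := by
  rw [lead, lead, Polynomial.sum_comp, Finset.mul_sum]
  refine Finset.sum_congr rfl fun d _ => ?_
  split_ifs with h
  · rw [Polynomial.monomial_comp, neg_pow, ← Polynomial.C_mul_X_pow_eq_monomial, one_pow, mul_one]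
    have h1 : ((-1 : ℝ)) ^ d 1 = (-1) ^ e * (-1) ^ d 0 := by
      rw [← zpow_natCast, ← zpow_natCast, ← zpow_add₀ (by norm_num)]
      have h2 : e + d 0 = d 1 + (if p = 1 then 0 else 2 * (d 0 : ℤ)) := by
        simp only [wt] at h
        rcases hp with rfl | rfl
        · simp; linarith
        · simp; linarith
      rw [h2, zpow_add₀ (by norm_num)]
      split_ifs
      · simp
      · rw [zpow_mul]; norm_num
    rw [h1]
    simp only [Polynomial.C_mul, Polynomial.C_pow, Polynomial.C_neg, Polynomial.C_1]
    ring
  · simp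

/-- If the leading part of the Jacobian has odd degree in the sense of weights, it vanishes. -/
theorem lead_jac_eq_zero (hJ : ∀ x y, 0 < σ * ev (Jac f g) x y) (hp : p = 1 ∨ p = -1)
    (hf : ∀ d ∈ f.support, wt p 1 d ≤ a) (hg : ∀ d ∈ g.support, wt p 1 d ≤ b) (hab : Odd (a + b)) :
    Polynomial.C (b : ℝ) * (lead p 1 a 1 f).derivative * lead p 1 b 1 g =
      Polynomial.C (a : ℝ) * lead p 1 a 1 f * (lead p 1 b 1 g).derivative := by
  have hσ : σ ≠ 0 := by
    rintro rfl
    simpa using hJ 0 0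
  refine Polynomial.funext fun s => ?_
  have h1 := lead_jac_nonneg (ε := 1) hJ le_rfl hf hg s
  have h2 := lead_jac_nonneg (ε := -1) hJ le_rfl hf hg (-s)
  rw [lead_neg_one hp, lead_neg_one hp] at h2
  simp only [Polynomial.derivative_mul, Polynomial.derivative_C, zero_mul, zero_add,
    Polynomial.derivative_comp, Polynomial.eval_mul, Polynomial.eval_C, Polynomial.eval_comp,
    Polynomial.eval_neg, Polynomial.eval_X, Polynomial.derivative_neg, Polynomial.derivative_X,
    Polynomial.eval_one, neg_neg] at h2
  have h3 : ((-1 : ℝ) ^ a) * (-1) ^ b = -1 := by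
    rw [← zpow_add₀ (by norm_num), hab.neg_one_zpow]
  simp only [Polynomial.eval_mul, Polynomial.eval_C]
  set A := (lead p 1 a 1 f).eval s
  set A' := (lead p 1 a 1 f).derivative.eval s
  set G := (lead p 1 b 1 g).eval s
  set G' := (lead p 1 b 1 g).derivative.eval s
  set u : ℝ := (-1) ^ a
  set v : ℝ := (-1) ^ b
  have h4 : 0 ≤ (u * v) * (σ * (b * A' * G - a * A * G')) := by
    refine h2.trans_eq ?_
    ring
  rw [h3] at h4
  have h5 : σ * (b * A' * G - a * A * G') = 0 := by linarith
  exact sub_eq_zero.1 ((mul_eq_zero.1 h5).resolve_left hσ)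

end weights

/-- A weighted logarithmic derivative of weakly constant sign leaves room for only one zero. -/
theorem Polynomial.not_two_roots {A G : Polynomial ℝ} (hA : A ≠ 0) (hG : G ≠ 0) {m k : ℕ}
    (hm : 0 < m) (hk : 0 < k) {σ : ℝ} (hσ : σ ≠ 0)
    (h : ∀ s, 0 ≤ σ * (m * A.derivative.eval s * G.eval s + k * A.eval s * G.derivative.eval s))
    {r1 r2 : ℝ} (hr : r1 ≠ r2) (h1 : (A * G).eval r1 = 0) (h2 : (A * G).eval r2 = 0) : False := by
  wlog hlt : r1 < r2 generalizing r1 r2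
  · exact this hr.symm h2 h1 (lt_of_le_of_ne (not_lt.1 hlt) hr.symm)
  have hAG : A * G ≠ 0 := mul_ne_zero hA hG
  set R := (A * G).roots.toFinset.filter (r1 < ·) with hR
  have hRne : R.Nonempty := ⟨r2, by simp [hR, hAG, hlt, Polynomial.IsRoot, h2]⟩
  set r := R.min' hRne
  obtain ⟨hr0, hr1⟩ := Finset.mem_filter.1 (R.min'_mem hRne)
  have hr0 : (A * G).eval r = 0 := by simpa [hAG, -Polynomial.eval_mul] using hr0
  have hne : ∀ s ∈ Set.Ioo r1 r, (A * G).eval s ≠ 0 := by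
    intro s hs he
    have := R.min'_le s (by simp [hR, hs.1, hAG, -Polynomial.eval_mul, he])
    exact absurd hs.2 (not_lt.2 this)
  set Φ := A ^ (2 * m) * G ^ (2 * k) with hΦ
  have hΦd : ∀ s, σ * Φ.derivative.eval s = 2 * (A.eval s ^ (2 * (m - 1)) * G.eval s ^ (2 * (k - 1))) *
      ((A * G).eval s) *
      (σ * (m * A.derivative.eval s * G.eval s + k * A.eval s * G.derivative.eval s)) := by
    intro s
    obtain ⟨m, rfl⟩ := Nat.exists_eq_succ_of_ne_zero hm.ne'
    obtain ⟨k, rfl⟩ := Nat.exists_eq_succ_of_ne_zero hk.ne'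
    simp only [hΦ, Polynomial.derivative_mul, Polynomial.derivative_pow, Polynomial.eval_add,
      Polynomial.eval_mul, Polynomial.eval_pow, Polynomial.eval_C, Nat.succ_eq_add_one,
      Nat.add_sub_cancel, show 2 * (m + 1) = 2 * m + 2 by omega,
      show 2 * (k + 1) = 2 * k + 2 by omega]
    push_cast
    ring
  have hsgn : (∀ s ∈ Set.Ioo r1 r, 0 ≤ σ * Φ.derivative.eval s) ∨
      (∀ s ∈ Set.Ioo r1 r, σ * Φ.derivative.eval s ≤ 0) := by
    have hcase : (∀ s ∈ Set.Ioo r1 r, 0 < (A * G).eval s) ∨ (∀ s ∈ Set.Ioo r1 r, (A * G).eval s < 0) := by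
      by_contra! hcon
      obtain ⟨⟨u, hu, hu'⟩, ⟨v, hv, hv'⟩⟩ := hcon
      obtain ⟨w, hw, hwe⟩ := isPreconnected_Ioo.intermediate_value hu hv
        (A * G).continuous.continuousOn ⟨hu', hv'⟩
      exact hne w hw hwe
    have hsq : ∀ s, 0 ≤ 2 * (A.eval s ^ (2 * (m - 1)) * G.eval s ^ (2 * (k - 1))) := by
      intro s
      simp only [pow_mul]
      positivity
    rcases hcase with hc | hc
    · left; intro s hs
      rw [hΦd]
      exact mul_nonneg (mul_nonneg (hsq s) (hc s hs).le) (h s)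
    · right; intro s hs
      rw [hΦd]
      exact mul_nonpos_of_nonpos_of_nonneg (mul_nonpos_of_nonneg_of_nonpos (hsq s) (hc s hs).le) (h s)
  have hz : ∀ s, (A * G).eval s = 0 → Φ.eval s = 0 := by
    intro s hs
    rw [Polynomial.eval_mul, mul_eq_zero] at hs
    simp only [hΦ, Polynomial.eval_mul, Polynomial.eval_pow]
    rcases hs with hs | hs
    · rw [hs, zero_pow (by omega), zero_mul]
    · rw [hs, zero_pow (by omega), mul_zero]
  set c := (r1 + r) / 2
  have hc : c ∈ Set.Ioo r1 r := ⟨by simp only [c]; linarith, by simp only [c]; linarith⟩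
  have hΦc : σ * Φ.eval c = 0 := by
    have hder : ∀ x, HasDerivAt (fun x => σ * Φ.eval x) (σ * Φ.derivative.eval x) x :=
      fun x => (Φ.hasDerivAt x).const_mul σ
    have hcont : ContinuousOn (fun x => σ * Φ.eval x) (Set.Icc r1 r) := by fun_prop
    have e1 : σ * Φ.eval r1 = 0 := by rw [hz r1 h1, mul_zero]
    have e2 : σ * Φ.eval r = 0 := by rw [hz r hr0, mul_zero]
    rcases hsgn with hs | hs
    · have hm : MonotoneOn (fun x => σ * Φ.eval x) (Set.Icc r1 r) :=
        monotoneOn_of_deriv_nonneg (convex_Icc _ _) hcont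
          (fun x _ => (hder x).differentiableAt.differentiableWithinAt)
          (fun x hx => by rw [(hder x).deriv]; exact hs x (by simpa using hx))
      have a1 := hm (Set.left_mem_Icc.2 hr1.le) ⟨hc.1.le, hc.2.le⟩ hc.1.le
      have a2 := hm ⟨hc.1.le, hc.2.le⟩ (Set.right_mem_Icc.2 hr1.le) hc.2.le
      simp only [e1, e2] at a1 a2
      exact le_antisymm a2 a1
    · have hm : AntitoneOn (fun x => σ * Φ.eval x) (Set.Icc r1 r) :=
        antitoneOn_of_deriv_nonpos (convex_Icc _ _) hcont
          (fun x _ => (hder x).differentiableAt.differentiableWithinAt)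
          (fun x hx => by rw [(hder x).deriv]; exact hs x (by simpa using hx))
      have a1 := hm (Set.left_mem_Icc.2 hr1.le) ⟨hc.1.le, hc.2.le⟩ hc.1.le
      have a2 := hm ⟨hc.1.le, hc.2.le⟩ (Set.right_mem_Icc.2 hr1.le) hc.2.le
      simp only [e1, e2] at a1 a2
      exact le_antisymm a1 a2
  have hΦc' : Φ.eval c = 0 := (mul_eq_zero.1 hΦc).resolve_left hσ
  have := hne c hc
  rw [Polynomial.eval_mul] at this
  simp only [hΦ, Polynomial.eval_mul, Polynomial.eval_pow, mul_eq_zero, pow_eq_zero_iff',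
    ne_eq] at hΦc'
  rcases hΦc' with h | h
  · exact this (by rw [h.1, zero_mul])
  · exact this (by rw [h.1, mul_zero])

/-- The exponent vector with the given entries. -/
noncomputable def mkExp (i j : ℕ) : Fin 2 →₀ ℕ := Finsupp.single 0 i + Finsupp.single 1 j

@[simp] theorem mkExp_zero (i j : ℕ) : mkExp i j 0 = i := by simp [mkExp]
@[simp] theorem mkExp_one (i j : ℕ) : mkExp i j 1 = j := by simp [mkExp]
theorem mkExp_self (d : Fin 2 →₀ ℕ) : mkExp (d 0) (d 1) = d := by
  ext i; fin_cases i <;> simp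

/-- The quintic with the given coefficients, as a function. -/
def quintic (a : ℕ → ℕ → ℝ) (x y : ℝ) : ℝ :=
  a 0 0 + a 1 0 * x + a 0 1 * y + a 2 0 * x ^ 2 + a 1 1 * x * y + a 0 2 * y ^ 2 +
  a 3 0 * x ^ 3 + a 2 1 * x ^ 2 * y + a 1 2 * x * y ^ 2 + a 0 3 * y ^ 3 +
  a 4 0 * x ^ 4 + a 3 1 * x ^ 3 * y + a 2 2 * x ^ 2 * y ^ 2 + a 1 3 * x * y ^ 3 + a 0 4 * y ^ 4 +
  a 5 0 * x ^ 5 + a 4 1 * x ^ 4 * y + a 3 2 * x ^ 3 * y ^ 2 + a 2 3 * x ^ 2 * y ^ 3 +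
  a 1 4 * x * y ^ 4 + a 0 5 * y ^ 5

/-- The first partial derivative of `quintic`. -/
def quinticX (a : ℕ → ℕ → ℝ) (x y : ℝ) : ℝ :=
  a 1 0 + 2 * a 2 0 * x + a 1 1 * y +
  3 * a 3 0 * x ^ 2 + 2 * a 2 1 * x * y + a 1 2 * y ^ 2 +
  4 * a 4 0 * x ^ 3 + 3 * a 3 1 * x ^ 2 * y + 2 * a 2 2 * x * y ^ 2 + a 1 3 * y ^ 3 +
  5 * a 5 0 * x ^ 4 + 4 * a 4 1 * x ^ 3 * y + 3 * a 3 2 * x ^ 2 * y ^ 2 + 2 * a 2 3 * x * y ^ 3 +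
  a 1 4 * y ^ 4

/-- The second partial derivative of `quintic`. -/
def quinticY (a : ℕ → ℕ → ℝ) (x y : ℝ) : ℝ :=
  a 0 1 + a 1 1 * x + 2 * a 0 2 * y +
  a 2 1 * x ^ 2 + 2 * a 1 2 * x * y + 3 * a 0 3 * y ^ 2 +
  a 3 1 * x ^ 3 + 2 * a 2 2 * x ^ 2 * y + 3 * a 1 3 * x * y ^ 2 + 4 * a 0 4 * y ^ 3 +
  a 4 1 * x ^ 4 + 2 * a 3 2 * x ^ 3 * y + 3 * a 2 3 * x ^ 2 * y ^ 2 +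
  4 * a 1 4 * x * y ^ 3 + 5 * a 0 5 * y ^ 4

/-- The polynomial `f` has degree at most five, with the given coefficients. -/
def IsQuintic (f : MvPolynomial (Fin 2) ℝ) (a : ℕ → ℕ → ℝ) : Prop := ∀ x y, ev f x y = quintic a x y

/-- The quintic with the given coefficients, as a polynomial. -/
noncomputable def quinticPoly (a : ℕ → ℕ → ℝ) : MvPolynomial (Fin 2) ℝ :=
  ∑ i ∈ Finset.range 6, ∑ j ∈ Finset.range (6 - i), monomial (mkExp i j) (a i j)

theorem coeff_quinticPoly (a : ℕ → ℕ → ℝ) (d : Fin 2 →₀ ℕ) :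
    coeff d (quinticPoly a) = if d 0 + d 1 ≤ 5 then a (d 0) (d 1) else 0 := by
  classical
  simp only [quinticPoly, coeff_sum, coeff_monomial]
  have key : ∀ i j, mkExp i j = d ↔ i = d 0 ∧ j = d 1 := by
    intro i j
    constructor
    · rintro rfl; simp
    · rintro ⟨rfl, rfl⟩; exact mkExp_self d
  simp only [key]
  split_ifs with h
  · rw [Finset.sum_eq_single (d 0), Finset.sum_eq_single (d 1)]
    · simp
    · intro j _ hj; simp [hj]
    · intro hj; simp only [Finset.mem_range, not_lt] at hj; omega
    · intro i _ hi; simp [hi]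
    · intro hj; simp only [Finset.mem_range, not_lt] at hj; omega
  · refine Finset.sum_eq_zero fun i hi => Finset.sum_eq_zero fun j hj => ?_
    simp only [Finset.mem_range] at hi hj
    rw [if_neg]
    rintro ⟨rfl, rfl⟩
    omega

theorem ev_monomial_mkExp (i j : ℕ) (c x y : ℝ) : ev (monomial (mkExp i j) c) x y = c * x ^ i * y ^ j := by
  simp [ev, eval_monomial, Finsupp.prod_fintype, Fin.prod_univ_two, mul_assoc]

theorem ev_sum {ι : Type*} (s : Finset ι) (f : ι → MvPolynomial (Fin 2) ℝ) (x y : ℝ) :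
    ev (∑ i ∈ s, f i) x y = ∑ i ∈ s, ev (f i) x y := by
  simp [ev]

theorem isQuintic_quinticPoly (a : ℕ → ℕ → ℝ) : IsQuintic (quinticPoly a) a := by
  intro x y
  simp only [quinticPoly, ev_sum, ev_monomial_mkExp, quintic]
  simp only [Finset.sum_range_succ, Finset.sum_range_zero, show 6 - 0 = 6 from rfl,
    show 6 - 1 = 5 from rfl, show 6 - 2 = 4 from rfl, show 6 - 3 = 3 from rfl,
    show 6 - 4 = 2 from rfl, show 6 - 5 = 1 from rfl]
  ring

theorem IsQuintic.eq {f : MvPolynomial (Fin 2) ℝ} {a : ℕ → ℕ → ℝ} (h : IsQuintic f a) : f = quinticPoly a :=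
  eq_of_ev_eq fun x y => by rw [h, isQuintic_quinticPoly]

theorem IsQuintic.coeff {f : MvPolynomial (Fin 2) ℝ} {a : ℕ → ℕ → ℝ} (h : IsQuintic f a) (d : Fin 2 →₀ ℕ) :
    coeff d f = if d 0 + d 1 ≤ 5 then a (d 0) (d 1) else 0 := by
  rw [h.eq, coeff_quinticPoly]

theorem IsQuintic.of_totalDegree {f : MvPolynomial (Fin 2) ℝ} (h : f.totalDegree ≤ 5) :
    IsQuintic f fun i j => MvPolynomial.coeff (mkExp i j) f := by
  have : f = quinticPoly fun i j => MvPolynomial.coeff (mkExp i j) f := by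
    ext d
    rw [coeff_quinticPoly, mkExp_self]
    split_ifs with hd
    · rfl
    · apply coeff_eq_zero_of_totalDegree_lt
      have : ∑ i ∈ d.support, d i = d 0 + d 1 := by
        rw [Finset.sum_subset (Finset.subset_univ _), Fin.sum_univ_two]
        intro i _ hi; simpa using hi
      omega
  intro x y
  conv_lhs => rw [this]
  rw [isQuintic_quinticPoly]

theorem IsQuintic.pderiv {f : MvPolynomial (Fin 2) ℝ} {a : ℕ → ℕ → ℝ} (h : IsQuintic f a) (x y : ℝ) :
    ev (pderiv 0 f) x y = quinticX a x y ∧ ev (pderiv 1 f) x y = quinticY a x y := by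
  have hf : HasStrictFDerivAt (fun z : ℝ × ℝ => ev f z.1 z.2) _ (x, y) := hasStrictFDerivAt_ev f (x, y)
  constructor
  · have h1 : HasDerivAt (fun t : ℝ => (t, y)) ((1 : ℝ), (0 : ℝ)) x :=
      (hasDerivAt_id x).prodMk (hasDerivAt_const x y)
    have h2 := hf.hasFDerivAt.comp_hasDerivAt x h1
    have h3 : HasDerivAt (fun t => quintic a t y) (quinticX a x y) x := by
      have e : (fun t => quintic a t y) = fun t => (Polynomial.C (a 0 0 + a 0 1 * y + a 0 2 * y ^ 2 +
          a 0 3 * y ^ 3 + a 0 4 * y ^ 4 + a 0 5 * y ^ 5) +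
        Polynomial.C (a 1 0 + a 1 1 * y + a 1 2 * y ^ 2 + a 1 3 * y ^ 3 + a 1 4 * y ^ 4) * Polynomial.X +
        Polynomial.C (a 2 0 + a 2 1 * y + a 2 2 * y ^ 2 + a 2 3 * y ^ 3) * Polynomial.X ^ 2 +
        Polynomial.C (a 3 0 + a 3 1 * y + a 3 2 * y ^ 2) * Polynomial.X ^ 3 +
        Polynomial.C (a 4 0 + a 4 1 * y) * Polynomial.X ^ 4 +
        Polynomial.C (a 5 0) * Polynomial.X ^ 5).eval t := by
        ext t; simp only [quintic, Polynomial.eval_add, Polynomial.eval_mul, Polynomial.eval_C,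
          Polynomial.eval_X, Polynomial.eval_pow]; ring
      rw [e]
      refine (Polynomial.hasDerivAt _ x).congr_deriv ?_
      simp only [quinticX, Polynomial.derivative_add, Polynomial.derivative_mul,
        Polynomial.derivative_C, Polynomial.derivative_X, Polynomial.derivative_X_pow,
        Polynomial.eval_add, Polynomial.eval_mul, Polynomial.eval_C, Polynomial.eval_X,
        Polynomial.eval_pow, Polynomial.eval_zero, Polynomial.eval_one]
      push_cast
      ring
    have e2 : (fun z : ℝ × ℝ => ev f z.1 z.2) ∘ (fun t : ℝ => (t, y)) = fun t => quintic a t y := by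
      ext t; exact h t y
    rw [e2] at h2
    have := h2.unique h3
    simpa using this
  · have h1 : HasDerivAt (fun t : ℝ => (x, t)) ((0 : ℝ), (1 : ℝ)) y :=
      (hasDerivAt_const y x).prodMk (hasDerivAt_id y)
    have h2 := hf.hasFDerivAt.comp_hasDerivAt y h1
    have h3 : HasDerivAt (fun t => quintic a x t) (quinticY a x y) y := by
      have e : (fun t => quintic a x t) = fun t => (Polynomial.C (a 0 0 + a 1 0 * x + a 2 0 * x ^ 2 +
          a 3 0 * x ^ 3 + a 4 0 * x ^ 4 + a 5 0 * x ^ 5) +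
        Polynomial.C (a 0 1 + a 1 1 * x + a 2 1 * x ^ 2 + a 3 1 * x ^ 3 + a 4 1 * x ^ 4) * Polynomial.X +
        Polynomial.C (a 0 2 + a 1 2 * x + a 2 2 * x ^ 2 + a 3 2 * x ^ 3) * Polynomial.X ^ 2 +
        Polynomial.C (a 0 3 + a 1 3 * x + a 2 3 * x ^ 2) * Polynomial.X ^ 3 +
        Polynomial.C (a 0 4 + a 1 4 * x) * Polynomial.X ^ 4 +
        Polynomial.C (a 0 5) * Polynomial.X ^ 5).eval t := by
        ext t; simp only [quintic, Polynomial.eval_add, Polynomial.eval_mul, Polynomial.eval_C,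
          Polynomial.eval_X, Polynomial.eval_pow]; ring
      rw [e]
      refine (Polynomial.hasDerivAt _ y).congr_deriv ?_
      simp only [quinticY, Polynomial.derivative_add, Polynomial.derivative_mul,
        Polynomial.derivative_C, Polynomial.derivative_X, Polynomial.derivative_X_pow,
        Polynomial.eval_add, Polynomial.eval_mul, Polynomial.eval_C, Polynomial.eval_X,
        Polynomial.eval_pow, Polynomial.eval_zero, Polynomial.eval_one]
      push_cast
      ring
    have e2 : (fun z : ℝ × ℝ => ev f z.1 z.2) ∘ (fun t : ℝ => (x, t)) = fun t => quintic a x t := by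
      ext t; exact h x t
    rw [e2] at h2
    have := h2.unique h3
    simpa using this

theorem IsQuintic.pderiv_zero {f : MvPolynomial (Fin 2) ℝ} {a : ℕ → ℕ → ℝ} (h : IsQuintic f a) (x y : ℝ) :
    ev (MvPolynomial.pderiv 0 f) x y = quinticX a x y := (h.pderiv x y).1

theorem IsQuintic.pderiv_one {f : MvPolynomial (Fin 2) ℝ} {a : ℕ → ℕ → ℝ} (h : IsQuintic f a) (x y : ℝ) :
    ev (MvPolynomial.pderiv 1 f) x y = quinticY a x y := (h.pderiv x y).2

/-! ### Sequences along an ultrafilter -/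

section ultrafilter

variable {ι : Type*} {l : Ultrafilter ι}

/-- Boundedness along an ultrafilter. -/
def BddAlong (l : Ultrafilter ι) (u : ι → ℝ) : Prop := ∃ M, ∀ᶠ n in l, |u n| ≤ M

theorem BddAlong.exists_tendsto {u : ι → ℝ} (h : BddAlong l u) : ∃ c, Tendsto u l (𝓝 c) := by
  obtain ⟨M, hM⟩ := h
  have hc : IsCompact (Set.Icc (-M) M) := isCompact_Icc
  obtain ⟨c, -, hc⟩ := hc.ultrafilter_le_nhds (l.map u)
    (tendsto_principal.2 (hM.mono fun n hn => abs_le.1 hn))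
  exact ⟨c, hc⟩

theorem BddAlong.of_tendsto {u : ι → ℝ} {c : ℝ} (h : Tendsto u l (𝓝 c)) : BddAlong l u := by
  refine ⟨|c| + 1, ?_⟩
  filter_upwards [h.abs.eventually (gt_mem_nhds (lt_add_one |c|))] with n hn using hn.le

theorem tendsto_or_abs_atTop (l : Ultrafilter ι) (u : ι → ℝ) :
    (∃ c, Tendsto u l (𝓝 c)) ∨ Tendsto (fun n => |u n|) l atTop := by
  by_cases h : BddAlong l u
  · exact Or.inl h.exists_tendsto
  · right
    rw [tendsto_atTop]
    intro b
    by_contra hc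
    rw [← Ultrafilter.eventually_not] at hc
    exact h ⟨b, by filter_upwards [hc] with n hn using (not_le.1 hn).le⟩

theorem BddAlong.mul_tendsto_zero {u v : ι → ℝ} (h : BddAlong l u) (hv : Tendsto v l (𝓝 0)) :
    Tendsto (fun n => u n * v n) l (𝓝 0) := by
  obtain ⟨c, hc⟩ := h.exists_tendsto
  simpa using hc.mul hv

theorem inv_tendsto_zero {u : ι → ℝ} (h : Tendsto (fun n => |u n|) l atTop) :
    Tendsto (fun n => (u n)⁻¹) l (𝓝 0) := by
  rw [tendsto_zero_iff_abs_tendsto_zero]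
  have := h.inv_tendsto_atTop
  refine this.congr fun n => ?_
  simp [abs_inv]

theorem ne_zero_along {u : ι → ℝ} (h : Tendsto (fun n => |u n|) l atTop) : ∀ᶠ n in l, u n ≠ 0 := by
  filter_upwards [h.eventually_gt_atTop 0] with n hn using abs_pos.1 hn

end ultrafilter

section terminal

variable {f g : MvPolynomial (Fin 2) ℝ}

theorem continuous_ev (f : MvPolynomial (Fin 2) ℝ) : Continuous fun z : ℝ × ℝ => ev f z.1 z.2 :=
  continuous_iff_continuousAt.2 fun z => (hasStrictFDerivAt_ev f z).continuousAt

theorem exists_sign (hJ : ∀ x y, ev (Jac f g) x y ≠ 0) :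
    ∃ σ : ℝ, σ ≠ 0 ∧ ∀ x y, 0 < σ * ev (Jac f g) x y := by
  refine ⟨ev (Jac f g) 0 0, hJ 0 0, fun x y => ?_⟩
  by_contra! hc
  have hcont := continuous_ev (Jac f g)
  rcases lt_or_gt_of_ne (hJ 0 0) with h0 | h0
  · have h1 : 0 ≤ ev (Jac f g) x y := by nlinarith
    obtain ⟨z, hz⟩ := mem_range_of_exists_le_of_exists_ge hcont ⟨(0, 0), h0.le⟩ ⟨(x, y), h1⟩
    exact hJ _ _ hz
  · have h1 : ev (Jac f g) x y ≤ 0 := by nlinarith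
    obtain ⟨z, hz⟩ := mem_range_of_exists_le_of_exists_ge hcont ⟨(x, y), h1⟩ ⟨(0, 0), h0.le⟩
    exact hJ _ _ hz

theorem ev_zero_zero (f : MvPolynomial (Fin 2) ℝ) : ev f 0 0 = coeff 0 f := by
  have : (![0, 0] : Fin 2 → ℝ) = 0 := by ext i; fin_cases i <;> rfl
  rw [ev, this, MvPolynomial.eval_zero, constantCoeff_eq]

theorem ev_pderiv_zero_zero (f : MvPolynomial (Fin 2) ℝ) (i : Fin 2) :
    ev (pderiv i f) 0 0 = coeff (Finsupp.single i 1) f := by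
  have h := coeff_X_mul_pderiv (f := f) i (Finsupp.single i 1)
  have h2 := coeff_X_mul (R := ℝ) (0 : Fin 2 →₀ ℕ) i (pderiv i f)
  rw [add_zero] at h2
  rw [h2] at h
  rw [ev_zero_zero, h]
  simp

/-- If all nonconstant monomials of `f` have weight at most that of the first variable, then no
curve of the corresponding shape stays within a bounded part of the target. -/
theorem not_bounded_of_weights {ι : Type*} {l : Ultrafilter ι} {p q : ℤ} (hp : 1 ≤ p) (hq : 1 ≤ q)
    (hJ : ∀ x y, ev (Jac f g) x y ≠ 0) (hf : ∀ d ∈ f.support, d ≠ 0 → wt p q d ≤ -p) {ε : ℝ}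
    (hε : ε ≠ 0) {t s : ι → ℝ} {s0 : ℝ} (ht0 : ∀ᶠ n in l, 0 < t n) (ht : Tendsto t l (𝓝 0))
    (hs : Tendsto s l (𝓝 s0)) (hs0 : s0 ≠ 0)
    (hg : BddAlong l fun n => ev g (s n * t n ^ p) (ε * t n ^ (-q))) : False := by
  have c01 : coeff (Finsupp.single 1 1) f = 0 := by
    by_contra hc
    have := hf _ (mem_support_iff.2 hc) (by simp)
    simp [wt] at this
    linarith
  have hJ0 := hJ 0 0
  rw [ev_Jac, ev_pderiv_zero_zero, ev_pderiv_zero_zero, ev_pderiv_zero_zero, ev_pderiv_zero_zero,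
    c01, zero_mul, sub_zero] at hJ0
  have c10 := left_ne_zero_of_mul hJ0
  have b01 := right_ne_zero_of_mul hJ0
  set f1 := f - C (coeff 0 f) with hf1
  have hf1s : ∀ d ∈ f1.support, wt p q d ≤ -p := by
    intro d hd
    have hd0 : d ≠ 0 := by
      rintro rfl
      rw [mem_support_iff] at hd
      simp [hf1] at hd
    refine hf d ?_ hd0
    rw [mem_support_iff] at hd ⊢
    simpa [hf1, coeff_C, hd0.symm] using hd
  have hJ1 : Jac f1 g = Jac f g := by simp [Jac, hf1]
  have hgne : g.support.Nonempty := ⟨_, mem_support_iff.2 b01⟩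
  obtain ⟨d0, hd0, hmax⟩ := g.support.exists_max_image (wt p q) hgne
  set b := wt p q d0
  have hbq : q ≤ b := by
    have := hmax _ (mem_support_iff.2 b01)
    simpa [wt] using this
  set A := lead p q (-p) ε f1
  set G := lead p q b ε g
  have hA0 : A.eval 0 = 0 := by
    rw [← Polynomial.coeff_zero_eq_eval_zero]
    refine coeff_lead_of_forall_ne fun j h => ?_
    have : 0 ≤ q * (j : ℤ) := by positivity
    simp at h; omega
  have hAne : A ≠ 0 := by
    intro h
    have h1 := coeff_lead (p := p) (e := -p) (ε := ε) (f := f1) hq (d := Finsupp.single 0 1)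
      (by simp [wt])
    rw [show lead p q (-p) ε f1 = 0 from h] at h1
    have h2 : (0 : Fin 2 →₀ ℕ) ≠ Finsupp.single 0 1 := by simp [eq_comm]
    simp [hf1, coeff_C, h2] at h1
    exact c10 h1.symm
  have hGne : G ≠ 0 := by
    intro h
    have h1 := coeff_lead (p := p) (e := b) (ε := ε) (f := g) hq (d := d0) rfl
    rw [show lead p q b ε g = 0 from h, Polynomial.coeff_zero] at h1
    exact mul_ne_zero (mem_support_iff.1 hd0) (pow_ne_zero _ hε) h1.symm
  have hGs : G.eval s0 = 0 := by
    have h1 := tendsto_lead (ε := ε) hmax ht0 ht hs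
    have hb0 : Tendsto (fun n => t n ^ b) l (𝓝 0) := by
      have : Tendsto (fun n => t n ^ b.toNat) l (𝓝 (0 ^ b.toNat)) := ht.pow _
      rw [zero_pow (by omega)] at this
      refine this.congr fun n => ?_
      rw [← zpow_natCast, Int.toNat_of_nonneg (by omega)]
    have h2 := hg.mul_tendsto_zero hb0
    exact tendsto_nhds_unique h1 (h2.congr fun n => mul_comm _ _)
  obtain ⟨σ, hσ, hσJ⟩ := exists_sign hJ
  have hsign := lead_jac_nonneg (ε := ε) (f := f1) (g := g) (by rw [hJ1]; exact hσJ) hq hf1s hmax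
  refine Polynomial.not_two_roots hAne hGne (m := b.toNat) (k := p.toNat) (by omega) (by omega)
    (mul_ne_zero hσ hε) (fun s => ?_) hs0.symm (r1 := 0) (r2 := s0) (by simp [hA0]) (by simp [hGs])
  have e1 : ((b.toNat : ℕ) : ℝ) = b := by
    exact_mod_cast congrArg (Int.cast (R := ℝ)) (Int.toNat_of_nonneg (by omega : 0 ≤ b))
  have e2 : ((p.toNat : ℕ) : ℝ) = p := by
    exact_mod_cast congrArg (Int.cast (R := ℝ)) (Int.toNat_of_nonneg (by omega : 0 ≤ p))
  rw [e1, e2]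
  refine (hsign s).trans_eq ?_
  push_cast
  ring

/-- The terminal case in terms of a monomial with a nonzero finite limit. -/
theorem not_bounded_of_monomial {ι : Type*} {l : Ultrafilter ι} (p q : ℕ) (hp : 1 ≤ p) (hq : 1 ≤ q)
    (hJ : ∀ x y, ev (Jac f g) x y ≠ 0)
    (hf : ∀ d ∈ f.support, d ≠ 0 → q * (d 1 : ℤ) - p * d 0 ≤ -p) {x y : ι → ℝ} {c : ℝ} (hc : c ≠ 0)
    (hy : Tendsto (fun n => |y n|) l atTop) (hxy : Tendsto (fun n => x n ^ q * y n ^ p) l (𝓝 c))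
    (hg : BddAlong l fun n => ev g (x n) (y n)) : False := by
  have hsgn : ∃ ε : ℝ, (ε = 1 ∨ ε = -1) ∧ ∀ᶠ n in l, y n = ε * |y n| := by
    rcases Ultrafilter.eventually_or.1 (Eventually.of_forall (f := (l : Filter ι))
      (fun n => le_total 0 (y n))) with h | h
    · exact ⟨1, Or.inl rfl, by filter_upwards [h] with n hn; rw [abs_of_nonneg hn, one_mul]⟩
    · exact ⟨-1, Or.inr rfl, by filter_upwards [h] with n hn; rw [abs_of_nonpos hn]; ring⟩
  obtain ⟨ε, hε, hyε⟩ := hsgn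
  have hε0 : ε ≠ 0 := by rcases hε with rfl | rfl <;> norm_num
  set t : ι → ℝ := fun n => |y n| ^ (-(1 / (q : ℝ)))
  have hqpos : (0 : ℝ) < 1 / q := by positivity
  have ht : Tendsto t l (𝓝 0) := (tendsto_rpow_neg_atTop hqpos).comp hy
  have hypos : ∀ᶠ n in l, 0 < |y n| := hy.eventually_gt_atTop 0
  have ht0 : ∀ᶠ n in l, 0 < t n := by
    filter_upwards [hypos] with n hn using Real.rpow_pos_of_pos hn _
  have htq : ∀ᶠ n in l, t n ^ (-(q : ℤ)) = |y n| := by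
    filter_upwards [hypos] with n hn
    rw [← Real.rpow_intCast, ← Real.rpow_mul hn.le]
    have hq' : (q : ℝ) ≠ 0 := by positivity
    have : -(1 / (q : ℝ)) * ((-(q : ℤ) : ℤ) : ℝ) = 1 := by push_cast; field_simp
    rw [this, Real.rpow_one]
  set s : ι → ℝ := fun n => x n * t n ^ (-(p : ℤ))
  have hsq : ∀ᶠ n in l, |s n| ^ q = |x n ^ q * y n ^ p| := by
    filter_upwards [htq, ht0] with n hn hn0
    have h1 : (t n ^ (-(p : ℤ))) ^ q = |y n| ^ p := by
      rw [← hn, ← zpow_natCast, ← zpow_natCast, ← zpow_mul, ← zpow_mul]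
      congr 1; ring
    have h2 : |t n ^ (-(p : ℤ))| = t n ^ (-(p : ℤ)) := abs_of_pos (zpow_pos hn0 _)
    simp only [s]
    rw [abs_mul, mul_pow, h2, h1, abs_mul, abs_pow, abs_pow]
  have hsl : Tendsto (fun n => |s n| ^ q) l (𝓝 |c|) := hxy.abs.congr' (by
    filter_upwards [hsq] with n hn using hn.symm)
  have hsb : BddAlong l s := by
    obtain ⟨M, hM⟩ := BddAlong.of_tendsto hsl
    refine ⟨max M 1, ?_⟩
    filter_upwards [hM] with n hn
    rw [abs_of_nonneg (by positivity)] at hn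
    by_contra! hcon
    obtain ⟨h1, h2⟩ := max_lt_iff.1 hcon
    have := le_self_pow₀ h2.le (by omega : q ≠ 0)
    linarith
  obtain ⟨s0, hs0⟩ := hsb.exists_tendsto
  have hs00 : s0 ≠ 0 := by
    rintro rfl
    have h1 := (hs0.abs.pow q)
    rw [abs_zero, zero_pow (by omega)] at h1
    exact hc (abs_eq_zero.1 (tendsto_nhds_unique hsl h1))
  refine not_bounded_of_weights (p := p) (q := q) (by exact_mod_cast hp) (by exact_mod_cast hq) hJ hf hε0
    ht0 ht hs0 hs00 ?_
  obtain ⟨M, hM⟩ := hg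
  refine ⟨M, ?_⟩
  filter_upwards [hM, htq, hyε, ht0] with n h1 h2 h3 h4
  rw [h2, ← h3]
  have : s n * t n ^ (p : ℤ) = x n := by
    simp only [s]
    rw [mul_assoc, ← zpow_add₀ h4.ne']
    simp
  rw [this]
  exact h1

end terminal

section limits

variable {ι : Type*} {l : Ultrafilter ι}

theorem tendsto_comp₃ {Φ : ℝ → ℝ → ℝ → ℝ} (hΦ : Continuous fun p : ℝ × ℝ × ℝ => Φ p.1 p.2.1 p.2.2)
    {x u s : ι → ℝ} {x0 u0 s0 : ℝ} (hx : Tendsto x l (𝓝 x0)) (hu : Tendsto u l (𝓝 u0))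
    (hs : Tendsto s l (𝓝 s0)) :
    Tendsto (fun n => Φ (x n) (u n) (s n)) l (𝓝 (Φ x0 u0 s0)) :=
  (hΦ.tendsto (x0, u0, s0)).comp (hx.prodMk_nhds (hu.prodMk_nhds hs))

/-- Passing to the limit in an identity whose left side tends to zero. -/
theorem eq_zero_of_tendsto₃ (Φ : ℝ → ℝ → ℝ → ℝ) {E x u s : ι → ℝ} {x0 u0 s0 : ℝ}
    (hE : Tendsto E l (𝓝 0)) (hx : Tendsto x l (𝓝 x0)) (hu : Tendsto u l (𝓝 u0))
    (hs : Tendsto s l (𝓝 s0)) (h : ∀ᶠ n in l, E n = Φ (x n) (u n) (s n))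
    (hΦ : Continuous fun p : ℝ × ℝ × ℝ => Φ p.1 p.2.1 p.2.2) : Φ x0 u0 s0 = 0 :=
  tendsto_nhds_unique ((tendsto_comp₃ hΦ hx hu hs).congr' (h.mono fun _ hn => hn.symm)) hE

/-- Solving a linear equation with converging coefficients. -/
theorem tendsto_of_mul_add_eq_zero (D N : ℝ → ℝ → ℝ → ℝ) {w x u s : ι → ℝ} {x0 u0 s0 : ℝ}
    (hx : Tendsto x l (𝓝 x0)) (hu : Tendsto u l (𝓝 u0)) (hs : Tendsto s l (𝓝 s0))
    (h : ∀ᶠ n in l, w n * D (x n) (u n) (s n) + N (x n) (u n) (s n) = 0)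
    (hD : Continuous fun p : ℝ × ℝ × ℝ => D p.1 p.2.1 p.2.2)
    (hN : Continuous fun p : ℝ × ℝ × ℝ => N p.1 p.2.1 p.2.2) (h0 : D x0 u0 s0 ≠ 0) :
    Tendsto w l (𝓝 (-N x0 u0 s0 / D x0 u0 s0)) := by
  have h1 := tendsto_comp₃ hD hx hu hs
  refine ((tendsto_comp₃ hN hx hu hs).neg.div h1 h0).congr' ?_
  filter_upwards [h, h1.eventually_ne h0] with n hn hn0
  rw [Pi.div_apply, div_eq_iff hn0]
  linarith

theorem BddAlong.of_eventually_eq_zero {u : ι → ℝ} (h : ∀ᶠ n in l, u n = 0) : BddAlong l u :=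
  ⟨0, h.mono fun n hn => by simp [hn]⟩

theorem BddAlong.mul_pow_tendsto_zero {u v : ι → ℝ} (h : BddAlong l u) (hv : Tendsto v l (𝓝 0))
    {k : ℕ} (hk : k ≠ 0) : Tendsto (fun n => u n * v n ^ k) l (𝓝 0) :=
  h.mul_tendsto_zero (by simpa [hk] using hv.pow k)

end limits

section critical

variable {f g : MvPolynomial (Fin 2) ℝ} {a : ℕ → ℕ → ℝ}

theorem IsQuintic.jac_eq (h : IsQuintic f a) (x y : ℝ) :
    ev (Jac f g) x y = quinticX a x y * ev (MvPolynomial.pderiv 1 g) x y - quinticY a x y * ev (MvPolynomial.pderiv 0 g) x y := by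
  rw [ev_Jac, h.pderiv_zero, h.pderiv_one]

theorem IsQuintic.not_critical (h : IsQuintic f a) (hJ : ∀ x y, ev (Jac f g) x y ≠ 0) (x y : ℝ)
    (h0 : quinticX a x y = 0) (h1 : quinticY a x y = 0) : False :=
  hJ x y (by rw [h.jac_eq, h0, h1]; ring)

/-- If `f` is constant on the axis `x = 0` and has a linear normal derivative there. -/
theorem IsQuintic.normal_derivative (h : IsQuintic f a) (hJ : ∀ x y, ev (Jac f g) x y ≠ 0)
    (h1 : a 0 1 = 0) (h2 : a 0 2 = 0) (h3 : a 0 3 = 0) (h4 : a 0 4 = 0) (h5 : a 0 5 = 0)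
    (h12 : a 1 2 = 0) (h13 : a 1 3 = 0) (h14 : a 1 4 = 0) : a 1 1 = 0 ∧ a 1 0 ≠ 0 := by
  have key : ∀ y, a 1 0 + a 1 1 * y ≠ 0 := by
    intro y hy
    refine h.not_critical hJ 0 y ?_ ?_
    · simp only [quinticX, h12, h13, h14]
      linear_combination hy
    · simp only [quinticY, h1, h2, h3, h4, h5]
      ring
  have h11 : a 1 1 = 0 := by
    by_contra hc
    exact key (-a 1 0 / a 1 1) (by field_simp; ring)
  exact ⟨h11, by simpa [h11] using key 0⟩

theorem IsQuintic.weights (h : IsQuintic f a) (p q : ℕ)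
    (H : ∀ i ∈ Finset.range 6, ∀ j ∈ Finset.range 6, i + j ≤ 5 → i + j ≠ 0 →
      ¬ (q * (j : ℤ) - p * i ≤ -p) → a i j = 0) :
    ∀ d ∈ f.support, d ≠ 0 → q * (d 1 : ℤ) - p * d 0 ≤ -p := by
  intro d hd hd0
  rw [mem_support_iff, h.coeff] at hd
  by_contra hc
  apply hd
  split_ifs with h5
  · refine H _ (Finset.mem_range.2 (by omega)) _ (Finset.mem_range.2 (by omega)) h5 ?_ hc
    intro h0
    apply hd0
    ext i
    fin_cases i
    · simpa using (by omega : d 0 = 0)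
    · simpa using (by omega : d 1 = 0)
  · rfl

end critical

section bounded_abscissa

variable {ι : Type*} {l : Ultrafilter ι} {f g : MvPolynomial (Fin 2) ℝ} {a : ℕ → ℕ → ℝ} {x y : ι → ℝ}

theorem vertical_coeffs (hx : Tendsto x l (𝓝 0)) (hy : Tendsto (fun n => |y n|) l atTop)
    (hD : BddAlong l fun n => quinticX a (x n) (y n)) (hF : BddAlong l fun n => quintic a (x n) (y n)) :
    a 0 5 = 0 ∧ a 1 4 = 0 ∧ a 0 4 = 0 ∧ a 1 3 = 0 ∧ a 0 3 = 0 := by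
  have hy0 := ne_zero_along hy
  have hu := inv_tendsto_zero hy
  have a05 : a 0 5 = 0 := by
    have := eq_zero_of_tendsto₃ (fun x u s => a 0 0 * u ^ 5 + a 1 0 * x * u ^ 5 + a 0 1 * u ^ 4 + a 2 0 * x ^ 2 * u ^ 5 +
      a 1 1 * x * u ^ 4 + a 0 2 * u ^ 3 + a 3 0 * x ^ 3 * u ^ 5 +
      a 2 1 * x ^ 2 * u ^ 4 + a 1 2 * x * u ^ 3 + a 0 3 * u ^ 2 +
      a 4 0 * x ^ 4 * u ^ 5 + a 3 1 * x ^ 3 * u ^ 4 + a 2 2 * x ^ 2 * u ^ 3 +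
      a 1 3 * x * u ^ 2 + a 0 4 * u + a 5 0 * x ^ 5 * u ^ 5 + a 4 1 * x ^ 4 * u ^ 4 +
      a 3 2 * x ^ 3 * u ^ 3 + a 2 3 * x ^ 2 * u ^ 2 + a 1 4 * x * u + a 0 5)
      (hF.mul_pow_tendsto_zero hu (k := 5) (by norm_num)) hx hu hu (by
        filter_upwards [hy0] with n hn
        simp only [quintic]
        field_simp) (by fun_prop)
    linear_combination this
  have a14 : a 1 4 = 0 := by
    have := eq_zero_of_tendsto₃ (fun x u s => a 1 0 * u ^ 4 + 2 * a 2 0 * x * u ^ 4 + a 1 1 * u ^ 3 +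
      3 * a 3 0 * x ^ 2 * u ^ 4 + 2 * a 2 1 * x * u ^ 3 + a 1 2 * u ^ 2 +
      4 * a 4 0 * x ^ 3 * u ^ 4 + 3 * a 3 1 * x ^ 2 * u ^ 3 + 2 * a 2 2 * x * u ^ 2 +
      a 1 3 * u + 5 * a 5 0 * x ^ 4 * u ^ 4 + 4 * a 4 1 * x ^ 3 * u ^ 3 +
      3 * a 3 2 * x ^ 2 * u ^ 2 + 2 * a 2 3 * x * u + a 1 4)
      (hD.mul_pow_tendsto_zero hu (k := 4) (by norm_num)) hx hu hu (by
        filter_upwards [hy0] with n hn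
        simp only [quinticX]
        field_simp) (by fun_prop)
    linear_combination this
  have a04 : a 0 4 = 0 := by
    have := eq_zero_of_tendsto₃ (fun x u s => a 0 0 * u ^ 4 + a 1 0 * x * u ^ 4 + a 0 1 * u ^ 3 + a 2 0 * x ^ 2 * u ^ 4 +
      a 1 1 * x * u ^ 3 + a 0 2 * u ^ 2 + a 3 0 * x ^ 3 * u ^ 4 +
      a 2 1 * x ^ 2 * u ^ 3 + a 1 2 * x * u ^ 2 + a 0 3 * u + a 4 0 * x ^ 4 * u ^ 4 +
      a 3 1 * x ^ 3 * u ^ 3 + a 2 2 * x ^ 2 * u ^ 2 + a 1 3 * x * u + a 0 4 +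
      a 5 0 * x ^ 5 * u ^ 4 + a 4 1 * x ^ 4 * u ^ 3 + a 3 2 * x ^ 3 * u ^ 2 +
      a 2 3 * x ^ 2 * u)
      (hF.mul_pow_tendsto_zero hu (k := 4) (by norm_num)) hx hu hu (by
        filter_upwards [hy0] with n hn
        simp only [quintic, a05, a14]
        field_simp
        ring) (by fun_prop)
    linear_combination this
  have a13 : a 1 3 = 0 := by
    have := eq_zero_of_tendsto₃ (fun x u s => a 1 0 * u ^ 3 + 2 * a 2 0 * x * u ^ 3 + a 1 1 * u ^ 2 +
      3 * a 3 0 * x ^ 2 * u ^ 3 + 2 * a 2 1 * x * u ^ 2 + a 1 2 * u +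
      4 * a 4 0 * x ^ 3 * u ^ 3 + 3 * a 3 1 * x ^ 2 * u ^ 2 + 2 * a 2 2 * x * u +
      a 1 3 + 5 * a 5 0 * x ^ 4 * u ^ 3 + 4 * a 4 1 * x ^ 3 * u ^ 2 +
      3 * a 3 2 * x ^ 2 * u + 2 * a 2 3 * x)
      (hD.mul_pow_tendsto_zero hu (k := 3) (by norm_num)) hx hu hu (by
        filter_upwards [hy0] with n hn
        simp only [quinticX, a14]
        field_simp
        ring) (by fun_prop)
    linear_combination this
  have a03 : a 0 3 = 0 := by
    have := eq_zero_of_tendsto₃ (fun x u s => a 0 0 * u ^ 3 + a 1 0 * x * u ^ 3 + a 0 1 * u ^ 2 + a 2 0 * x ^ 2 * u ^ 3 +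
      a 1 1 * x * u ^ 2 + a 0 2 * u + a 3 0 * x ^ 3 * u ^ 3 + a 2 1 * x ^ 2 * u ^ 2 +
      a 1 2 * x * u + a 0 3 + a 4 0 * x ^ 4 * u ^ 3 + a 3 1 * x ^ 3 * u ^ 2 +
      a 2 2 * x ^ 2 * u + a 5 0 * x ^ 5 * u ^ 3 + a 4 1 * x ^ 4 * u ^ 2 +
      a 3 2 * x ^ 3 * u + a 2 3 * x ^ 2)
      (hF.mul_pow_tendsto_zero hu (k := 3) (by norm_num)) hx hu hu (by
        filter_upwards [hy0] with n hn
        simp only [quintic, a04, a05, a13, a14]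
        field_simp
        ring) (by fun_prop)
    linear_combination this
  exact ⟨a05, a14, a04, a13, a03⟩

theorem vertical_main (h : IsQuintic f a)
    (hJ : ∀ x y, ev (Jac f g) x y ≠ 0) (hx : Tendsto x l (𝓝 0))
    (hy : Tendsto (fun n => |y n|) l atTop) (hX : ∀ᶠ n in l, quinticX a (x n) (y n) = 0)
    (hF : BddAlong l fun n => quintic a (x n) (y n)) (hG : BddAlong l fun n => ev g (x n) (y n)) (a23 : a 2 3 ≠ 0) :
    ∃ s0, s0 ≠ 0 ∧ Tendsto (fun n => x n * y n) l (𝓝 s0) ∧ a 1 2 = -2 * a 2 3 * s0 ∧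
      a 0 1 = a 2 3 * s0 ^ 2 ∧ a 0 2 = 0 := by
  have hy0 := ne_zero_along hy
  have hu := inv_tendsto_zero hy
  have hD := BddAlong.of_eventually_eq_zero hX
  obtain ⟨a05, a14, a04, a13, a03⟩ := vertical_coeffs hx hy hD hF
  have hs : Tendsto (fun n => x n * y n) l (𝓝 (-a 1 2 / (2 * a 2 3))) := by
    refine (tendsto_of_mul_add_eq_zero (fun x u s => 2 * a 2 3)
      (fun x u s => a 1 0 * u ^ 2 + 2 * a 2 0 * x * u ^ 2 + a 1 1 * u + 3 * a 3 0 * x ^ 2 * u ^ 2 +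
      2 * a 2 1 * x * u + a 1 2 + 4 * a 4 0 * x ^ 3 * u ^ 2 + 3 * a 3 1 * x ^ 2 * u +
      2 * a 2 2 * x + 5 * a 5 0 * x ^ 4 * u ^ 2 + 4 * a 4 1 * x ^ 3 * u +
      3 * a 3 2 * x ^ 2)
      hx hu hu ?_ (by fun_prop) (by fun_prop) (by simpa using a23)).trans_eq ?_
    · filter_upwards [hy0, hX] with n hn hn2
      simp only [quinticX, a13, a14] at hn2
      field_simp
      linear_combination hn2
    · congr 1
      simp
  set s0 := -a 1 2 / (2 * a 2 3) with hs0
  have a12 : a 1 2 = -2 * a 2 3 * s0 := by rw [hs0]; field_simp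
  have a02 : a 0 2 = 0 := by
    have := eq_zero_of_tendsto₃ (fun x u s => a 0 0 * u ^ 2 + a 1 0 * x * u ^ 2 + a 0 1 * u + a 2 0 * x ^ 2 * u ^ 2 +
      a 1 1 * x * u + a 0 2 + a 3 0 * x ^ 3 * u ^ 2 + a 2 1 * x ^ 2 * u + a 1 2 * x +
      a 4 0 * x ^ 4 * u ^ 2 + a 3 1 * x ^ 3 * u + a 2 2 * x ^ 2 +
      a 5 0 * x ^ 5 * u ^ 2 + a 4 1 * x ^ 4 * u + a 3 2 * x ^ 3 + a 2 3 * x * s)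
      (hF.mul_pow_tendsto_zero hu (k := 2) (by norm_num)) hx hu hs (by
        filter_upwards [hy0] with n hn
        simp only [quintic, a03, a04, a05, a13, a14]
        field_simp
        ring) (by fun_prop)
    linear_combination this
  have h01 : a 0 1 + a 1 2 * s0 + a 2 3 * s0 ^ 2 = 0 := by
    have := eq_zero_of_tendsto₃ (fun x u s => a 0 0 * u + a 1 0 * x * u + a 0 1 + a 2 0 * x ^ 2 * u + a 1 1 * x +
      a 3 0 * x ^ 3 * u + a 2 1 * x ^ 2 + a 1 2 * s + a 4 0 * x ^ 4 * u +
      a 3 1 * x ^ 3 + a 2 2 * x * s + a 5 0 * x ^ 5 * u + a 4 1 * x ^ 4 +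
      a 3 2 * x ^ 2 * s + a 2 3 * s ^ 2)
      (hF.mul_pow_tendsto_zero hu (k := 1) (by norm_num)) hx hu hs (by
        filter_upwards [hy0] with n hn
        simp only [quintic, a02, a03, a04, a05, a13, a14]
        field_simp
        ring) (by fun_prop)
    linear_combination this
  have a01 : a 0 1 = a 2 3 * s0 ^ 2 := by rw [a12] at h01; linear_combination h01
  refine ⟨s0, fun h00 => ?_, hs, a12, a01, a02⟩
  rw [h00] at a12 a01 hs
  simp only [mul_zero] at a12
  norm_num at a01
  obtain ⟨a11, a10⟩ := h.normal_derivative hJ a01 a02 a03 a04 a05 a12 a13 a14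
  have hw : Tendsto (fun n => x n * y n ^ 3) l (𝓝 (-a 1 0 / (2 * a 2 3))) := by
    refine (tendsto_of_mul_add_eq_zero (fun x u s => 2 * a 2 3 + (2 * a 2 2 + 3 * a 3 2 * x) * u)
      (fun x u s => a 1 0 + 2 * a 2 0 * x + 3 * a 3 0 * x ^ 2 + 2 * a 2 1 * s + 4 * a 4 0 * x ^ 3 +
      3 * a 3 1 * x * s + 5 * a 5 0 * x ^ 4 + 4 * a 4 1 * x ^ 2 * s)
      hx hu hs ?_ (by fun_prop) (by fun_prop) (by simpa using a23)).trans_eq ?_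
    · filter_upwards [hy0, hX] with n hn hn2
      simp only [quinticX, a11, a12, a13, a14] at hn2
      field_simp
      linear_combination hn2
    · congr 1
      simp
  refine not_bounded_of_monomial (f := f) (g := g) 3 1 (by norm_num) le_rfl hJ (h.weights 3 1 ?_)
    (div_ne_zero (neg_ne_zero.2 a10) (mul_ne_zero two_ne_zero a23)) hy (by simpa using hw) hG
  intro i hi j hj hij hij0 hw
  fin_cases hi <;> fin_cases hj <;> first | assumption | (exfalso; revert hw hij hij0; norm_num)

theorem not_vertical_aux (h : IsQuintic f a)
    (hJ : ∀ x y, ev (Jac f g) x y ≠ 0) (hx : Tendsto x l (𝓝 0))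
    (hy : Tendsto (fun n => |y n|) l atTop) (hX : ∀ᶠ n in l, quinticX a (x n) (y n) = 0)
    (hF : BddAlong l fun n => quintic a (x n) (y n)) (hG : BddAlong l fun n => ev g (x n) (y n)) (a23 : a 2 3 = 0) : a 2 2 = 0 ∧ a 1 2 = 0 ∧ a 0 2 = 0 := by
  have hy0 := ne_zero_along hy
  have hu := inv_tendsto_zero hy
  have hD := BddAlong.of_eventually_eq_zero hX
  obtain ⟨a05, a14, a04, a13, a03⟩ := vertical_coeffs hx hy hD hF
  have a12 : a 1 2 = 0 := by
    have := eq_zero_of_tendsto₃ (fun x u s => a 1 0 * u ^ 2 + 2 * a 2 0 * x * u ^ 2 + a 1 1 * u + 3 * a 3 0 * x ^ 2 * u ^ 2 +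
      2 * a 2 1 * x * u + a 1 2 + 4 * a 4 0 * x ^ 3 * u ^ 2 + 3 * a 3 1 * x ^ 2 * u +
      2 * a 2 2 * x + 5 * a 5 0 * x ^ 4 * u ^ 2 + 4 * a 4 1 * x ^ 3 * u +
      3 * a 3 2 * x ^ 2)
      (hD.mul_pow_tendsto_zero hu (k := 2) (by norm_num)) hx hu hu (by
        filter_upwards [hy0] with n hn
        simp only [quinticX, a13, a14, a23]
        field_simp
        ring) (by fun_prop)
    linear_combination this
  have a02 : a 0 2 = 0 := by
    have := eq_zero_of_tendsto₃ (fun x u s => a 0 0 * u ^ 2 + a 1 0 * x * u ^ 2 + a 0 1 * u + a 2 0 * x ^ 2 * u ^ 2 +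
      a 1 1 * x * u + a 0 2 + a 3 0 * x ^ 3 * u ^ 2 + a 2 1 * x ^ 2 * u +
      a 4 0 * x ^ 4 * u ^ 2 + a 3 1 * x ^ 3 * u + a 2 2 * x ^ 2 +
      a 5 0 * x ^ 5 * u ^ 2 + a 4 1 * x ^ 4 * u + a 3 2 * x ^ 3)
      (hF.mul_pow_tendsto_zero hu (k := 2) (by norm_num)) hx hu hu (by
        filter_upwards [hy0] with n hn
        simp only [quintic, a03, a04, a05, a12, a13, a14, a23]
        field_simp
        ring) (by fun_prop)
    linear_combination this
  refine ⟨?_, a12, a02⟩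
  by_contra a22
  have hs : Tendsto (fun n => x n * y n) l (𝓝 (-a 1 1 / (2 * a 2 2))) := by
    refine (tendsto_of_mul_add_eq_zero (fun x u s => 2 * a 2 2 + 3 * a 3 2 * x)
      (fun x u s => a 1 0 * u + 2 * a 2 0 * x * u + a 1 1 + 3 * a 3 0 * x ^ 2 * u + 2 * a 2 1 * x +
      4 * a 4 0 * x ^ 3 * u + 3 * a 3 1 * x ^ 2 + 5 * a 5 0 * x ^ 4 * u +
      4 * a 4 1 * x ^ 3)
      hx hu hu ?_ (by fun_prop) (by fun_prop) (by simpa using a22)).trans_eq ?_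
    · filter_upwards [hy0, hX] with n hn hn2
      simp only [quinticX, a12, a13, a14, a23] at hn2
      field_simp
      linear_combination hn2
    · congr 1
      simp
  have a01 : a 0 1 = 0 := by
    have := eq_zero_of_tendsto₃ (fun x u s => a 0 0 * u + a 1 0 * x * u + a 0 1 + a 2 0 * x ^ 2 * u + a 1 1 * x +
      a 3 0 * x ^ 3 * u + a 2 1 * x ^ 2 + a 4 0 * x ^ 4 * u + a 3 1 * x ^ 3 +
      a 2 2 * x * s + a 5 0 * x ^ 5 * u + a 4 1 * x ^ 4 + a 3 2 * x ^ 2 * s)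
      (hF.mul_pow_tendsto_zero hu (k := 1) (by norm_num)) hx hu hs (by
        filter_upwards [hy0] with n hn
        simp only [quintic, a02, a03, a04, a05, a12, a13, a14, a23]
        field_simp
        ring) (by fun_prop)
    linear_combination this
  obtain ⟨a11, a10⟩ := h.normal_derivative hJ a01 a02 a03 a04 a05 a12 a13 a14
  rw [a11] at hs
  simp only [neg_zero, zero_div] at hs
  have hw : Tendsto (fun n => x n * y n ^ 2) l (𝓝 (-a 1 0 / (2 * a 2 2))) := by
    refine (tendsto_of_mul_add_eq_zero (fun x u s => 2 * a 2 2 + 3 * a 3 2 * x)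
      (fun x u s => a 1 0 + 2 * a 2 0 * x + 3 * a 3 0 * x ^ 2 + 2 * a 2 1 * s + 4 * a 4 0 * x ^ 3 +
      3 * a 3 1 * x * s + 5 * a 5 0 * x ^ 4 + 4 * a 4 1 * x ^ 2 * s)
      hx hu hs ?_ (by fun_prop) (by fun_prop) (by simpa using a22)).trans_eq ?_
    · filter_upwards [hy0, hX] with n hn hn2
      simp only [quinticX, a11, a12, a13, a14, a23] at hn2
      field_simp
      linear_combination hn2
    · congr 1
      simp
  refine not_bounded_of_monomial (f := f) (g := g) 2 1 (by norm_num) le_rfl hJ (h.weights 2 1 ?_)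
    (div_ne_zero (neg_ne_zero.2 a10) (mul_ne_zero two_ne_zero a22)) hy (by simpa using hw) hG
  intro i hi j hj hij hij0 hw
  fin_cases hi <;> fin_cases hj <;> first | assumption | (exfalso; revert hw hij hij0; norm_num)

theorem not_vertical (h : IsQuintic f a)
    (hJ : ∀ x y, ev (Jac f g) x y ≠ 0) (hx : Tendsto x l (𝓝 0))
    (hy : Tendsto (fun n => |y n|) l atTop) (hX : ∀ᶠ n in l, quinticX a (x n) (y n) = 0)
    (hF : BddAlong l fun n => quintic a (x n) (y n)) (hG : BddAlong l fun n => ev g (x n) (y n)) (a23 : a 2 3 = 0) : False := by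
  have hy0 := ne_zero_along hy
  have hu := inv_tendsto_zero hy
  have hD := BddAlong.of_eventually_eq_zero hX
  obtain ⟨a05, a14, a04, a13, a03⟩ := vertical_coeffs hx hy hD hF
  obtain ⟨a22, a12, a02⟩ := not_vertical_aux h hJ hx hy hX hF hG a23
  by_cases a32 : a 3 2 = 0
  · have a11 : a 1 1 = 0 := by
      have := eq_zero_of_tendsto₃ (fun x u s => a 1 0 * u + 2 * a 2 0 * x * u + a 1 1 + 3 * a 3 0 * x ^ 2 * u + 2 * a 2 1 * x +
        4 * a 4 0 * x ^ 3 * u + 3 * a 3 1 * x ^ 2 + 5 * a 5 0 * x ^ 4 * u +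
        4 * a 4 1 * x ^ 3)
        (hD.mul_pow_tendsto_zero hu (k := 1) (by norm_num)) hx hu hu (by
          filter_upwards [hy0] with n hn
          simp only [quinticX, a12, a13, a14, a22, a23, a32]
          field_simp
          ring) (by fun_prop)
      linear_combination this
    have a01 : a 0 1 = 0 := by
      have := eq_zero_of_tendsto₃ (fun x u s => a 0 0 * u + a 1 0 * x * u + a 0 1 + a 2 0 * x ^ 2 * u + a 1 1 * x +
        a 3 0 * x ^ 3 * u + a 2 1 * x ^ 2 + a 4 0 * x ^ 4 * u + a 3 1 * x ^ 3 +
        a 5 0 * x ^ 5 * u + a 4 1 * x ^ 4)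
        (hF.mul_pow_tendsto_zero hu (k := 1) (by norm_num)) hx hu hu (by
          filter_upwards [hy0] with n hn
          simp only [quintic, a02, a03, a04, a05, a12, a13, a14, a22, a23, a32]
          field_simp
          ring) (by fun_prop)
      linear_combination this
    obtain ⟨-, a10⟩ := h.normal_derivative hJ a01 a02 a03 a04 a05 a12 a13 a14
    by_cases a21 : a 2 1 = 0
    · by_cases a31 : a 3 1 = 0
      · have a41 : a 4 1 ≠ 0 := by
          intro a41
          apply a10
          have := eq_zero_of_tendsto₃ (fun x u s => a 1 0 + 2 * a 2 0 * x + 3 * a 3 0 * x ^ 2 + 4 * a 4 0 * x ^ 3 +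
      5 * a 5 0 * x ^ 4)
            (E := fun n => 0) tendsto_const_nhds hx hu hu (by
              filter_upwards [hX] with n hn
              simp only [quinticX, a11, a12, a13, a14, a21, a22, a23, a31, a32, a41] at hn
              linear_combination -hn) (by fun_prop)
          linear_combination this
        have hw : Tendsto (fun n => x n ^ 3 * y n) l (𝓝 (-a 1 0 / (4 * a 4 1))) := by
          refine (tendsto_of_mul_add_eq_zero (fun x u s => 4 * a 4 1)
            (fun x u s => a 1 0 + 2 * a 2 0 * x + 3 * a 3 0 * x ^ 2 + 4 * a 4 0 * x ^ 3 +
      5 * a 5 0 * x ^ 4)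
            hx hu hu ?_ (by fun_prop) (by fun_prop) (by simpa using a41)).trans_eq ?_
          · filter_upwards [hy0, hX] with n hn hn2
            simp only [quinticX, a11, a12, a13, a14, a21, a22, a23, a31, a32] at hn2
            field_simp
            linear_combination hn2
          · congr 1
            simp
        refine not_bounded_of_monomial (f := f) (g := g) 1 3 (by norm_num) (by norm_num) hJ
          (h.weights 1 3 ?_)
          (div_ne_zero (neg_ne_zero.2 a10) (mul_ne_zero four_ne_zero a41)) hy (by simpa using hw) hG
        intro i hi j hj hij hij0 hw
        fin_cases hi <;> fin_cases hj <;> first | assumption | (exfalso; revert hw hij hij0; norm_num)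
      · have hw : Tendsto (fun n => x n ^ 2 * y n) l (𝓝 (-a 1 0 / (3 * a 3 1))) := by
          refine (tendsto_of_mul_add_eq_zero (fun x u s => 3 * a 3 1 + 4 * a 4 1 * x)
            (fun x u s => a 1 0 + 2 * a 2 0 * x + 3 * a 3 0 * x ^ 2 + 4 * a 4 0 * x ^ 3 +
      5 * a 5 0 * x ^ 4)
            hx hu hu ?_ (by fun_prop) (by fun_prop) (by simpa using a31)).trans_eq ?_
          · filter_upwards [hy0, hX] with n hn hn2
            simp only [quinticX, a11, a12, a13, a14, a21, a22, a23, a32] at hn2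
            field_simp
            linear_combination hn2
          · congr 1
            simp
        refine not_bounded_of_monomial (f := f) (g := g) 1 2 (by norm_num) (by norm_num) hJ
          (h.weights 1 2 ?_)
          (div_ne_zero (neg_ne_zero.2 a10) (mul_ne_zero three_ne_zero a31)) hy (by simpa using hw) hG
        intro i hi j hj hij hij0 hw
        fin_cases hi <;> fin_cases hj <;> first | assumption | (exfalso; revert hw hij hij0; norm_num)
    · have hw : Tendsto (fun n => x n * y n) l (𝓝 (-a 1 0 / (2 * a 2 1))) := by
        refine (tendsto_of_mul_add_eq_zero (fun x u s => 2 * a 2 1 + 3 * a 3 1 * x + 4 * a 4 1 * x ^ 2)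
          (fun x u s => a 1 0 + 2 * a 2 0 * x + 3 * a 3 0 * x ^ 2 + 4 * a 4 0 * x ^ 3 +
      5 * a 5 0 * x ^ 4)
          hx hu hu ?_ (by fun_prop) (by fun_prop) (by simpa using a21)).trans_eq ?_
        · filter_upwards [hy0, hX] with n hn hn2
          simp only [quinticX, a11, a12, a13, a14, a22, a23, a32] at hn2
          field_simp
          linear_combination hn2
        · congr 1
          simp
      refine not_bounded_of_monomial (f := f) (g := g) 1 1 (by norm_num) (by norm_num) hJ
        (h.weights 1 1 ?_)
        (div_ne_zero (neg_ne_zero.2 a10) (mul_ne_zero two_ne_zero a21)) hy (by simpa using hw) hG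
      intro i hi j hj hij hij0 hw
      fin_cases hi <;> fin_cases hj <;> first | assumption | (exfalso; revert hw hij hij0; norm_num)
  · have hv : Tendsto (fun n => x n ^ 2 * y n) l (𝓝 (-a 1 1 / (3 * a 3 2))) := by
      refine (tendsto_of_mul_add_eq_zero (fun x u s => 3 * a 3 2)
        (fun x u s => a 1 0 * u + 2 * a 2 0 * x * u + a 1 1 + 3 * a 3 0 * x ^ 2 * u + 2 * a 2 1 * x +
      4 * a 4 0 * x ^ 3 * u + 3 * a 3 1 * x ^ 2 + 5 * a 5 0 * x ^ 4 * u +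
      4 * a 4 1 * x ^ 3)
        hx hu hu ?_ (by fun_prop) (by fun_prop) (by simpa using a32)).trans_eq ?_
      · filter_upwards [hy0, hX] with n hn hn2
        simp only [quinticX, a12, a13, a14, a22, a23] at hn2
        field_simp
        linear_combination hn2
      · congr 1
        simp
    have a01 : a 0 1 = 0 := by
      have := eq_zero_of_tendsto₃ (fun x u s => a 0 0 * u + a 1 0 * x * u + a 0 1 + a 2 0 * x ^ 2 * u + a 1 1 * x +
        a 3 0 * x ^ 3 * u + a 2 1 * x ^ 2 + a 4 0 * x ^ 4 * u + a 3 1 * x ^ 3 +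
        a 5 0 * x ^ 5 * u + a 4 1 * x ^ 4 + a 3 2 * x * s)
        (hF.mul_pow_tendsto_zero hu (k := 1) (by norm_num)) hx hu hv (by
          filter_upwards [hy0] with n hn
          simp only [quintic, a02, a03, a04, a05, a12, a13, a14, a22, a23]
          field_simp
          ring) (by fun_prop)
      linear_combination this
    obtain ⟨a11, a10⟩ := h.normal_derivative hJ a01 a02 a03 a04 a05 a12 a13 a14
    rw [a11] at hv
    simp only [neg_zero, zero_div] at hv
    have hs : ∃ s0, s0 ≠ 0 ∧ Tendsto (fun n => x n * y n) l (𝓝 s0) := by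
      rcases tendsto_or_abs_atTop l (fun n => x n * y n) with ⟨s0, hs⟩ | hs
      · refine ⟨s0, ?_, hs⟩
        rintro rfl
        apply a10
        have := eq_zero_of_tendsto₃ (fun x v s => a 1 0 + 2 * a 2 0 * x + 3 * a 3 0 * x ^ 2 + 4 * a 4 0 * x ^ 3 + 3 * a 3 1 * v +
      5 * a 5 0 * x ^ 4 + 4 * a 4 1 * x * v +
            2 * a 2 1 * s + 3 * a 3 2 * s ^ 2)
          (E := fun n => 0) tendsto_const_nhds hx hv hs (by
            filter_upwards [hX] with n hn
            simp only [quinticX, a11, a12, a13, a14, a22, a23] at hn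
            linear_combination -hn) (by fun_prop)
        linear_combination this
      · exfalso
        apply a32
        have hs0 := ne_zero_along hs
        have := eq_zero_of_tendsto₃ (fun x v s => (a 1 0 + 2 * a 2 0 * x + 3 * a 3 0 * x ^ 2 + 4 * a 4 0 * x ^ 3 + 3 * a 3 1 * v +
      5 * a 5 0 * x ^ 4 + 4 * a 4 1 * x * v) * s ^ 2 +
            2 * a 2 1 * s + 3 * a 3 2)
          (E := fun n => 0) tendsto_const_nhds hx hv (inv_tendsto_zero hs) (by
            filter_upwards [hX, hs0] with n hn hn0
            simp only [quinticX, a11, a12, a13, a14, a22, a23] at hn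
            have h1 : x n * y n * (x n * y n)⁻¹ = 1 := mul_inv_cancel₀ hn0
            generalize (x n * y n)⁻¹ = w at h1 ⊢
            linear_combination (-w ^ 2) * hn - (2 * a 2 1 * w + 3 * a 3 2 * (x n * y n * w + 1)) * -h1)
          (by fun_prop)
        linear_combination this / 3
    obtain ⟨s0, hs0, hs⟩ := hs
    refine not_bounded_of_monomial (f := f) (g := g) 1 1 le_rfl le_rfl hJ
      (h.weights 1 1 ?_) hs0 hy (by simpa using hs) hG
    intro i hi j hj hij hij0 hw
    fin_cases hi <;> fin_cases hj <;> first | assumption | (exfalso; revert hw hij hij0; norm_num)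

end bounded_abscissa

section unbounded

variable {ι : Type*} {l : Ultrafilter ι} {f g : MvPolynomial (Fin 2) ℝ} {a : ℕ → ℕ → ℝ} {x y : ι → ℝ}

/-- Asymptotics of a quintic that is critical in the first variable along a curve close to the
second axis but leaving every vertical strip. -/
theorem steep_coeffs (hx : Tendsto (fun n => |x n|) l atTop) (hy : Tendsto (fun n => |y n|) l atTop)
    (hz : Tendsto (fun n => x n * (y n)⁻¹) l (𝓝 0)) (hD : ∀ᶠ n in l, quinticX a (x n) (y n) = 0)
    (h1 : Tendsto (fun n => quintic a (x n) (y n) * (y n)⁻¹ ^ 4) l (𝓝 0))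
    (h2 : Tendsto (fun n => quintic a (x n) (y n) * (x n)⁻¹ * (y n)⁻¹ ^ 3) l (𝓝 0)) :
    a 0 5 = 0 ∧ a 1 4 = 0 ∧ a 2 3 = 0 ∧ a 3 2 = 0 := by
  have hx0 := ne_zero_along hx
  have hy0 := ne_zero_along hy
  have hX := inv_tendsto_zero hx
  have hY := inv_tendsto_zero hy
  have hD0 := BddAlong.of_eventually_eq_zero hD
  have a05 : a 0 5 = 0 := by
    have := eq_zero_of_tendsto₃ (fun z X r => a 0 0 * z ^ 5 * X ^ 5 + a 1 0 * z ^ 5 * X ^ 4 + a 0 1 * z ^ 4 * X ^ 4 +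
      a 2 0 * z ^ 5 * X ^ 3 + a 1 1 * z ^ 4 * X ^ 3 + a 0 2 * z ^ 3 * X ^ 3 +
      a 3 0 * z ^ 5 * X ^ 2 + a 2 1 * z ^ 4 * X ^ 2 + a 1 2 * z ^ 3 * X ^ 2 +
      a 0 3 * z ^ 2 * X ^ 2 + a 4 0 * z ^ 5 * X + a 3 1 * z ^ 4 * X +
      a 2 2 * z ^ 3 * X + a 1 3 * z ^ 2 * X + a 0 4 * z * X + a 5 0 * z ^ 5 +
      a 4 1 * z ^ 4 + a 3 2 * z ^ 3 + a 2 3 * z ^ 2 + a 1 4 * z + a 0 5)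
      (E := fun n => quintic a (x n) (y n) * (y n)⁻¹ ^ 4 * (y n)⁻¹) (by simpa using h1.mul hY) hz hX hz (by
        filter_upwards [hx0, hy0] with n hn hn'
        simp only [quintic]
        field_simp) (by fun_prop)
    linear_combination this
  have a14 : a 1 4 = 0 := by
    have := eq_zero_of_tendsto₃ (fun z X r => a 1 0 * z ^ 4 * X ^ 4 + 2 * a 2 0 * z ^ 4 * X ^ 3 + a 1 1 * z ^ 3 * X ^ 3 +
      3 * a 3 0 * z ^ 4 * X ^ 2 + 2 * a 2 1 * z ^ 3 * X ^ 2 + a 1 2 * z ^ 2 * X ^ 2 +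
      4 * a 4 0 * z ^ 4 * X + 3 * a 3 1 * z ^ 3 * X + 2 * a 2 2 * z ^ 2 * X +
      a 1 3 * z * X + 5 * a 5 0 * z ^ 4 + 4 * a 4 1 * z ^ 3 + 3 * a 3 2 * z ^ 2 +
      2 * a 2 3 * z + a 1 4)
      (hD0.mul_pow_tendsto_zero hY (k := 4) (by norm_num)) hz hX hz (by
        filter_upwards [hx0, hy0] with n hn hn'
        simp only [quinticX]
        field_simp) (by fun_prop)
    linear_combination this
  have a23 : a 2 3 = 0 := by
    have := eq_zero_of_tendsto₃ (fun z X r => a 1 0 * z ^ 3 * X ^ 4 + 2 * a 2 0 * z ^ 3 * X ^ 3 + a 1 1 * z ^ 2 * X ^ 3 +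
      3 * a 3 0 * z ^ 3 * X ^ 2 + 2 * a 2 1 * z ^ 2 * X ^ 2 + a 1 2 * z * X ^ 2 +
      4 * a 4 0 * z ^ 3 * X + 3 * a 3 1 * z ^ 2 * X + 2 * a 2 2 * z * X + a 1 3 * X +
      5 * a 5 0 * z ^ 3 + 4 * a 4 1 * z ^ 2 + 3 * a 3 2 * z + 2 * a 2 3)
      (E := fun n => quinticX a (x n) (y n) * (x n)⁻¹ * (y n)⁻¹ ^ 3)
      (by simpa using (hD0.mul_tendsto_zero hX).mul (hY.pow 3)) hz hX hz (by
        filter_upwards [hx0, hy0] with n hn hn'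
        simp only [quinticX, a14]
        field_simp
        ring) (by fun_prop)
    linear_combination this / 2
  refine ⟨a05, a14, a23, ?_⟩
  rcases tendsto_or_abs_atTop l (fun n => x n ^ 2 * (y n)⁻¹) with ⟨r0, hr⟩ | hr
  · have e1 : a 1 3 + 3 * a 3 2 * r0 = 0 := by
      have := eq_zero_of_tendsto₃ (fun z X r => a 1 0 * z ^ 3 * X ^ 3 + 2 * a 2 0 * z ^ 3 * X ^ 2 + a 1 1 * z ^ 2 * X ^ 2 +
      3 * a 3 0 * z ^ 3 * X + 2 * a 2 1 * z ^ 2 * X + a 1 2 * z * X +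
      4 * a 4 0 * z ^ 3 + 3 * a 3 1 * z ^ 2 + 2 * a 2 2 * z + a 1 3 +
      5 * a 5 0 * r * z ^ 2 + 4 * a 4 1 * r * z + 3 * a 3 2 * r)
        (hD0.mul_pow_tendsto_zero hY (k := 3) (by norm_num)) hz hX hr (by
          filter_upwards [hx0, hy0] with n hn hn'
          simp only [quinticX, a14, a23]
          field_simp
          ring) (by fun_prop)
      linear_combination this
    have a04 : a 0 4 = 0 := by
      have := eq_zero_of_tendsto₃ (fun z X r => a 0 0 * z ^ 4 * X ^ 4 + a 1 0 * z ^ 4 * X ^ 3 + a 0 1 * z ^ 3 * X ^ 3 +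
      a 2 0 * z ^ 4 * X ^ 2 + a 1 1 * z ^ 3 * X ^ 2 + a 0 2 * z ^ 2 * X ^ 2 +
      a 3 0 * z ^ 4 * X + a 2 1 * z ^ 3 * X + a 1 2 * z ^ 2 * X + a 0 3 * z * X +
      a 4 0 * z ^ 4 + a 3 1 * z ^ 3 + a 2 2 * z ^ 2 + a 1 3 * z + a 0 4 +
      a 5 0 * r * z ^ 3 + a 4 1 * r * z ^ 2 + a 3 2 * r * z)
        (h1) hz hX hr (by
          filter_upwards [hx0, hy0] with n hn hn'
          simp only [quintic, a05, a14, a23]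
          field_simp
          ring) (by fun_prop)
      linear_combination this
    have e2 : a 1 3 + a 3 2 * r0 = 0 := by
      have := eq_zero_of_tendsto₃ (fun z X r => a 0 0 * z ^ 3 * X ^ 4 + a 1 0 * z ^ 3 * X ^ 3 + a 0 1 * z ^ 2 * X ^ 3 +
      a 2 0 * z ^ 3 * X ^ 2 + a 1 1 * z ^ 2 * X ^ 2 + a 0 2 * z * X ^ 2 +
      a 3 0 * z ^ 3 * X + a 2 1 * z ^ 2 * X + a 1 2 * z * X + a 0 3 * X +
      a 4 0 * z ^ 3 + a 3 1 * z ^ 2 + a 2 2 * z + a 1 3 + a 5 0 * r * z ^ 2 +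
      a 4 1 * r * z + a 3 2 * r)
        (h2) hz hX hr (by
          filter_upwards [hx0, hy0] with n hn hn'
          simp only [quintic, a04, a05, a14, a23]
          field_simp
          ring) (by fun_prop)
      linear_combination this
    by_contra a32
    have hr0 : r0 = 0 := by
      have : a 3 2 * r0 = 0 := by linear_combination (e1 - e2) / 2
      exact (mul_eq_zero.1 this).resolve_left a32
    have a13 : a 1 3 = 0 := by rw [hr0] at e1; linear_combination e1
    have h32 : a 3 2 = 0 := by
      have := eq_zero_of_tendsto₃ (fun z X r => a 1 0 * z ^ 2 * X ^ 4 + 2 * a 2 0 * z ^ 2 * X ^ 3 + a 1 1 * z * X ^ 3 +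
      3 * a 3 0 * z ^ 2 * X ^ 2 + 2 * a 2 1 * z * X ^ 2 + a 1 2 * X ^ 2 +
      4 * a 4 0 * z ^ 2 * X + 3 * a 3 1 * z * X + 2 * a 2 2 * X + 5 * a 5 0 * z ^ 2 +
      4 * a 4 1 * z + 3 * a 3 2)
        (E := fun n => quinticX a (x n) (y n) * (x n)⁻¹ ^ 2 * (y n)⁻¹ ^ 2)
          (by simpa using (hD0.mul_pow_tendsto_zero hX two_ne_zero).mul (hY.pow 2)) hz hX hz (by
          filter_upwards [hx0, hy0] with n hn hn'
          simp only [quinticX, a13, a14, a23]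
          field_simp
          ring) (by fun_prop)
      linear_combination this / 3
    exact a32 h32
  · have hr0 : Tendsto (fun n => y n * (x n)⁻¹ ^ 2) l (𝓝 0) := by
      refine (inv_tendsto_zero hr).congr fun n => ?_
      simp [mul_comm]
    have h32 : a 3 2 = 0 := by
      have := eq_zero_of_tendsto₃ (fun z X r => a 1 0 * z ^ 2 * X ^ 4 + 2 * a 2 0 * z ^ 2 * X ^ 3 + a 1 1 * z * X ^ 3 +
      3 * a 3 0 * z ^ 2 * X ^ 2 + 2 * a 2 1 * z * X ^ 2 + a 1 2 * X ^ 2 +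
      4 * a 4 0 * z ^ 2 * X + 3 * a 3 1 * z * X + 2 * a 2 2 * X + a 1 3 * r +
      5 * a 5 0 * z ^ 2 + 4 * a 4 1 * z + 3 * a 3 2)
        (E := fun n => quinticX a (x n) (y n) * (x n)⁻¹ ^ 2 * (y n)⁻¹ ^ 2)
          (by simpa using (hD0.mul_pow_tendsto_zero hX two_ne_zero).mul (hY.pow 2)) hz hX hr0 (by
          filter_upwards [hx0, hy0] with n hn hn'
          simp only [quinticX, a14, a23]
          field_simp
          ring) (by fun_prop)
      linear_combination this / 3
    exact h32

theorem polynomial_coeffs {c0 c1 c2 c3 c4 c5 c6 : ℝ} (hx : Tendsto (fun n => |x n|) l atTop)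
    (h : Tendsto (fun n => (c0 + c1 * x n + c2 * x n ^ 2 + c3 * x n ^ 3 + c4 * x n ^ 4 + c5 * x n ^ 5 +
      c6 * x n ^ 6) * (x n)⁻¹ ^ 2) l (𝓝 0)) :
    c6 = 0 ∧ c5 = 0 ∧ c4 = 0 ∧ c3 = 0 ∧ c2 = 0 := by
  have hx0 := ne_zero_along hx
  have hX := inv_tendsto_zero hx
  have key : ∀ k, Tendsto (fun n => ((c0 + c1 * x n + c2 * x n ^ 2 + c3 * x n ^ 3 + c4 * x n ^ 4 +
      c5 * x n ^ 5 + c6 * x n ^ 6) * (x n)⁻¹ ^ 2) * (x n)⁻¹ ^ k) l (𝓝 0) := by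
    intro k
    simpa using h.mul (hX.pow k)
  have h6 : c6 = 0 := by
    have := eq_zero_of_tendsto₃ (fun X _ _ => c6 + c5 * X ^ 1 + c4 * X ^ 2 + c3 * X ^ 3 + c2 * X ^ 4 + c1 * X ^ 5 + c0 * X ^ 6)
      (key 4) hX hX hX (by
        filter_upwards [hx0] with n hn
        field_simp
        ring) (by fun_prop)
    simpa using this
  have h5 : c5 = 0 := by
    have := eq_zero_of_tendsto₃ (fun X _ _ => c5 + c4 * X ^ 1 + c3 * X ^ 2 + c2 * X ^ 3 + c1 * X ^ 4 + c0 * X ^ 5)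
      (key 3) hX hX hX (by
        filter_upwards [hx0] with n hn
        simp only [h6]
        field_simp
        ring) (by fun_prop)
    simpa using this
  have h4 : c4 = 0 := by
    have := eq_zero_of_tendsto₃ (fun X _ _ => c4 + c3 * X ^ 1 + c2 * X ^ 2 + c1 * X ^ 3 + c0 * X ^ 4)
      (key 2) hX hX hX (by
        filter_upwards [hx0] with n hn
        simp only [h6, h5]
        field_simp
        ring) (by fun_prop)
    simpa using this
  have h3 : c3 = 0 := by
    have := eq_zero_of_tendsto₃ (fun X _ _ => c3 + c2 * X ^ 1 + c1 * X ^ 2 + c0 * X ^ 3)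
      (key 1) hX hX hX (by
        filter_upwards [hx0] with n hn
        simp only [h6, h5, h4]
        field_simp
        ring) (by fun_prop)
    simpa using this
  have h2 : c2 = 0 := by
    have := eq_zero_of_tendsto₃ (fun X _ _ => c2 + c1 * X ^ 1 + c0 * X ^ 2)
      (key 0) hX hX hX (by
        filter_upwards [hx0] with n hn
        simp only [h6, h5, h4, h3]
        field_simp
        ring) (by fun_prop)
    simpa using this
  exact ⟨h6, h5, h4, h3, h2⟩

/-- No curve of critical points for the second variable leaves to infinity away from the first axis
with `f` bounded, if `f` has degree at most four and `f₄ = c x⁴`. -/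
theorem not_flat_quartic (h : IsQuintic f a) (hJ : ∀ x y, ev (Jac f g) x y ≠ 0)
    (hx : Tendsto (fun n => |x n|) l atTop) (hy : Tendsto (fun n => |y n|) l atTop)
    (hz : Tendsto (fun n => x n * (y n)⁻¹) l (𝓝 0)) (hE : ∀ᶠ n in l, quinticY a (x n) (y n) = 0)
    (hF : BddAlong l fun n => quintic a (x n) (y n)) (a50 : a 5 0 = 0) (a41 : a 4 1 = 0)
    (a32 : a 3 2 = 0) (a23 : a 2 3 = 0) (a14 : a 1 4 = 0) (a05 : a 0 5 = 0) (a31 : a 3 1 = 0)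
    (a22 : a 2 2 = 0) (a13 : a 1 3 = 0) (a04 : a 0 4 = 0) : False := by
  have hx0 := ne_zero_along hx
  have hy0 := ne_zero_along hy
  have hX := inv_tendsto_zero hx
  have hY := inv_tendsto_zero hy
  have hE0 := BddAlong.of_eventually_eq_zero hE
  have a03 : a 0 3 = 0 := by
    have := eq_zero_of_tendsto₃ (fun z X r => a 0 1 * z ^ 2 * X ^ 2 + a 1 1 * z ^ 2 * X + 2 * a 0 2 * z * X + a 2 1 * z ^ 2 +
      2 * a 1 2 * z + 3 * a 0 3)
      (hE0.mul_pow_tendsto_zero hY two_ne_zero) hz hX hz (by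
        filter_upwards [hx0, hy0] with n hn hn'
        simp only [quinticY, a04, a05, a13, a14, a22, a23, a31, a32, a41]
        field_simp
        ring) (by fun_prop)
    linear_combination this / 3
  have a12 : a 1 2 = 0 := by
    have := eq_zero_of_tendsto₃ (fun z X r => a 0 1 * z * X ^ 2 + a 1 1 * z * X + 2 * a 0 2 * X + a 2 1 * z + 2 * a 1 2)
      (E := fun n => quinticY a (x n) (y n) * (x n)⁻¹ * (y n)⁻¹)
      (by simpa using (hE0.mul_tendsto_zero hX).mul hY) hz hX hz (by
        filter_upwards [hx0, hy0] with n hn hn'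
        simp only [quinticY, a03, a04, a05, a13, a14, a22, a23, a31, a32, a41]
        field_simp
        ring) (by fun_prop)
    linear_combination this / 2
  by_cases a02 : a 0 2 = 0
  · have hq : ∀ᶠ n in l, a 0 1 + a 1 1 * x n + a 2 1 * x n ^ 2 = 0 := by
      filter_upwards [hE] with n hn
      simp only [quinticY, a02, a03, a04, a05, a12, a13, a14, a22, a23, a31, a32, a41] at hn
      linear_combination hn
    obtain ⟨-, -, a21, a11, a01⟩ := polynomial_coeffs (c0 := 0) (c1 := 0) (c2 := a 0 1) (c3 := a 1 1)
      (c4 := a 2 1) (c5 := 0) (c6 := 0) hx (tendsto_const_nhds.congr' (by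
        filter_upwards [hq] with n hn
        linear_combination -(x n) ^ 2 * (x n)⁻¹ ^ 2 * hn))
    obtain ⟨-, -, -, -, a10⟩ := polynomial_coeffs (c0 := 0) (c1 := a 0 0) (c2 := a 1 0) (c3 := a 2 0)
      (c4 := a 3 0) (c5 := a 4 0) (c6 := 0) hx ((hF.mul_tendsto_zero hX).congr' (by
        filter_upwards [hx0] with n hn
        simp only [quintic, a01, a02, a03, a04, a05, a11, a12, a13, a14, a21, a22, a23, a31, a32, a41, a50]
        field_simp
        ring))
    refine h.not_critical hJ 0 0 ?_ ?_
    · simp only [quinticX, a10]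
      ring
    · simp only [quinticY, a01]
      ring
  · obtain ⟨-, -, -, -, e1⟩ := polynomial_coeffs (c0 := 0) (c1 := 4 * a 0 2 * a 0 0 - a 0 1 ^ 2)
      (c2 := 4 * a 0 2 * a 1 0 - 2 * a 0 1 * a 1 1)
      (c3 := 4 * a 0 2 * a 2 0 - 2 * a 0 1 * a 2 1 - a 1 1 ^ 2)
      (c4 := 4 * a 0 2 * a 3 0 - 2 * a 1 1 * a 2 1) (c5 := 4 * a 0 2 * a 4 0 - a 2 1 ^ 2) (c6 := 0) hx
      (((hF.mul_tendsto_zero hX).const_mul (4 * a 0 2)).congr' (by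
        filter_upwards [hx0, hE] with n hn hn2
        simp only [quinticY, a03, a04, a05, a12, a13, a14, a22, a23, a31, a32, a41] at hn2
        simp only [quintic, a03, a04, a05, a12, a13, a14, a22, a23, a31, a32, a41, a50]
        have h3 : (x n)⁻¹ ^ 2 * x n = (x n)⁻¹ := by field_simp
        linear_combination (2 * a 0 2 * y n + a 0 1 + a 1 1 * x n + a 2 1 * x n ^ 2) * (x n)⁻¹ * hn2 -
          (4 * a 0 2 * a 0 0 - a 0 1 ^ 2 + (4 * a 0 2 * a 1 0 - 2 * a 0 1 * a 1 1) * x n +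
            (4 * a 0 2 * a 2 0 - 2 * a 0 1 * a 2 1 - a 1 1 ^ 2) * x n ^ 2 +
            (4 * a 0 2 * a 3 0 - 2 * a 1 1 * a 2 1) * x n ^ 3 +
            (4 * a 0 2 * a 4 0 - a 2 1 ^ 2) * x n ^ 4) * h3) |>.trans_eq (by simp))
    obtain ⟨y0, hy⟩ : ∃ y0, 2 * a 0 2 * y0 = -a 0 1 :=
      ⟨-a 0 1 / (2 * a 0 2), mul_div_cancel₀ _ (mul_ne_zero two_ne_zero a02)⟩
    refine h.not_critical hJ 0 y0 ?_ ?_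
    · simp only [quinticX, a12, a13, a14, a22, a23, a31, a32, a41, a50]
      refine (mul_eq_zero.1 (?_ : a 0 2 * _ = 0)).resolve_left a02
      linear_combination e1 / 4 + a 1 1 / 2 * hy
    · simp only [quinticY, a03, a04, a05, a12, a13, a14, a22, a23, a31, a32, a41]
      linear_combination hy

theorem flat_quintic_coeffs (hx : Tendsto (fun n => |x n|) l atTop)
    (hy : Tendsto (fun n => |y n|) l atTop) (hz : Tendsto (fun n => x n * (y n)⁻¹) l (𝓝 0))
    (hE : ∀ᶠ n in l, quinticY a (x n) (y n) = 0) (hF : BddAlong l fun n => quintic a (x n) (y n))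
    (a50 : a 5 0 ≠ 0) (a41 : a 4 1 = 0) (a32 : a 3 2 = 0) (a23 : a 2 3 = 0) (a14 : a 1 4 = 0)
    (a05 : a 0 5 = 0) : a 0 4 = 0 ∧ a 1 3 = 0 ∧ a 2 2 = 0 ∧ a 0 3 = 0 ∧ a 1 2 ≠ 0 := by
  have hx0 := ne_zero_along hx
  have hy0 := ne_zero_along hy
  have hX := inv_tendsto_zero hx
  have hY := inv_tendsto_zero hy
  have hE0 := BddAlong.of_eventually_eq_zero hE
  have hG : BddAlong l fun n => 3 * quintic a (x n) (y n) - y n * quinticY a (x n) (y n) := by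
    obtain ⟨c, hc⟩ := hF.exists_tendsto
    refine BddAlong.of_tendsto (c := 3 * c) ((hc.const_mul 3).congr' ?_)
    filter_upwards [hE] with n hn
    rw [hn]
    ring
  have a04 : a 0 4 = 0 := by
    have := eq_zero_of_tendsto₃ (fun z X r => a 0 1 * z ^ 3 * X ^ 3 + a 1 1 * z ^ 3 * X ^ 2 + 2 * a 0 2 * z ^ 2 * X ^ 2 +
      a 2 1 * z ^ 3 * X + 2 * a 1 2 * z ^ 2 * X + 3 * a 0 3 * z * X + a 3 1 * z ^ 3 +
      2 * a 2 2 * z ^ 2 + 3 * a 1 3 * z + 4 * a 0 4)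
      (hE0.mul_pow_tendsto_zero hY (k := 3) (by norm_num)) hz hX hz (by
        filter_upwards [hx0, hy0] with n hn hn'
        simp only [quinticY, a05, a14, a23, a32, a41]
        field_simp
        ring) (by fun_prop)
    linear_combination this / 4
  have a13 : a 1 3 = 0 := by
    have := eq_zero_of_tendsto₃ (fun z X r => a 0 1 * z ^ 2 * X ^ 3 + a 1 1 * z ^ 2 * X ^ 2 + 2 * a 0 2 * z * X ^ 2 +
      a 2 1 * z ^ 2 * X + 2 * a 1 2 * z * X + 3 * a 0 3 * X + a 3 1 * z ^ 2 +
      2 * a 2 2 * z + 3 * a 1 3)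
      (E := fun n => quinticY a (x n) (y n) * (x n)⁻¹ * (y n)⁻¹ ^ 2)
      (by simpa using (hE0.mul_tendsto_zero hX).mul (hY.pow 2)) hz hX hz (by
        filter_upwards [hx0, hy0] with n hn hn'
        simp only [quinticY, a04, a05, a14, a23, a32, a41]
        field_simp
        ring) (by fun_prop)
    linear_combination this / 3
  have main : a 2 2 = 0 ∧ a 0 3 = 0 := by
    rcases tendsto_or_abs_atTop l (fun n => x n ^ 2 * (y n)⁻¹) with ⟨r0, hr⟩ | hr
    · have e1 : 3 * a 0 3 + 2 * a 2 2 * r0 = 0 := by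
        have := eq_zero_of_tendsto₃ (fun z X r => a 0 1 * z ^ 2 * X ^ 2 + a 1 1 * z ^ 2 * X + 2 * a 0 2 * z * X + a 2 1 * z ^ 2 +
      2 * a 1 2 * z + 3 * a 0 3 + a 3 1 * r * z + 2 * a 2 2 * r)
          (hE0.mul_pow_tendsto_zero hY two_ne_zero) hz hX hr (by
            filter_upwards [hx0, hy0] with n hn hn'
            simp only [quinticY, a04, a05, a13, a14, a23, a32, a41]
            field_simp
            ring) (by fun_prop)
        linear_combination this
      have a22 : a 2 2 = 0 := by
        have := eq_zero_of_tendsto₃ (fun z X r => 3 * a 0 0 * z ^ 2 * X ^ 4 + 3 * a 1 0 * z ^ 2 * X ^ 3 + 2 * a 0 1 * z * X ^ 3 +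
            3 * a 2 0 * z ^ 2 * X ^ 2 + 2 * a 1 1 * z * X ^ 2 + a 0 2 * X ^ 2 +
            3 * a 3 0 * z ^ 2 * X + 2 * a 2 1 * z * X + a 1 2 * X + 3 * a 4 0 * z ^ 2 +
            2 * a 3 1 * z + a 2 2 + 3 * a 5 0 * r * z)
          (E := fun n => (3 * quintic a (x n) (y n) - y n * quinticY a (x n) (y n)) *
            (x n)⁻¹ ^ 2 * (y n)⁻¹ ^ 2)
          (by simpa using (hG.mul_pow_tendsto_zero hX two_ne_zero).mul (hY.pow 2)) hz hX hr (by
            filter_upwards [hx0, hy0] with n hn hn'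
            simp only [quintic, quinticY, a04, a05, a13, a14, a23, a32, a41]
            field_simp
            ring) (by fun_prop)
        linear_combination this
      exact ⟨a22, by rw [a22] at e1; linear_combination e1 / 3⟩
    · exfalso
      have hr0 : Tendsto (fun n => y n * (x n)⁻¹ ^ 2) l (𝓝 0) := by
        refine (inv_tendsto_zero hr).congr fun n => ?_
        simp [mul_comm]
      have a22 : a 2 2 = 0 := by
        have := eq_zero_of_tendsto₃ (fun z X r => a 0 1 * z * X ^ 3 + a 1 1 * z * X ^ 2 + 2 * a 0 2 * X ^ 2 + a 2 1 * z * X +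
      2 * a 1 2 * X + 3 * a 0 3 * r + a 3 1 * z + 2 * a 2 2)
          (E := fun n => quinticY a (x n) (y n) * (x n)⁻¹ ^ 2 * (y n)⁻¹)
          (by simpa using (hE0.mul_pow_tendsto_zero hX two_ne_zero).mul hY) hz hX hr0 (by
            filter_upwards [hx0, hy0] with n hn hn'
            simp only [quinticY, a04, a05, a13, a14, a23, a32, a41]
            field_simp
            ring) (by fun_prop)
        linear_combination this / 2
      have h50 : a 5 0 = 0 := by
        have := eq_zero_of_tendsto₃ (fun z X r => 3 * a 0 0 * X ^ 5 + 3 * a 1 0 * X ^ 4 + 2 * a 0 1 * r * X ^ 3 +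
            3 * a 2 0 * X ^ 3 + 2 * a 1 1 * r * X ^ 2 + a 0 2 * r ^ 2 * X +
            3 * a 3 0 * X ^ 2 + 2 * a 2 1 * r * X + a 1 2 * r ^ 2 + 3 * a 4 0 * X +
            2 * a 3 1 * r + 3 * a 5 0)
          (hG.mul_pow_tendsto_zero hX (k := 5) (by norm_num)) hz hX hr0 (by
            filter_upwards [hx0, hy0] with n hn hn'
            simp only [quintic, quinticY, a04, a05, a13, a14, a22, a23, a32, a41]
            field_simp
            ring) (by fun_prop)
        linear_combination this / 3
      exact a50 h50
  obtain ⟨a22, a03⟩ := main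
  refine ⟨a04, a13, a22, a03, fun a12 => ?_⟩
  have hq : ∀ᶠ n in l, a 0 1 + a 1 1 * x n + a 2 1 * x n ^ 2 + a 3 1 * x n ^ 3 + 2 * a 0 2 * y n = 0 := by
    filter_upwards [hE] with n hn
    simp only [quinticY, a03, a04, a05, a12, a13, a14, a22, a23, a32, a41] at hn
    linear_combination hn
  obtain ⟨a31, h50, -⟩ := polynomial_coeffs (c0 := 4 * a 0 2 * a 0 0 - a 0 1 ^ 2)
    (c1 := 4 * a 0 2 * a 1 0 - 2 * a 0 1 * a 1 1)
    (c2 := 4 * a 0 2 * a 2 0 - 2 * a 0 1 * a 2 1 - a 1 1 ^ 2)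
    (c3 := 4 * a 0 2 * a 3 0 - 2 * a 1 1 * a 2 1 - 2 * a 0 1 * a 3 1)
    (c4 := 4 * a 0 2 * a 4 0 - a 2 1 ^ 2 - 2 * a 1 1 * a 3 1)
    (c5 := 4 * a 0 2 * a 5 0 - 2 * a 2 1 * a 3 1) (c6 := -a 3 1 ^ 2) hx
    (((hF.mul_pow_tendsto_zero hX two_ne_zero).const_mul (4 * a 0 2)).congr' (by
      filter_upwards [hq] with n hn
      simp only [quintic, a03, a04, a05, a12, a13, a14, a22, a23, a32, a41]
      linear_combination (2 * a 0 2 * y n + a 0 1 + a 1 1 * x n + a 2 1 * x n ^ 2 + a 3 1 * x n ^ 3) *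
        (x n)⁻¹ ^ 2 * hn) |>.trans_eq (by simp))
  have a31' : a 3 1 = 0 := by simpa using a31
  have a02 : a 0 2 = 0 := by
    rw [a31'] at h50
    have : a 0 2 * a 5 0 = 0 := by linear_combination h50 / 4
    exact (mul_eq_zero.1 this).resolve_right a50
  obtain ⟨-, h50, -⟩ := polynomial_coeffs (c0 := a 0 0) (c1 := a 1 0) (c2 := a 2 0) (c3 := a 3 0)
    (c4 := a 4 0) (c5 := a 5 0) (c6 := 0) hx ((hF.mul_pow_tendsto_zero hX two_ne_zero).congr' (by
      filter_upwards [hq] with n hn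
      simp only [quintic, a02, a03, a04, a05, a12, a13, a14, a22, a23, a32, a41]
      rw [a02] at hn
      linear_combination y n * (x n)⁻¹ ^ 2 * hn))
  exact a50 h50

/-- The algebraic relations in the degenerate quintic case. -/
theorem flat_quintic_relations (hx : Tendsto (fun n => |x n|) l atTop)
    (hE : ∀ᶠ n in l, quinticY a (x n) (y n) = 0) (hF : BddAlong l fun n => quintic a (x n) (y n))
    (a41 : a 4 1 = 0) (a32 : a 3 2 = 0) (a23 : a 2 3 = 0) (a14 : a 1 4 = 0)
    (a05 : a 0 5 = 0) (a04 : a 0 4 = 0) (a13 : a 1 3 = 0) (a22 : a 2 2 = 0) (a03 : a 0 3 = 0)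
    (a02 : a 0 2 = 0) :
    4 * a 1 2 * a 5 0 - a 3 1 ^ 2 = 0 ∧ 4 * a 1 2 * a 4 0 - 2 * a 3 1 * a 2 1 = 0 ∧
      4 * a 1 2 * a 3 0 - 2 * a 3 1 * a 1 1 - a 2 1 ^ 2 = 0 ∧
      4 * a 1 2 * a 2 0 - 2 * a 3 1 * a 0 1 - 2 * a 2 1 * a 1 1 = 0 ∧
      4 * a 1 2 * a 1 0 - 2 * a 2 1 * a 0 1 - a 1 1 ^ 2 = 0 := by
  have hx0 := ne_zero_along hx
  have hX := inv_tendsto_zero hx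
  refine polynomial_coeffs (c0 := -a 0 1 ^ 2) (c1 := 4 * a 1 2 * a 0 0 - 2 * a 0 1 * a 1 1) hx
    (((hF.mul_tendsto_zero hX).const_mul (4 * a 1 2)).congr' (by
      filter_upwards [hx0, hE] with n hn hn2
      simp only [quinticY, a02, a03, a04, a05, a13, a14, a22, a23, a32, a41] at hn2
      trans 4 * a 1 2 * x n * quintic a (x n) (y n) * (x n)⁻¹ ^ 2
      · field_simp
      simp only [quintic, a02, a03, a04, a05, a13, a14, a22, a23, a32, a41]
      linear_combination (2 * a 1 2 * x n * y n + a 0 1 + a 1 1 * x n + a 2 1 * x n ^ 2 +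
        a 3 1 * x n ^ 3) * (x n)⁻¹ ^ 2 * hn2) |>.trans_eq (by simp))

end unbounded

section substitution

/-- Substitution of two polynomials for the variables. -/
noncomputable def sub₂ (φ ψ f : MvPolynomial (Fin 2) ℝ) : MvPolynomial (Fin 2) ℝ := bind₁ ![φ, ψ] f

variable {φ ψ f g : MvPolynomial (Fin 2) ℝ} {a : ℕ → ℕ → ℝ}

theorem ev_sub₂ (φ ψ f : MvPolynomial (Fin 2) ℝ) (x y : ℝ) :
    ev (sub₂ φ ψ f) x y = ev f (ev φ x y) (ev ψ x y) := by
  simp only [ev, sub₂]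
  rw [← coe_aeval_eq_eval, ← coe_aeval_eq_eval]
  simp only [RingHom.coe_coe]
  rw [aeval_bind₁]
  congr 2
  ext i
  fin_cases i <;> simp

theorem pderiv_sub₂ (i : Fin 2) (φ ψ f : MvPolynomial (Fin 2) ℝ) :
    pderiv i (sub₂ φ ψ f) =
      sub₂ φ ψ (pderiv 0 f) * pderiv i φ + sub₂ φ ψ (pderiv 1 f) * pderiv i ψ := by
  simp only [sub₂]
  induction f using MvPolynomial.induction_on with
  | C c => simp
  | add p q hp hq => simp only [map_add, hp, hq]; ring
  | mul_X p j hp =>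
    simp only [map_mul, Derivation.leibniz, smul_eq_mul, hp, map_add, bind₁_X_right]
    fin_cases j <;> simp [pderiv_X] <;> ring

theorem Jac_sub₂ (φ ψ f g : MvPolynomial (Fin 2) ℝ) :
    Jac (sub₂ φ ψ f) (sub₂ φ ψ g) = sub₂ φ ψ (Jac f g) * Jac φ ψ := by
  simp only [Jac, pderiv_sub₂]
  simp only [sub₂, map_sub, map_mul]
  ring

theorem Bad.sub₂ (h : Bad f g) (hJ : ∀ x y, ev (Jac φ ψ) x y ≠ 0)
    (hs : ∀ x y, ∃ x' y', ev φ x' y' = x ∧ ev ψ x' y' = y) : Bad (sub₂ φ ψ f) (sub₂ φ ψ g) := by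
  refine ⟨fun x y => ?_, fun hinj => h.2 ?_⟩
  · rw [Jac_sub₂, ev_mul, ev_sub₂]
    exact mul_ne_zero (h.1 _ _) (hJ _ _)
  · rintro ⟨x1, y1⟩ ⟨x2, y2⟩ he
    obtain ⟨u1, v1, rfl, rfl⟩ := hs x1 y1
    obtain ⟨u2, v2, rfl, rfl⟩ := hs x2 y2
    have : (u1, v1) = (u2, v2) := hinj (by
      simp only [planeMap, Prod.mk.injEq] at he ⊢
      simpa only [ev_sub₂] using he)
    simp only [Prod.mk.injEq] at this
    rw [this.1, this.2]

/-- The substitution `x ↦ x + m y`. -/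
noncomputable def shear (m : ℝ) (f : MvPolynomial (Fin 2) ℝ) : MvPolynomial (Fin 2) ℝ :=
  sub₂ (X 0 + C m * X 1) (X 1) f

/-- The substitution `y ↦ y + m x`. -/
noncomputable def shear' (m : ℝ) (f : MvPolynomial (Fin 2) ℝ) : MvPolynomial (Fin 2) ℝ :=
  sub₂ (X 0) (X 1 + C m * X 0) f

/-- The substitution `x ↦ x + c`. -/
noncomputable def transl (c : ℝ) (f : MvPolynomial (Fin 2) ℝ) : MvPolynomial (Fin 2) ℝ :=
  sub₂ (X 0 + C c) (X 1) f

theorem ev_shear (m : ℝ) (f : MvPolynomial (Fin 2) ℝ) (x y : ℝ) :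
    ev (shear m f) x y = ev f (x + m * y) y := by simp [shear, ev_sub₂]

theorem ev_shear' (m : ℝ) (f : MvPolynomial (Fin 2) ℝ) (x y : ℝ) :
    ev (shear' m f) x y = ev f x (y + m * x) := by simp [shear', ev_sub₂]

theorem ev_transl (c : ℝ) (f : MvPolynomial (Fin 2) ℝ) (x y : ℝ) :
    ev (transl c f) x y = ev f (x + c) y := by simp [transl, ev_sub₂]

theorem pderiv_zero_shear (m : ℝ) (f : MvPolynomial (Fin 2) ℝ) :
    pderiv 0 (shear m f) = shear m (pderiv 0 f) := by
  simp [shear, pderiv_sub₂, pderiv_X]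

theorem pderiv_transl (c : ℝ) (f : MvPolynomial (Fin 2) ℝ) (i : Fin 2) :
    pderiv i (transl c f) = transl c (pderiv i f) := by
  fin_cases i <;> simp [transl, pderiv_sub₂, pderiv_X]

theorem Bad.shear (h : Bad f g) (m : ℝ) : Bad (shear m f) (shear m g) :=
  h.sub₂ (fun x y => by simp [Jac, pderiv_X]) fun x y => ⟨x - m * y, y, by simp, by simp⟩

theorem Bad.shear' (h : Bad f g) (m : ℝ) : Bad (shear' m f) (shear' m g) :=
  h.sub₂ (fun x y => by simp [Jac, pderiv_X]) fun x y => ⟨x, y - m * x, by simp, by simp⟩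

theorem Bad.transl (h : Bad f g) (c : ℝ) : Bad (transl c f) (transl c g) :=
  h.sub₂ (fun x y => by simp [Jac, pderiv_X]) fun x y => ⟨x - c, y, by simp, by simp⟩

theorem Bad.linear (h : Bad f g) {α β γ δ : ℝ} (hd : α * δ - β * γ ≠ 0) :
    Bad (C α * f + C β * g) (C γ * f + C δ * g) := by
  refine ⟨fun x y => ?_, fun hinj => h.2 fun p q he => hinj ?_⟩
  · have : Jac (C α * f + C β * g) (C γ * f + C δ * g) = C (α * δ - β * γ) * Jac f g := by
      simp only [Jac, map_add, map_sub, map_mul, Derivation.leibniz, smul_eq_mul, pderiv_C]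
      ring
    rw [this, ev_mul, ev_C]
    exact mul_ne_zero hd (h.1 x y)
  · simp only [planeMap, Prod.mk.injEq] at he ⊢
    simp only [ev_add, ev_mul, ev_C, he.1, he.2, and_self]

theorem Bad.swap (h : Bad f g) : Bad g f := by
  simpa using h.linear (α := 0) (β := 1) (γ := 1) (δ := 0) (by norm_num)

theorem Bad.add_mul (h : Bad f g) (c : ℝ) : Bad (f + C c * g) g := by
  simpa using h.linear (α := 1) (β := c) (γ := 0) (δ := 1) (by norm_num)

end substitution

section coefficients

/-- Coefficients after `x ↦ x + m y`. -/
noncomputable def shearCoeff (m : ℝ) (a : ℕ → ℕ → ℝ) (i j : ℕ) : ℝ :=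
  ∑ k ∈ Finset.range (j + 1), a (i + k) (j - k) * (i + k).choose k * m ^ k

/-- Coefficients after `y ↦ y + m x`. -/
noncomputable def shearCoeff' (m : ℝ) (a : ℕ → ℕ → ℝ) (i j : ℕ) : ℝ :=
  ∑ k ∈ Finset.range (i + 1), a (i - k) (j + k) * (j + k).choose k * m ^ k

/-- Coefficients after `x ↦ x + c`, for quintics. -/
noncomputable def translCoeff (c : ℝ) (a : ℕ → ℕ → ℝ) (i j : ℕ) : ℝ :=
  ∑ k ∈ Finset.range (6 - i - j), a (i + k) j * (i + k).choose k * c ^ k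

variable {f : MvPolynomial (Fin 2) ℝ} {a b : ℕ → ℕ → ℝ}

theorem quintic_shearCoeff (m : ℝ) (a : ℕ → ℕ → ℝ) (x y : ℝ) :
    quintic (shearCoeff m a) x y = quintic a (x + m * y) y := by
  simp [quintic, shearCoeff, Finset.sum_range_succ, Nat.choose]
  ring

theorem quintic_shearCoeff' (m : ℝ) (a : ℕ → ℕ → ℝ) (x y : ℝ) :
    quintic (shearCoeff' m a) x y = quintic a x (y + m * x) := by
  simp [quintic, shearCoeff', Finset.sum_range_succ, Nat.choose]
  ring

theorem quintic_translCoeff (c : ℝ) (a : ℕ → ℕ → ℝ) (x y : ℝ) :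
    quintic (translCoeff c a) x y = quintic a (x + c) y := by
  simp [quintic, translCoeff, Finset.sum_range_succ, Nat.choose]
  ring

theorem IsQuintic.shear (h : IsQuintic f a) (m : ℝ) : IsQuintic (shear m f) (shearCoeff m a) :=
  fun x y => by rw [ev_shear, quintic_shearCoeff, h]

theorem IsQuintic.shear' (h : IsQuintic f a) (m : ℝ) : IsQuintic (shear' m f) (shearCoeff' m a) :=
  fun x y => by rw [ev_shear', quintic_shearCoeff', h]

theorem IsQuintic.transl (h : IsQuintic f a) (c : ℝ) : IsQuintic (transl c f) (translCoeff c a) :=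
  fun x y => by rw [ev_transl, quintic_translCoeff, h]

theorem IsQuintic.add_mul {g : MvPolynomial (Fin 2) ℝ} (hf : IsQuintic f a) (hg : IsQuintic g b)
    (c : ℝ) : IsQuintic (f + C c * g) fun i j => a i j + c * b i j := fun x y => by
  rw [ev_add, ev_mul, ev_C, hf, hg]
  simp only [quintic]
  ring

/-- All coefficients of degree above `d` vanish. -/
def DegLE (d : ℕ) (a : ℕ → ℕ → ℝ) : Prop := ∀ i j, d < i + j → a i j = 0

theorem DegLE.shear {d : ℕ} (h : DegLE d a) (m : ℝ) : DegLE d (shearCoeff m a) := by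
  intro i j hij
  refine Finset.sum_eq_zero fun k hk => ?_
  rw [Finset.mem_range] at hk
  rw [h _ _ (by omega)]
  ring

theorem DegLE.shear' {d : ℕ} (h : DegLE d a) (m : ℝ) : DegLE d (shearCoeff' m a) := by
  intro i j hij
  refine Finset.sum_eq_zero fun k hk => ?_
  rw [Finset.mem_range] at hk
  rw [h _ _ (by omega)]
  ring

theorem DegLE.transl {d : ℕ} (h : DegLE d a) (c : ℝ) : DegLE d (translCoeff c a) := by
  intro i j hij
  refine Finset.sum_eq_zero fun k _ => ?_
  rw [h _ _ (by omega)]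
  ring

theorem IsQuintic.of_degree {d : ℕ} (h : f.totalDegree ≤ d) (hd : d ≤ 5) :
    ∃ a, IsQuintic f a ∧ DegLE d a := by
  refine ⟨_, IsQuintic.of_totalDegree (h.trans hd), fun i j hij => ?_⟩
  apply coeff_eq_zero_of_totalDegree_lt
  have : ∑ k ∈ (mkExp i j).support, mkExp i j k = i + j := by
    rw [Finset.sum_subset (Finset.subset_univ _), Fin.sum_univ_two, mkExp_zero, mkExp_one]
    intro k _ hk
    simpa using hk
  omega

@[simp] theorem shearCoeff_zero_right (m : ℝ) (a : ℕ → ℕ → ℝ) (i : ℕ) : shearCoeff m a i 0 = a i 0 := by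
  simp [shearCoeff]

theorem translCoeff_top (c : ℝ) (a : ℕ → ℕ → ℝ) {i j : ℕ} (h : i + j = 5) :
    translCoeff c a i j = a i j := by
  simp [translCoeff, show 6 - i - j = 1 by omega]

theorem exists_shearCoeff'_ne_zero {d : ℕ} (h : ∃ i ≤ d, a i (d - i) ≠ 0) :
    ∃ m, shearCoeff' m a d 0 ≠ 0 := by
  by_contra! hc
  obtain ⟨i, hi, hne⟩ := h
  set P : Polynomial ℝ := ∑ k ∈ Finset.range (d + 1), Polynomial.monomial k (a (d - k) k)
  have hP : P = 0 := by
    refine Polynomial.funext fun m => ?_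
    rw [Polynomial.eval_zero, ← hc m]
    simp [P, Polynomial.eval_finsetSum, shearCoeff']
  have h1 : P.coeff (d - i) = a i (d - i) := by
    simp only [P, Polynomial.finsetSum_coeff, Polynomial.coeff_monomial]
    rw [Finset.sum_ite_eq' (Finset.range (d + 1)) (d - i)]
    simp [show d - (d - i) = i by omega, show d - i < d + 1 by omega]
  rw [hP, Polynomial.coeff_zero] at h1
  exact hne h1.symm

end coefficients

section sequences

variable {f g : MvPolynomial (Fin 2) ℝ} {a : ℕ → ℕ → ℝ} {x y : ℕ → ℝ}

theorem exists_seq {P : ℝ × ℝ → Prop} {c : ℝ × ℝ → ℝ} (h : ∀ N : ℝ, ∃ z, P z ∧ N < |c z|) :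
    ∃ x y : ℕ → ℝ, (∀ n, P (x n, y n)) ∧
      Tendsto (fun n => |c (x n, y n)|) (hyperfilter ℕ : Ultrafilter ℕ) atTop := by
  choose z hz hc using fun n : ℕ => h n
  refine ⟨fun n => (z n).1, fun n => (z n).2, hz, ?_⟩
  exact (tendsto_atTop_mono (fun n => (hc n).le) tendsto_natCast_atTop_atTop).mono_left
    Nat.hyperfilter_le_atTop

/-- Multiplication by a power of `x`, on coefficients. -/
def shiftX (k : ℕ) (a : ℕ → ℕ → ℝ) (i j : ℕ) : ℝ := if i < k then 0 else a (i - k) j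

/-- Multiplication by a power of `y`, on coefficients. -/
def shiftY (k : ℕ) (a : ℕ → ℕ → ℝ) (i j : ℕ) : ℝ := if j < k then 0 else a i (j - k)

theorem quintic_shiftX {k : ℕ} (hk : k ≤ 5) (h : DegLE (5 - k) a) (x y : ℝ) :
    quintic (shiftX k a) x y = x ^ k * quintic a x y := by
  interval_cases k <;> (simp (disch := norm_num) only [quintic, shiftX, h _ _]; norm_num) <;> ring

theorem quintic_shiftY {k : ℕ} (hk : k ≤ 5) (h : DegLE (5 - k) a) (x y : ℝ) :
    quintic (shiftY k a) x y = y ^ k * quintic a x y := by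
  interval_cases k <;> (simp (disch := norm_num) only [quintic, shiftY, h _ _]; norm_num) <;> ring

theorem quinticX_shiftY {k : ℕ} (hk : k ≤ 5) (h : DegLE (5 - k) a) (x y : ℝ) :
    quinticX (shiftY k a) x y = y ^ k * quinticX a x y := by
  interval_cases k <;> (simp (disch := norm_num) only [quinticX, shiftY, h _ _]; norm_num) <;> ring

theorem top_eq_zero_of_bounded {ι : Type*} {l : Ultrafilter ι} {x y : ι → ℝ} {d : ℕ} {w : ℝ}
    (hd1 : 1 ≤ d) (hd5 : d ≤ 5) (hdeg : DegLE d a) (hx : Tendsto (fun n => |x n|) l atTop)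
    (hw : Tendsto (fun n => y n * (x n)⁻¹) l (𝓝 w)) (hF : BddAlong l fun n => quintic a (x n) (y n)) :
    ∑ i ∈ Finset.range (d + 1), a (d - i) i * w ^ i = 0 := by
  have hX := inv_tendsto_zero hx
  have hx0 := ne_zero_along hx
  set b := shiftX (5 - d) a with hb
  have h := eq_zero_of_tendsto₃ (fun w u s => b 0 0 * u ^ 5 + b 1 0 * u ^ 4 + b 0 1 * w * u ^ 4 +
      b 2 0 * u ^ 3 + b 1 1 * w * u ^ 3 + b 0 2 * w ^ 2 * u ^ 3 +
      b 3 0 * u ^ 2 + b 2 1 * w * u ^ 2 + b 1 2 * w ^ 2 * u ^ 2 + b 0 3 * w ^ 3 * u ^ 2 +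
      b 4 0 * u + b 3 1 * w * u + b 2 2 * w ^ 2 * u + b 1 3 * w ^ 3 * u + b 0 4 * w ^ 4 * u +
      b 5 0 + b 4 1 * w + b 3 2 * w ^ 2 + b 2 3 * w ^ 3 + b 1 4 * w ^ 4 + b 0 5 * w ^ 5)
      (hF.mul_pow_tendsto_zero hX (k := d) (by omega)) hw hX hX (by
        filter_upwards [hx0] with n hn
        have h1 := quintic_shiftX (k := 5 - d) (by omega)
          (show DegLE (5 - (5 - d)) a by rwa [Nat.sub_sub_self hd5]) (x n) (y n)
        have h2 : quintic a (x n) (y n) * (x n)⁻¹ ^ d = quintic b (x n) (y n) * (x n)⁻¹ ^ 5 := by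
          rw [h1, mul_comm ((x n) ^ (5 - d)), mul_assoc]
          congr 1
          rw [eq_comm, inv_pow, inv_pow, mul_inv_eq_iff_eq_mul₀ (pow_ne_zero _ hn),
            eq_inv_mul_iff_mul_eq₀ (pow_ne_zero _ hn), ← pow_add]
          congr 1
          omega
        rw [h2]
        simp only [quintic]
        field_simp) (by fun_prop)
  rw [← h]
  clear_value b
  subst hb
  interval_cases d <;> simp [Finset.sum_range_succ, shiftX]

/-- Tangencies of the level sets of `f` with the first coordinate direction escape along a vertical
asymptote. -/
structure VerticalCurve (f g : MvPolynomial (Fin 2) ℝ) (x y : ℕ → ℝ) (x0 : ℝ) : Prop where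
  fst : Tendsto x (hyperfilter ℕ : Ultrafilter ℕ) (𝓝 x0)
  snd : Tendsto (fun n => |y n|) (hyperfilter ℕ : Ultrafilter ℕ) atTop
  tangent : ∀ᶠ n in (hyperfilter ℕ : Ultrafilter ℕ), ev (pderiv 0 f) (x n) (y n) = 0
  bound_left : BddAlong (hyperfilter ℕ) fun n => ev f (x n) (y n)
  bound_right : BddAlong (hyperfilter ℕ) fun n => ev g (x n) (y n)

theorem VerticalCurve.transl {x0 : ℝ} (h : VerticalCurve f g x y x0) (c : ℝ) :
    VerticalCurve (transl c f) (transl c g) (fun n => x n - c) y (x0 - c) where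
  fst := h.fst.sub_const c
  snd := h.snd
  tangent := by simpa [pderiv_transl, ev_transl] using h.tangent
  bound_left := by simpa [ev_transl] using h.bound_left
  bound_right := by simpa [ev_transl] using h.bound_right

theorem VerticalCurve.coeffs {x0 : ℝ} (h : VerticalCurve f g x y x0) (hf : IsQuintic f a) :
    a 0 5 = 0 ∧ a 1 4 = 0 := by
  have h1 := h.transl x0
  have h2 := hf.transl x0
  obtain ⟨h05, h14, -⟩ := vertical_coeffs (a := translCoeff x0 a) (by simpa using h1.fst) h1.snd
    (.of_eventually_eq_zero (by simpa only [← h2.pderiv_zero] using h1.tangent))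
    (by simpa only [← h2 _ _] using h1.bound_left)
  rw [translCoeff_top _ _ (by norm_num)] at h05 h14
  exact ⟨h05, h14⟩

theorem VerticalCurve.coeff_ne_zero {x0 : ℝ} (h : VerticalCurve f g x y x0) (hf : IsQuintic f a)
    (hB : Bad f g) : a 2 3 ≠ 0 := by
  intro a23
  have h1 := h.transl x0
  have h2 := hf.transl x0
  refine not_vertical (a := translCoeff x0 a) h2 (hB.transl x0).1 (by simpa using h1.fst) h1.snd
    (by simpa only [← h2.pderiv_zero] using h1.tangent)
    (by simpa only [← h2 _ _] using h1.bound_left) h1.bound_right ?_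
  rwa [translCoeff_top _ _ (by norm_num)]

/-- After a shear, either the top form is divisible by a high power of `x`, or there is a vertical
asymptote. -/
theorem exists_shear_of_bad (h : Bad f g) (hf : IsQuintic f a) {d : ℕ} (hd1 : 1 ≤ d) (hd5 : d ≤ 5)
    (hdeg : DegLE d a) (htop : a d 0 ≠ 0) :
    ∃ m, (∀ i ≤ 3, i ≤ d → shearCoeff m a i (d - i) = 0) ∨
      ∃ x0 x y, VerticalCurve (shear m f) (shear m g) x y x0 := by
  obtain ⟨B, M, E⟩ := h.exists_escapes
  have hno : ∀ x y : ℕ → ℝ, (∀ n, (x n, y n) ∈ B) →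
      Tendsto (fun n => |x n|) (hyperfilter ℕ : Ultrafilter ℕ) atTop →
      ¬ Tendsto (fun n => y n * (x n)⁻¹) (hyperfilter ℕ : Ultrafilter ℕ) (𝓝 0) := by
    intro x y hB hx hz
    have hF : BddAlong (hyperfilter ℕ) fun n => quintic a (x n) (y n) :=
      ⟨M, .of_forall fun n => by simpa only [← hf _ _] using E.bound_left _ (hB n)⟩
    have h1 := top_eq_zero_of_bounded hd1 hd5 hdeg hx hz hF
    rw [Finset.sum_eq_single 0 (by intro i _ hi; simp [hi]) (by simp)] at h1
    exact htop (by simpa using h1)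
  have hy : ∀ N : ℝ, ∃ z ∈ B, N < |z.2| := by
    rcases E.unbounded with hx | hy
    · by_contra! hc
      obtain ⟨N, hN⟩ := hc
      obtain ⟨x, y, hB, hx⟩ := exists_seq (c := Prod.fst) hx
      refine hno x y hB hx (BddAlong.mul_tendsto_zero ⟨N, .of_forall fun n => hN _ (hB n)⟩
        (inv_tendsto_zero hx))
    · exact hy
  obtain ⟨x, y, hB, hy⟩ := exists_seq (P := fun z => z ∈ B ∧ ev (pderiv 0 f) z.1 z.2 = 0)
    (c := Prod.snd) fun N => by
      obtain ⟨z, hz, hN, h0⟩ := E.tangent_snd hy N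
      exact ⟨z, ⟨hz, h0⟩, hN⟩
  have hy0 := ne_zero_along hy
  have hY := inv_tendsto_zero hy
  obtain ⟨m, hm⟩ : ∃ m, Tendsto (fun n => x n * (y n)⁻¹) (hyperfilter ℕ : Ultrafilter ℕ) (𝓝 m) := by
    refine (tendsto_or_abs_atTop _ _).resolve_right fun hc => ?_
    refine hno x y (fun n => (hB n).1) ?_ ?_
    · refine (hc.atTop_mul_atTop₀ hy).congr' ?_
      filter_upwards [hy0] with n hn
      rw [← abs_mul, inv_mul_cancel_right₀ hn]
    · refine (inv_tendsto_zero hc).congr fun n => ?_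
      rw [mul_inv, inv_inv, mul_comm]
  refine ⟨m, ?_⟩
  have hbF : BddAlong (hyperfilter ℕ) fun n => ev (shear m f) (x n - m * y n) (y n) :=
    ⟨M, .of_forall fun n => by simpa [ev_shear] using E.bound_left _ (hB n).1⟩
  have hbG : BddAlong (hyperfilter ℕ) fun n => ev (shear m g) (x n - m * y n) (y n) :=
    ⟨M, .of_forall fun n => by simpa [ev_shear] using E.bound_right _ (hB n).1⟩
  have hT : ∀ n, ev (pderiv 0 (shear m f)) (x n - m * y n) (y n) = 0 := fun n => by
    simpa [pderiv_zero_shear, ev_shear] using (hB n).2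
  rcases tendsto_or_abs_atTop (hyperfilter ℕ) fun n => x n - m * y n with ⟨x0, hx0⟩ | hx
  · exact Or.inr ⟨x0, _, y, hx0, hy, .of_forall hT, hbF, hbG⟩
  left
  have hb := hf.shear m
  have hbd := hdeg.shear m
  set b := shearCoeff m a
  rcases hd1.eq_or_lt with rfl | hd2
  · exfalso
    have := hT 0
    rw [hb.pderiv_zero] at this
    simp (disch := norm_num) only [quinticX, hbd _ _] at this
    apply htop
    have h10 : b 1 0 = a 1 0 := shearCoeff_zero_right m a 1
    rw [← h10]
    linarith
  · have hk : DegLE (5 - (5 - d)) b := by rwa [Nat.sub_sub_self hd5]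
    have hq : ∀ n, quintic (shiftY (5 - d) b) (x n - m * y n) (y n) =
        y n ^ (5 - d) * ev (shear m f) (x n - m * y n) (y n) := fun n => by
      rw [quintic_shiftY (by omega) hk, hb]
    have hXX := inv_tendsto_zero hx
    have key := steep_coeffs (a := shiftY (5 - d) b) hx hy (by
        refine (show Tendsto (fun n => x n * (y n)⁻¹ - m) (hyperfilter ℕ : Ultrafilter ℕ) (𝓝 0) by
          simpa using hm.sub_const m).congr' ?_
        filter_upwards [hy0] with n hn
        field_simp) (.of_forall fun n => by
          rw [quinticX_shiftY (by omega) hk, ← hb.pderiv_zero, hT, mul_zero]) (by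
        refine (hbF.mul_pow_tendsto_zero hY (k := d - 1) (by omega)).congr' ?_
        filter_upwards [hy0] with n hn
        rw [hq]
        interval_cases d <;> norm_num <;> field_simp) (by
        have h0 := (hbF.mul_tendsto_zero hXX).mul (hY.pow (d - 2))
        rw [zero_mul] at h0
        refine h0.congr' ?_
        filter_upwards [hy0] with n hn
        rw [hq]
        interval_cases d <;> norm_num <;> field_simp)
    interval_cases d <;> simp [shiftY] at key <;> intro i hi hi' <;> interval_cases i <;> simp [key]

end sequences

section lowDegree

variable {f g : MvPolynomial (Fin 2) ℝ} {a : ℕ → ℕ → ℝ}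

/-- When the top form is a power of `x`, the escaping tangencies are nearly vertical. -/
theorem exists_flat_of_bad (h : Bad f g) (hf : IsQuintic f a) {d : ℕ} (hd1 : 1 ≤ d) (hd5 : d ≤ 5)
    (hdeg : DegLE d a) (htop : a d 0 ≠ 0) (hz : ∀ i < d, a i (d - i) = 0) :
    ∃ x y : ℕ → ℝ, Tendsto (fun n => |x n|) (hyperfilter ℕ : Ultrafilter ℕ) atTop ∧
      Tendsto (fun n => |y n|) (hyperfilter ℕ : Ultrafilter ℕ) atTop ∧
      Tendsto (fun n => x n * (y n)⁻¹) (hyperfilter ℕ : Ultrafilter ℕ) (𝓝 0) ∧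
      (∀ᶠ n in (hyperfilter ℕ : Ultrafilter ℕ), quinticY a (x n) (y n) = 0) ∧
      BddAlong (hyperfilter ℕ) fun n => quintic a (x n) (y n) := by
  obtain ⟨B, M, E⟩ := h.exists_escapes
  by_cases hx : ∀ N : ℝ, ∃ z ∈ B, N < |z.1|
  · obtain ⟨x, y, hB, hx⟩ := exists_seq (P := fun z => z ∈ B ∧ ev (pderiv 1 f) z.1 z.2 = 0)
      (c := Prod.fst) fun N => by
        obtain ⟨z, hz, hN, h0⟩ := E.tangent_fst hx N
        exact ⟨z, ⟨hz, h0⟩, hN⟩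
    have hF : BddAlong (hyperfilter ℕ) fun n => quintic a (x n) (y n) :=
      ⟨M, .of_forall fun n => by simpa only [← hf _ _] using E.bound_left _ (hB n).1⟩
    have hy : Tendsto (fun n => |y n * (x n)⁻¹|) (hyperfilter ℕ : Ultrafilter ℕ) atTop := by
      refine (tendsto_or_abs_atTop _ _).resolve_left fun ⟨w, hw⟩ => ?_
      have h1 := top_eq_zero_of_bounded hd1 hd5 hdeg hx hw hF
      rw [Finset.sum_eq_single 0 (by
        intro i hi h0
        have := hz (d - i) (by omega)
        rw [Nat.sub_sub_self (by simpa [Nat.lt_succ_iff] using hi)] at this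
        simp [this]) (by simp)] at h1
      exact htop (by simpa using h1)
    refine ⟨x, y, hx, ?_, ?_, .of_forall fun n => by rw [← hf.pderiv_one]; exact (hB n).2, hF⟩
    · refine (hy.atTop_mul_atTop₀ hx).congr' ?_
      filter_upwards [ne_zero_along hx] with n hn
      rw [← abs_mul, inv_mul_cancel_right₀ hn]
    · refine (inv_tendsto_zero hy).congr fun n => ?_
      rw [mul_inv, inv_inv, mul_comm]
  · exfalso
    have hy := E.unbounded.resolve_left hx
    push Not at hx
    obtain ⟨N, hN⟩ := hx
    obtain ⟨x, y, hB, hy⟩ := exists_seq (P := fun z => z ∈ B ∧ ev (pderiv 0 f) z.1 z.2 = 0)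
      (c := Prod.snd) fun N => by
        obtain ⟨z, hz, hN, h0⟩ := E.tangent_snd hy N
        exact ⟨z, ⟨hz, h0⟩, hN⟩
    have hxb : BddAlong (hyperfilter ℕ) x := ⟨N, .of_forall fun n => hN (x n, y n) (hB n).1⟩
    obtain ⟨x0, hx0⟩ := hxb.exists_tendsto
    have hV : VerticalCurve f g x y x0 := ⟨hx0, hy, .of_forall fun n => (hB n).2,
      ⟨M, .of_forall fun n => E.bound_left (x n, y n) (hB n).1⟩,
      ⟨M, .of_forall fun n => E.bound_right (x n, y n) (hB n).1⟩⟩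
    refine hV.coeff_ne_zero hf h ?_
    rcases hd5.eq_or_lt with rfl | hd
    · exact hz 2 (by norm_num)
    · exact hdeg _ _ hd

theorem not_bad_of_degLE_four {d : ℕ} (hd : d ≤ 4) (h : Bad f g) (hf : IsQuintic f a)
    (hdeg : DegLE d a) : False := by
  induction d with
  | zero =>
    refine hf.not_critical h.1 0 0 ?_ ?_
    · simp (disch := norm_num) only [quinticX, hdeg _ _]; norm_num
    · simp (disch := norm_num) only [quinticY, hdeg _ _]; norm_num
  | succ d ih =>
    by_cases hne : ∃ i ≤ d + 1, a i (d + 1 - i) ≠ 0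
    · clear ih
      obtain ⟨m, hm⟩ := exists_shearCoeff'_ne_zero hne
      have h' := h.shear' m
      have hf' := hf.shear' m
      have hdeg' := hdeg.shear' m
      obtain ⟨k, hk⟩ := exists_shear_of_bad h' hf' (by omega) (by omega) hdeg' hm
      have h2 := h'.shear k
      have hf2 := hf'.shear k
      have hdeg2 := hdeg'.shear k
      rw [← shearCoeff_zero_right k (shearCoeff' m a) (d + 1)] at hm
      set b := shearCoeff k (shearCoeff' m a)
      rcases hk with hz | ⟨x0, x, y, hV⟩
      · have hz' : ∀ i < d + 1, b i (d + 1 - i) = 0 := fun i hi => hz i (by omega) (by omega)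
        obtain ⟨x, y, hx, hy, hxy, hY, hF⟩ :=
          exists_flat_of_bad h2 hf2 (by omega) (by omega) hdeg2 hm hz'
        have h4 : ∀ i < 4, b i (4 - i) = 0 := fun i hi => by
          rcases hd.eq_or_lt with h3 | h3
          · rw [h3] at hz'
            exact hz' i hi
          · exact hdeg2 _ _ (by omega)
        exact not_flat_quartic hf2 h2.1 hx hy hxy hY hF (hdeg2 _ _ (by omega)) (hdeg2 _ _ (by omega))
          (hdeg2 _ _ (by omega)) (hdeg2 _ _ (by omega)) (hdeg2 _ _ (by omega))
          (hdeg2 _ _ (by omega)) (h4 3 (by norm_num)) (h4 2 (by norm_num)) (h4 1 (by norm_num))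
          (h4 0 (by norm_num))
      · exact hV.coeff_ne_zero hf2 h2 (hdeg2 _ _ (by omega))
    · push Not at hne
      refine ih (by omega) fun i j hij => ?_
      rcases (show d + 1 ≤ i + j from hij).eq_or_lt with h1 | h1
      · rw [show j = d + 1 - i by omega]
        exact hne i (by omega)
      · exact hdeg i j h1

theorem DegLE.five {f : MvPolynomial (Fin 2) ℝ} (hf : IsQuintic f a) :
    ∃ b, IsQuintic f b ∧ DegLE 5 b ∧ ∀ i j, i + j ≤ 5 → b i j = a i j := by
  refine ⟨fun i j => if i + j ≤ 5 then a i j else 0, fun x y => by simpa [quintic] using hf x y,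
    fun i j hij => if_neg (by omega), fun i j hij => if_pos hij⟩

/-- The normal form in which the two highest powers of `y` can be completed to a square. -/
theorem not_bad_of_completed_square (h : Bad f g) (hf : IsQuintic f a) (hdeg : DegLE 5 a) (a50 : a 5 0 ≠ 0)
    (a41 : a 4 1 = 0) (a32 : a 3 2 = 0) (a23 : a 2 3 = 0) (a14 : a 1 4 = 0) (a05 : a 0 5 = 0)
    (a02 : a 0 2 = 0) : False := by
  obtain ⟨x, y, hx, hy, hxy, hY, hF⟩ := exists_flat_of_bad h hf (by norm_num) le_rfl hdeg a50
    (by intro i hi; interval_cases i <;> assumption)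
  obtain ⟨a04, a13, a22, a03, a12⟩ := flat_quintic_coeffs hx hy hxy hY hF a50 a41 a32 a23 a14 a05
  obtain ⟨r5, r4, r3, r2, r1⟩ :=
    flat_quintic_relations hx hY hF a41 a32 a23 a14 a05 a04 a13 a22 a03 a02
  have h2 : Bad (sub₂ (X 0) (C (1 / (2 * a 1 2)) *
      (X 1 - C (a 3 1) * X 0 ^ 2 - C (a 2 1) * X 0 - C (a 1 1))) f) (sub₂ (X 0) (C (1 / (2 * a 1 2)) *
      (X 1 - C (a 3 1) * X 0 ^ 2 - C (a 2 1) * X 0 - C (a 1 1))) g) := by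
    refine h.sub₂ (fun x y => ?_) fun x y => ⟨x, 2 * a 1 2 * y + a 3 1 * x ^ 2 + a 2 1 * x + a 1 1,
      by simp, ?_⟩
    · simp [Jac, pderiv_X, a12]
    · simp only [ev_mul, ev_C, ev_sub, ev_X1, ev_X0, ev_pow]
      field_simp
      ring
  refine not_bad_of_degLE_four (d := 3) (by norm_num) h2 (a := fun i j =>
    if i = 1 ∧ j = 2 then 1 / (4 * a 1 2) else if i = 0 ∧ j = 1 then a 0 1 / (2 * a 1 2) else
    if i = 0 ∧ j = 0 then a 0 0 - a 0 1 * a 1 1 / (2 * a 1 2) else 0) (fun x z => ?_) fun i j hij => ?_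
  · rw [ev_sub₂, hf]
    simp only [ev_mul, ev_C, ev_sub, ev_X1, ev_X0, ev_pow]
    obtain ⟨y, rfl⟩ : ∃ y, z = 2 * a 1 2 * y + a 3 1 * x ^ 2 + a 2 1 * x + a 1 1 :=
      ⟨(z - a 3 1 * x ^ 2 - a 2 1 * x - a 1 1) / (2 * a 1 2), by field_simp; ring⟩
    rw [show 1 / (2 * a 1 2) * (2 * a 1 2 * y + a 3 1 * x ^ 2 + a 2 1 * x + a 1 1 - a 3 1 * x ^ 2 -
      a 2 1 * x - a 1 1) = y by field_simp; ring]
    simp [quintic, a41, a32, a23, a14, a05, a02, a04, a13, a22, a03]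
    field_simp
    linear_combination 2 * (x ^ 5 * r5 + x ^ 4 * r4 + x ^ 3 * r3 + x ^ 2 * r2 + x * r1)
  · dsimp only
    split_ifs <;> first | rfl | omega

theorem not_bad_of_top_eq_pow (h : Bad f g) (hf : IsQuintic f a) (a50 : a 5 0 ≠ 0)
    (a41 : a 4 1 = 0) (a32 : a 3 2 = 0) (a23 : a 2 3 = 0) (a14 : a 1 4 = 0) (a05 : a 0 5 = 0) :
    False := by
  obtain ⟨b, hb, hdeg, hba⟩ := DegLE.five hf
  rw [← hba _ _ (by norm_num)] at a50 a41 a32 a23 a14 a05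
  obtain ⟨x, y, hx, hy, hxy, hY, hF⟩ := exists_flat_of_bad h hb (by norm_num) le_rfl hdeg a50
    (by intro i hi; interval_cases i <;> assumption)
  obtain ⟨a04, a13, a22, a03, a12⟩ := flat_quintic_coeffs hx hy hxy hY hF a50 a41 a32 a23 a14 a05
  refine not_bad_of_completed_square (h.transl (-b 0 2 / b 1 2)) (hb.transl _) (hdeg.transl _)
    ?_ ?_ ?_ ?_ ?_ ?_ ?_
  iterate 6 rwa [translCoeff_top _ _ (by norm_num)]
  simp [translCoeff, Finset.sum_range_succ, a22, a32]
  field_simp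
  ring

end lowDegree

section pencil

variable {f g k : MvPolynomial (Fin 2) ℝ} {a b : ℕ → ℕ → ℝ} {x y : ℕ → ℝ} {p q e : ℤ}

theorem IsQuintic.wt_le (h : IsQuintic f a)
    (h0 : ∀ i : ℕ, i ≤ 5 → ∀ j : ℕ, j ≤ 5 → i + j ≤ 5 → e < q * j - p * i → a i j = 0) :
    ∀ d ∈ f.support, wt p q d ≤ e := by
  intro d hd
  by_contra! hc
  rw [mem_support_iff, h.coeff] at hd
  apply hd
  split_ifs with h5
  · exact h0 _ (by omega) _ (by omega) h5 hc
  · rfl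

theorem IsQuintic.coeff_lead (h : IsQuintic f a) (hq : 1 ≤ q) {i j : ℕ} (hij : q * j - p * i = e) :
    (lead p q e 1 f).coeff i = if i + j ≤ 5 then a i j else 0 := by
  have := _root_.coeff_lead (f := f) (ε := 1) hq (d := mkExp i j) (by simpa [wt] using hij)
  simpa [h.coeff] using this

theorem IsQuintic.lead_eq_one (h : IsQuintic f a) : lead 1 1 1 1 f =
    Polynomial.C (a 0 1) + Polynomial.C (a 1 2) * Polynomial.X +
      Polynomial.C (a 2 3) * Polynomial.X ^ 2 := by
  ext n
  rw [h.coeff_lead le_rfl (j := n + 1) (by push_cast; ring)]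
  rcases n with _ | _ | _ | n
  · simp
  · simp [Polynomial.coeff_C]
  · simp
  · rw [if_neg (by omega)]
    simp

theorem IsQuintic.lead_eq_two (h : IsQuintic f a) : lead 1 1 2 1 f =
    Polynomial.C (a 0 2) + Polynomial.C (a 1 3) * Polynomial.X := by
  ext n
  rw [h.coeff_lead le_rfl (j := n + 2) (by push_cast; ring)]
  rcases n with _ | _ | n
  · simp
  · simp [Polynomial.coeff_C]
  · rw [if_neg (by omega)]
    simp

theorem IsQuintic.lead_eq_zero (h : IsQuintic f a) : lead 1 1 0 1 f =
    Polynomial.C (a 0 0) + Polynomial.C (a 1 1) * Polynomial.X +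
      Polynomial.C (a 2 2) * Polynomial.X ^ 2 := by
  ext n
  rw [h.coeff_lead le_rfl (j := n) (by ring)]
  rcases n with _ | _ | _ | n
  · simp
  · simp [Polynomial.coeff_C]
  · simp
  · rw [if_neg (by omega)]
    simp

theorem VerticalCurve.pencil_coeffs (h : Bad f k) (hf : IsQuintic f a) (hk : IsQuintic k b)
    (V : VerticalCurve f k x y 0) (b05 : b 0 5 = 0) (b14 : b 1 4 = 0) (b23 : b 2 3 = 0) :
    ∃ s, s ≠ 0 ∧ a 1 2 = -2 * a 2 3 * s ∧ a 0 1 = a 2 3 * s ^ 2 ∧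
      (a 0 2 = 0 ∧ a 0 3 = 0 ∧ a 0 4 = 0 ∧ a 1 3 = 0) ∧
      (b 0 2 = 0 ∧ b 0 3 = 0 ∧ b 0 4 = 0 ∧ b 1 3 = 0) ∧ b 0 1 + b 1 2 * s = 0 := by
  have a23 := V.coeff_ne_zero hf h
  have hX : ∀ᶠ n in (hyperfilter ℕ : Ultrafilter ℕ), quinticX a (x n) (y n) = 0 := by
    simpa only [← hf.pderiv_zero] using V.tangent
  have hF : BddAlong (hyperfilter ℕ) fun n => quintic a (x n) (y n) := by
    simpa only [← hf _ _] using V.bound_left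
  have hK : BddAlong (hyperfilter ℕ) fun n => quintic b (x n) (y n) := by
    simpa only [← hk _ _] using V.bound_right
  have hx := V.fst
  have hy := V.snd
  have hy0 := ne_zero_along hy
  have hu := inv_tendsto_zero hy
  obtain ⟨a05, a14, a04, a13, a03⟩ := vertical_coeffs hx hy (.of_eventually_eq_zero hX) hF
  obtain ⟨s, hs0, hs, a12, a01, a02⟩ := vertical_main hf h.1 hx hy hX hF V.bound_right a23
  have b04 : b 0 4 = 0 := by
    have := eq_zero_of_tendsto₃ (fun x u s => b 0 0 * u ^ 4 + b 1 0 * x * u ^ 4 + b 0 1 * u ^ 3 +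
      b 2 0 * x ^ 2 * u ^ 4 + b 1 1 * x * u ^ 3 + b 0 2 * u ^ 2 + b 3 0 * x ^ 3 * u ^ 4 +
      b 2 1 * x ^ 2 * u ^ 3 + b 1 2 * x * u ^ 2 + b 0 3 * u + b 4 0 * x ^ 4 * u ^ 4 +
      b 3 1 * x ^ 3 * u ^ 3 + b 2 2 * x ^ 2 * u ^ 2 + b 1 3 * x * u + b 0 4 +
      b 5 0 * x ^ 5 * u ^ 4 + b 4 1 * x ^ 4 * u ^ 3 + b 3 2 * x ^ 3 * u ^ 2)
      (hK.mul_pow_tendsto_zero hu (k := 4) (by norm_num)) hx hu hu (by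
        filter_upwards [hy0] with n hn
        simp only [quintic, b05, b14, b23]
        field_simp
        ring) (by fun_prop)
    linear_combination this
  have b03 : b 0 3 = 0 := by
    have := eq_zero_of_tendsto₃ (fun x u s => b 0 0 * u ^ 3 + b 1 0 * x * u ^ 3 + b 0 1 * u ^ 2 +
      b 2 0 * x ^ 2 * u ^ 3 + b 1 1 * x * u ^ 2 + b 0 2 * u + b 3 0 * x ^ 3 * u ^ 3 +
      b 2 1 * x ^ 2 * u ^ 2 + b 1 2 * x * u + b 0 3 + b 4 0 * x ^ 4 * u ^ 3 +
      b 3 1 * x ^ 3 * u ^ 2 + b 2 2 * x ^ 2 * u + b 1 3 * x +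
      b 5 0 * x ^ 5 * u ^ 3 + b 4 1 * x ^ 4 * u ^ 2 + b 3 2 * x ^ 3 * u)
      (hK.mul_pow_tendsto_zero hu (k := 3) (by norm_num)) hx hu hu (by
        filter_upwards [hy0] with n hn
        simp only [quintic, b05, b14, b23, b04]
        field_simp
        ring) (by fun_prop)
    linear_combination this
  have b02 : b 0 2 + b 1 3 * s = 0 := by
    have := eq_zero_of_tendsto₃ (fun x u s => b 0 0 * u ^ 2 + b 1 0 * x * u ^ 2 + b 0 1 * u +
      b 2 0 * x ^ 2 * u ^ 2 + b 1 1 * x * u + b 0 2 + b 3 0 * x ^ 3 * u ^ 2 +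
      b 2 1 * x ^ 2 * u + b 1 2 * x + b 4 0 * x ^ 4 * u ^ 2 +
      b 3 1 * x ^ 3 * u + b 2 2 * x ^ 2 + b 1 3 * s +
      b 5 0 * x ^ 5 * u ^ 2 + b 4 1 * x ^ 4 * u + b 3 2 * x ^ 3)
      (hK.mul_pow_tendsto_zero hu (k := 2) (by norm_num)) hx hu hs (by
        filter_upwards [hy0] with n hn
        simp only [quintic, b05, b14, b23, b04, b03]
        field_simp
        ring) (by fun_prop)
    linear_combination this
  obtain ⟨σ, -, hσ⟩ := exists_sign h.1
  have hode := lead_jac_eq_zero (a := 1) (b := 2) hσ (Or.inl rfl)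
    (hf.wt_le (by intro i hi j hj _ _; interval_cases i <;> interval_cases j <;> omega))
    (hk.wt_le (by intro i hi j hj _ _; interval_cases i <;> interval_cases j <;> omega))
    (by decide)
  rw [hf.lead_eq_one, hk.lead_eq_two] at hode
  have b13 : b 1 3 = 0 := by
    have := congrArg (Polynomial.eval (s + 1)) hode
    simp [a12, a01, Polynomial.derivative_pow] at this
    have h3 : a 2 3 * b 1 3 * 3 = 0 := by linear_combination this - 4 * a 2 3 * b02
    simpa [a23] using h3
  have b02 : b 0 2 = 0 := by simpa [b13] using b02
  refine ⟨s, hs0, a12, a01, ⟨a02, a03, a04, a13⟩, ⟨b02, b03, b04, b13⟩, ?_⟩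
  have := eq_zero_of_tendsto₃ (fun x u s => b 0 0 * u + b 1 0 * x * u + b 0 1 +
      b 2 0 * x ^ 2 * u + b 1 1 * x + b 3 0 * x ^ 3 * u +
      b 2 1 * x ^ 2 + b 1 2 * s + b 4 0 * x ^ 4 * u +
      b 3 1 * x ^ 3 + b 2 2 * x * s +
      b 5 0 * x ^ 5 * u + b 4 1 * x ^ 4 + b 3 2 * x ^ 2 * s)
      (hK.mul_pow_tendsto_zero hu (k := 1) (by norm_num)) hx hu hs (by
        filter_upwards [hy0] with n hn
        simp only [quintic, b05, b14, b23, b04, b03, b02, b13]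
        field_simp
        ring) (by fun_prop)
  linear_combination this

theorem not_bad_of_square_of_negative {s : ℝ} (h : Bad f k) (hf : IsQuintic f a) (hk : IsQuintic k b)
    (hs : s ≠ 0) (a05 : a 0 5 = 0) (a14 : a 1 4 = 0) (a02 : a 0 2 = 0) (a03 : a 0 3 = 0)
    (a04 : a 0 4 = 0) (a13 : a 1 3 = 0) (a23 : a 2 3 ≠ 0) (a12 : a 1 2 = -2 * a 2 3 * s)
    (a01 : a 0 1 = a 2 3 * s ^ 2) (b05 : b 0 5 = 0) (b14 : b 1 4 = 0) (b23 : b 2 3 = 0)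
    (b02 : b 0 2 = 0) (b03 : b 0 3 = 0) (b04 : b 0 4 = 0) (b13 : b 1 3 = 0) (b12 : b 1 2 = 0)
    (b01 : b 0 1 = 0) : False := by
  obtain ⟨σ, hσ0, hσ⟩ := exists_sign h.1
  have hfw := hf.wt_le (p := 1) (q := 1) (e := 1) (by
    intro i hi j hj _ _; interval_cases i <;> interval_cases j <;> omega)
  have hode := lead_jac_eq_zero (a := 1) (b := 0) hσ (Or.inl rfl) hfw
    (hk.wt_le (by intro i hi j hj _ _; interval_cases i <;> interval_cases j <;> omega))
    (by decide)
  have hA0 : lead 1 1 1 1 f ≠ 0 := fun h0 => by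
    have := congrArg (fun P => Polynomial.coeff P 2) h0
    simp [hf.lead_eq_one, a23] at this
  have hAs : (lead 1 1 1 1 f).eval s = 0 := by
    rw [hf.lead_eq_one]
    simp [a12, a01]
    ring
  have hG : (lead 1 1 0 1 k).derivative = 0 := by simpa [hA0] using hode.symm
  rw [hk.lead_eq_zero] at hG
  have b11 : b 1 1 = 0 := by simpa using congrArg (Polynomial.eval 0) hG
  have b22 : b 2 2 = 0 := by simpa [b11] using congrArg (Polynomial.eval 1) hG
  set k' := k + C (-b 0 0) with hk'
  have hJ : Jac f k' = Jac f k := by simp [Jac, hk']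
  have hkc : ∀ d ∈ k'.support, wt 1 1 d ≤ -1 := by
    have : IsQuintic k' fun i j => if i = 0 ∧ j = 0 then 0 else b i j := fun x y => by
      rw [hk', ev_add, hk, ev_C]
      simp [quintic]
      ring
    refine this.wt_le ?_
    intro i hi j hj _ _
    interval_cases i <;> interval_cases j <;> first | omega | simp [b01, b02, b03, b04, b05, b11, b12, b13, b14, b22, b23]
  have hk0 : k'.support.Nonempty := by
    rw [Finset.nonempty_iff_ne_empty, Ne, support_eq_empty]
    intro h0
    apply h.1 0 0
    rw [← hJ, h0]
    simp [Jac]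
  obtain ⟨d, hd, hmax⟩ := Finset.exists_max_image _ (wt 1 1) hk0
  have hG0 : lead 1 1 (wt 1 1 d) 1 k' ≠ 0 := fun h0 => by
    have h1 := coeff_lead (f := k') (ε := 1) le_rfl (rfl : wt 1 1 d = wt 1 1 d)
    rw [h0] at h1
    simp at h1
    exact mem_support_iff.1 hd h1.symm
  have hd1 := hkc d hd
  refine Polynomial.not_two_roots hA0 hG0 (m := (-wt 1 1 d).toNat) (k := 1) (by omega) one_pos
    (σ := -σ) (by simpa) (fun t => ?_) hs (by simp [hAs]) ?_
  · have h1 := lead_jac_nonneg (σ := σ) (f := f) (g := k') (ε := 1) (by rwa [hJ]) le_rfl hfw hmax t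
    have h2 : (((-wt 1 1 d).toNat : ℕ) : ℝ) = -(wt 1 1 d : ℝ) := by
      have : (((-wt 1 1 d).toNat : ℕ) : ℤ) = -wt 1 1 d := Int.toNat_of_nonneg (by omega)
      exact_mod_cast congrArg (Int.cast : ℤ → ℝ) this
    rw [h2]
    refine h1.trans_eq ?_
    push_cast
    ring
  · rw [Polynomial.eval_mul, ← Polynomial.coeff_zero_eq_eval_zero (lead 1 1 (wt 1 1 d) 1 k'),
      coeff_lead_of_forall_ne, mul_zero]
    intro j
    push_cast
    omega

theorem not_two_vertical (h : Bad f g) (hf : IsQuintic f a) (hg : IsQuintic g b) {x' y' : ℕ → ℝ}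
    {x0 : ℝ} (V : VerticalCurve f g x y 0) (V' : VerticalCurve g f x' y' x0) : False := by
  have a23 := V.coeff_ne_zero hf h
  have b23 := V'.coeff_ne_zero hg h.swap
  obtain ⟨a05, a14⟩ := V.coeffs hf
  obtain ⟨b05, b14⟩ := V'.coeffs hg
  set κ := -(b 2 3 / a 2 3) with hκ
  have hk : Bad f (g + C κ * f) := (h.swap.add_mul κ).swap
  have hkq := hg.add_mul hf κ
  have Vk : VerticalCurve f (g + C κ * f) x y 0 := ⟨V.fst, V.snd, V.tangent, V.bound_left, by
    obtain ⟨u, hu⟩ := V.bound_left.exists_tendsto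
    obtain ⟨v, hv⟩ := V.bound_right.exists_tendsto
    refine .of_tendsto (c := v + κ * u) ?_
    simpa using hv.add (hu.const_mul κ)⟩
  set c : ℕ → ℕ → ℝ := fun i j => b i j + κ * a i j with hc
  have hcc : ∀ i j, c i j = b i j + κ * a i j := fun _ _ => rfl
  have c05 : c 0 5 = 0 := by simp [hcc, a05, b05]
  have c14 : c 1 4 = 0 := by simp [hcc, a14, b14]
  have c23 : c 2 3 = 0 := by simp only [hcc, hκ]; field_simp; ring
  clear_value c
  obtain ⟨s, hs, a12, a01, ⟨a02, a03, a04, a13⟩, ⟨c02, c03, c04, c13⟩, hcs⟩ :=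
    Vk.pencil_coeffs hk hf hkq c05 c14 c23
  have b13 : b 1 3 = 0 := by linear_combination c13 - hcc 1 3 - κ * a13
  have V2 := V'.transl x0
  have hg2 := hg.transl x0
  obtain ⟨-, -, -, h13, -⟩ := vertical_coeffs (a := translCoeff x0 b) (by simpa using V2.fst) V2.snd
    (.of_eventually_eq_zero (by simpa only [← hg2.pderiv_zero] using V2.tangent))
    (by simpa only [← hg2 _ _] using V2.bound_left)
  have hx0 : x0 = 0 := by simpa [translCoeff, Finset.sum_range_succ, b13, b23] using h13
  subst hx0
  obtain ⟨t, -, -, b12, b01, -⟩ := vertical_main hg h.swap.1 V'.fst V'.snd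
    (by simpa only [← hg.pderiv_zero] using V'.tangent)
    (by simpa only [← hg _ _] using V'.bound_left) V'.bound_right b23
  have hκa : κ * a 2 3 = -b 2 3 := by simp only [hκ]; field_simp
  have hts : b 2 3 * (t - s) ^ 2 = 0 := by
    rw [hcc, hcc] at hcs
    linear_combination hcs - b01 - s * b12 - κ * a01 - κ * s * a12 + s ^ 2 * hκa
  have hts : t = s := by simpa [b23, sub_eq_zero] using hts
  subst hts
  have c12 : c 1 2 = 0 := by linear_combination hcc 1 2 + b12 + κ * a12 - 2 * t * hκa
  have c01 : c 0 1 = 0 := by linear_combination hcs - t * c12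
  exact not_bad_of_square_of_negative hk hf hkq hs a05 a14 a02 a03 a04 a13 a23 a12 a01 c05 c14 c23
    c02 c03 c04 c13 c12 c01

end pencil

section topForm

variable {f g : MvPolynomial (Fin 2) ℝ} {a b : ℕ → ℕ → ℝ}

theorem Polynomial.X_sub_C_mul_derivative_pow_mul (m : ℝ) (k : ℕ) (P : Polynomial ℝ) :
    (X - C m) * derivative ((X - C m) ^ k * P) =
      (X - C m) ^ k * (C (k : ℝ) * P + (X - C m) * derivative P) := by
  rcases k with _ | k
  · simp
  · simp [derivative_pow]
    ring

theorem Polynomial.eq_C_mul_pow_of_ode {A G : Polynomial ℝ} (hG : G ≠ 0) (hA : A.natDegree = 5)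
    (h : C 6 * derivative A * G = C 5 * A * derivative G) {m : ℝ} (hm : A.eval m = 0) :
    ∃ c, A = C c * (X - C m) ^ 5 := by
  have hA0 : A ≠ 0 := fun h0 => by simp [h0] at hA
  obtain ⟨A₁, hA₁, hAm⟩ := exists_eq_pow_rootMultiplicity_mul_and_not_dvd A hA0 m
  obtain ⟨G₁, hG₁, hGm⟩ := exists_eq_pow_rootMultiplicity_mul_and_not_dvd G hG m
  set k := A.rootMultiplicity m
  set l := G.rootMultiplicity m
  rw [dvd_iff_isRoot, IsRoot.def] at hAm hGm
  have hX : (X - C m : Polynomial ℝ) ≠ 0 := X_sub_C_ne_zero m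
  have h1 : C 6 * (C (k : ℝ) * A₁ + (X - C m) * derivative A₁) * G₁ =
      C 5 * A₁ * (C (l : ℝ) * G₁ + (X - C m) * derivative G₁) := by
    refine mul_left_cancel₀ (pow_ne_zero (k + l) hX) ?_
    have h2 := X_sub_C_mul_derivative_pow_mul m k A₁
    have h3 := X_sub_C_mul_derivative_pow_mul m l G₁
    rw [hA₁, hG₁] at h
    linear_combination (X - C m) * h - C 6 * (X - C m) ^ l * G₁ * h2 +
      C 5 * (X - C m) ^ k * A₁ * h3
  have h2 := congrArg (eval m) h1
  simp only [eval_mul, eval_add, eval_C, eval_sub, eval_X, sub_self, zero_mul, add_zero] at h2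
  have h3 : (6 * k : ℝ) = 5 * l := mul_right_cancel₀ (mul_ne_zero hAm hGm) (by linear_combination h2)
  have h4 : 6 * k = 5 * l := by exact_mod_cast h3
  have hk : k ≠ 0 := fun h0 => by
    rw [h0, pow_zero, one_mul] at hA₁
    exact hAm (hA₁ ▸ hm)
  have hA₁0 : A₁ ≠ 0 := fun h0 => hAm (by simp [h0])
  have hdeg : k + A₁.natDegree = 5 := by
    rw [← hA, hA₁, natDegree_mul (pow_ne_zero _ hX) hA₁0, natDegree_pow, natDegree_X_sub_C, mul_one]
  have hk5 : k = 5 := by omega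
  refine ⟨A₁.coeff 0, ?_⟩
  rw [← eq_C_of_natDegree_eq_zero (by omega : A₁.natDegree = 0), mul_comm, ← hk5]
  exact hA₁

/-- The dehomogenized form of degree five. -/
noncomputable def topPoly (a : ℕ → ℕ → ℝ) : Polynomial ℝ :=
  ∑ i ∈ Finset.range 6, Polynomial.C (a i (5 - i)) * Polynomial.X ^ i

theorem coeff_topPoly (a : ℕ → ℕ → ℝ) (i : ℕ) :
    (topPoly a).coeff i = if i ≤ 5 then a i (5 - i) else 0 := by
  simp [topPoly, Polynomial.coeff_X_pow, Nat.lt_succ_iff]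

theorem topPoly_shearCoeff (m : ℝ) (a : ℕ → ℕ → ℝ) :
    topPoly (shearCoeff m a) = (topPoly a).comp (Polynomial.X + Polynomial.C m) := by
  refine Polynomial.funext fun x => ?_
  simp [topPoly, shearCoeff, Finset.sum_range_succ, Nat.choose]
  ring

theorem IsQuintic.lead_top (hf : IsQuintic f a) : lead (-1) 1 5 1 f = topPoly a := by
  ext i
  rw [coeff_topPoly]
  split_ifs with hi
  · rw [hf.coeff_lead le_rfl (j := 5 - i) (by omega), if_pos (by omega)]
  · exact coeff_lead_of_forall_ne fun j => by omega

theorem natDegree_topPoly (h : a 5 0 ≠ 0) : (topPoly a).natDegree = 5 := by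
  refine Polynomial.natDegree_eq_of_le_of_coeff_ne_zero ?_ (by simpa [coeff_topPoly] using h)
  refine Polynomial.natDegree_le_iff_coeff_eq_zero.2 fun i hi => ?_
  rw [coeff_topPoly, if_neg (by omega)]

/-- A quintic whose top form is a fifth power of a linear form is not a component of a
counterexample. -/
theorem not_bad_of_topPoly_eq {m c : ℝ} (h : Bad f g) (hf : IsQuintic f a) (a50 : a 5 0 ≠ 0)
    (htop : topPoly a = Polynomial.C c * (Polynomial.X - Polynomial.C m) ^ 5) : False := by
  have h1 := topPoly_shearCoeff m a
  simp only [htop, Polynomial.mul_comp, Polynomial.C_comp, Polynomial.pow_comp, Polynomial.sub_comp,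
    Polynomial.X_comp, add_sub_cancel_right] at h1
  have h2 : ∀ i < 5, shearCoeff m a i (5 - i) = 0 := fun i hi => by
    have := congrArg (fun P => Polynomial.coeff P i) h1
    simpa [coeff_topPoly, hi.le, hi.ne, Polynomial.coeff_X_pow] using this
  refine not_bad_of_top_eq_pow (h.shear m) (hf.shear m) ?_ (h2 4 (by norm_num)) (h2 3 (by norm_num))
    (h2 2 (by norm_num)) (h2 1 (by norm_num)) (h2 0 (by norm_num))
  rwa [shearCoeff_zero_right]

theorem not_bad_of_totalDegree_eq_six (h : Bad f g) (hf : IsQuintic f a) (hdeg : DegLE 5 a)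
    (a50 : a 5 0 ≠ 0) (hg : g.totalDegree = 6) : False := by
  have hwt : ∀ d : Fin 2 →₀ ℕ, wt (-1) 1 d = (d.sum fun _ e => e : ℕ) := fun d => by
    simp [wt, Finsupp.sum_fintype, add_comm]
  obtain ⟨m, hm⟩ := exists_shear_of_bad h hf (by norm_num) le_rfl hdeg a50
  have hm0 : shearCoeff m a 0 5 = 0 := by
    rcases hm with hm | ⟨x0, x, y, V⟩
    · exact hm 0 (by norm_num) (by norm_num)
    · exact (V.coeffs (hf.shear m)).1
  obtain ⟨σ, -, hσ⟩ := exists_sign h.1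
  have hode := lead_jac_eq_zero (p := -1) (a := 5) (b := 6) hσ (Or.inr rfl)
    (hf.wt_le fun i _ j _ _ _ => by omega)
    (fun d hd => by
      rw [hwt]
      exact_mod_cast hg ▸ le_totalDegree hd) (by decide)
  have hG : lead (-1) 1 6 1 g ≠ 0 := by
    obtain ⟨d, hd, hd6⟩ := Finset.exists_mem_eq_sup g.support
      (Finset.nonempty_iff_ne_empty.2 fun h0 => by simp [totalDegree, h0] at hg)
      fun d => d.sum fun _ e => e
    intro h0
    have h1 := coeff_lead (f := g) (p := -1) (q := 1) (e := 6) (ε := 1) le_rfl (d := d) (by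
      rw [hwt, ← hd6, ← totalDegree, hg]
      rfl)
    rw [h0] at h1
    simp at h1
    exact mem_support_iff.1 hd h1.symm
  rw [hf.lead_top] at hode
  obtain ⟨c, hc⟩ := Polynomial.eq_C_mul_pow_of_ode hG (natDegree_topPoly a50)
    (by exact_mod_cast hode) (m := m) (by
      have := congrArg (Polynomial.eval 0) (topPoly_shearCoeff m a)
      simpa [topPoly, Polynomial.eval_comp, Finset.sum_range_succ, hm0] using this.symm)
  exact not_bad_of_topPoly_eq h hf a50 hc

end topForm

section quintics

variable {f g : MvPolynomial (Fin 2) ℝ} {a b : ℕ → ℕ → ℝ}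

theorem Polynomial.natDegree_X_mul_derivative_le (P : Polynomial ℝ) :
    (X * derivative P).natDegree ≤ P.natDegree := by
  refine natDegree_le_iff_coeff_eq_zero.2 fun n hn => ?_
  obtain ⟨n, rfl⟩ := Nat.exists_eq_succ_of_ne_zero (Nat.ne_zero_of_lt hn)
  rw [coeff_X_mul, coeff_derivative, coeff_eq_zero_of_natDegree_lt hn, zero_mul]

theorem Polynomial.coeff_X_mul_derivative (P : Polynomial ℝ) (n : ℕ) :
    (X * derivative P).coeff n = n * P.coeff n := by
  rcases n with _ | n
  · simp
  · rw [coeff_X_mul, coeff_derivative]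
    push_cast
    ring

theorem Polynomial.wronskian_ne_zero_of_natDegree_lt {A E : Polynomial ℝ} (hE : E ≠ 0)
    (h : E.natDegree < A.natDegree) : derivative A * E - A * derivative E ≠ 0 := by
  intro h0
  have hA : A ≠ 0 := fun h0 => by simp [h0] at h
  have h1 := coeff_mul_add_eq_of_natDegree_le (natDegree_X_mul_derivative_le A) (le_refl E.natDegree)
  have h2 := coeff_mul_add_eq_of_natDegree_le (le_refl A.natDegree) (natDegree_X_mul_derivative_le E)
  rw [coeff_X_mul_derivative] at h1 h2
  have h3 : X * derivative A * E = A * (X * derivative E) := by linear_combination X * h0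
  rw [h3, h2] at h1
  have h4 : (E.natDegree : ℝ) = A.natDegree :=
    mul_right_cancel₀ (mul_ne_zero (leadingCoeff_ne_zero.2 hA) (leadingCoeff_ne_zero.2 hE)) (by
      simp only [leadingCoeff]
      linear_combination h1)
  exact h.ne (by exact_mod_cast h4)

theorem shearCoeff_add_mul (m c : ℝ) (a b : ℕ → ℕ → ℝ) (i j : ℕ) :
    shearCoeff m (fun i j => a i j + c * b i j) i j = shearCoeff m a i j + c * shearCoeff m b i j := by
  simp only [shearCoeff, Finset.mul_sum, ← Finset.sum_add_distrib]
  exact Finset.sum_congr rfl fun _ _ => by ring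

theorem eval_topPoly (m : ℝ) (a : ℕ → ℕ → ℝ) : (topPoly a).eval m = shearCoeff m a 0 5 := by
  have := congrArg (Polynomial.eval 0) (topPoly_shearCoeff m a)
  rw [← Polynomial.coeff_zero_eq_eval_zero, coeff_topPoly] at this
  simpa [Polynomial.eval_comp] using this.symm

theorem eval_derivative_topPoly (m : ℝ) (a : ℕ → ℕ → ℝ) :
    (topPoly a).derivative.eval m = shearCoeff m a 1 4 := by
  have := congrArg (fun P => Polynomial.eval 0 (Polynomial.derivative P)) (topPoly_shearCoeff m a)
  simp only [← Polynomial.coeff_zero_eq_eval_zero (Polynomial.derivative (topPoly (shearCoeff m a))),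
    Polynomial.coeff_derivative, coeff_topPoly, Polynomial.derivative_comp] at this
  simpa [Polynomial.eval_comp] using this.symm

theorem topPoly_eq_zero_of_shearCoeff {m : ℝ} (h : ∀ i ≤ 5, shearCoeff m a i (5 - i) = 0) :
    topPoly a = 0 := by
  have h0 : topPoly (shearCoeff m a) = 0 := by
    ext i
    rw [coeff_topPoly]
    split_ifs with hi
    · exact h i hi
    · rfl
  refine Polynomial.funext fun x => ?_
  have := congrArg (Polynomial.eval (x - m)) (topPoly_shearCoeff m a)
  simpa [h0, Polynomial.eval_comp] using this.symm

/-- A pencil of quintics contains at most one member with vertical asymptotes. -/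
theorem not_vertical_pencil (h : Bad f g) (hf : IsQuintic f a) (hg : IsQuintic g b) {m c c' : ℝ}
    (hc : c ≠ c') {x y x' y' : ℕ → ℝ} {x0 x0' : ℝ}
    (V : VerticalCurve (shear m (f + C c * g)) (shear m g) x y x0)
    (V' : VerticalCurve (shear m (f + C c' * g)) (shear m g) x' y' x0') : False := by
  have hB : Bad (f + C c * g) (f + C c' * g) := by
    simpa using h.linear (α := 1) (β := c) (γ := 1) (δ := c') (by
      rw [one_mul, mul_one]
      exact sub_ne_zero.2 hc.symm)
  have key : ∀ {c c' x0 : ℝ} {x y : ℕ → ℝ},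
      VerticalCurve (shear m (f + C c * g)) (shear m g) x y x0 →
      VerticalCurve (shear m (f + C c * g)) (shear m (f + C c' * g)) x y x0 := by
    intro c c' x0 x y V
    refine ⟨V.fst, V.snd, V.tangent, V.bound_left, ?_⟩
    obtain ⟨u, hu⟩ := V.bound_left.exists_tendsto
    obtain ⟨v, hv⟩ := V.bound_right.exists_tendsto
    refine .of_tendsto (c := u + (c' - c) * v) ((hu.add (hv.const_mul (c' - c))).congr fun n => ?_)
    simp only [ev_shear, ev_add, ev_mul, ev_C]
    ring
  have W := (key (c' := c') V).transl x0
  rw [sub_self] at W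
  exact not_two_vertical ((hB.shear m).transl x0) (((hf.add_mul hg c).shear m).transl x0)
    (((hf.add_mul hg c').shear m).transl x0) W ((key (c' := c) V').transl x0)

theorem not_bad_of_reduced_quintics (h : Bad f g) (hf : IsQuintic f a) (hg : IsQuintic g b)
    (hfd : DegLE 5 a) (hgd : DegLE 5 b) (a50 : a 5 0 ≠ 0) (b50 : b 5 0 = 0) : False := by
  by_cases hE : topPoly b = 0
  · refine not_bad_of_degLE_four le_rfl h.swap hg fun i j hij => ?_
    rcases (show 5 ≤ i + j from hij).eq_or_lt with h1 | h1
    · have := coeff_topPoly b i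
      rw [hE, Polynomial.coeff_zero, if_pos (by omega)] at this
      rw [show j = 5 - i by omega, ← this]
    · exact hgd i j h1
  have hs : ∀ c : ℕ, ∃ m, (∀ i ≤ 3, shearCoeff m a i (5 - i) + c * shearCoeff m b i (5 - i) = 0) ∨
      ∃ x0 x y, VerticalCurve (shear m (f + C (c : ℝ) * g)) (shear m g) x y x0 := by
    intro c
    obtain ⟨m, hm⟩ := exists_shear_of_bad (h.add_mul c) (hf.add_mul hg c) (by norm_num) le_rfl
      (fun i j hij => by simp [hfd i j hij, hgd i j hij]) (by simpa [b50] using a50)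
    simp only [shearCoeff_add_mul] at hm
    exact ⟨m, hm.imp_left fun h i hi => h i hi (by omega)⟩
  choose m hm using hs
  set W := (topPoly a).derivative * topPoly b - topPoly a * (topPoly b).derivative
  have hb5 : (topPoly b).natDegree < 5 := by
    rw [Nat.lt_succ_iff]
    refine Polynomial.natDegree_le_iff_coeff_eq_zero.2 fun i hi => ?_
    rw [coeff_topPoly]
    split_ifs with h5
    · rw [show i = 5 by omega, b50]
    · rfl
  have hW : W ≠ 0 := Polynomial.wronskian_ne_zero_of_natDegree_lt hE (by rwa [natDegree_topPoly a50])
  have hroot : ∀ c, m c ∈ W.roots.toFinset := by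
    intro c
    rw [Multiset.mem_toFinset, Polynomial.mem_roots hW, Polynomial.IsRoot.def]
    have h2 : shearCoeff (m c) a 0 5 + c * shearCoeff (m c) b 0 5 = 0 ∧
        shearCoeff (m c) a 1 4 + c * shearCoeff (m c) b 1 4 = 0 := by
      rcases hm c with hz | ⟨x0, x, y, V⟩
      · exact ⟨hz 0 (by norm_num), hz 1 (by norm_num)⟩
      · simpa only [shearCoeff_add_mul] using V.coeffs ((hf.add_mul hg c).shear (m c))
    simp only [W, Polynomial.eval_sub, Polynomial.eval_mul, eval_topPoly, eval_derivative_topPoly]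
    linear_combination shearCoeff (m c) b 0 5 * h2.2 - shearCoeff (m c) b 1 4 * h2.1
  obtain ⟨c, c', hne, hcc⟩ := Finite.exists_ne_map_eq_of_infinite
    fun c : ℕ => ((⟨m c, hroot c⟩ : W.roots.toFinset),
      ∀ i ≤ 3, shearCoeff (m c) a i (5 - i) + c * shearCoeff (m c) b i (5 - i) = 0)
  rw [Prod.mk.injEq, Subtype.mk.injEq] at hcc
  obtain ⟨hmm, hiff⟩ := hcc
  have hne' : (c : ℝ) ≠ c' := by exact_mod_cast hne
  have h1 := hm c
  have h2 := hm c'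
  rw [← hmm] at h2 hiff
  set m := m c
  by_cases hz : ∀ i ≤ 3, shearCoeff m a i (5 - i) + c * shearCoeff m b i (5 - i) = 0
  · have hz' := hiff.mp hz
    have hb : ∀ i ≤ 3, shearCoeff m b i (5 - i) = 0 := fun i hi =>
      mul_left_cancel₀ (sub_ne_zero.2 hne') (by linear_combination hz i hi - hz' i hi)
    have ha : ∀ i ≤ 3, shearCoeff m a i (5 - i) = 0 := fun i hi => by simpa [hb i hi] using hz i hi
    have b41 : shearCoeff m b 4 1 ≠ 0 := fun h0 => hE <| topPoly_eq_zero_of_shearCoeff fun i hi => by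
      rcases show i ≤ 3 ∨ i = 4 ∨ i = 5 by omega with h3 | rfl | rfl
      · exact hb i h3
      · exact h0
      · rw [shearCoeff_zero_right, b50]
    set t := -(shearCoeff m a 4 1 / shearCoeff m b 4 1) with ht
    have hcoef : ∀ i ≤ 3, shearCoeff m (fun i j => a i j + t * b i j) i (5 - i) = 0 := fun i hi => by
      rw [shearCoeff_add_mul, ha i hi, hb i hi, mul_zero, add_zero]
    refine not_bad_of_top_eq_pow ((h.add_mul t).shear m) ((hf.add_mul hg t).shear m) ?_ ?_
      (hcoef 3 (by norm_num)) (hcoef 2 (by norm_num)) (hcoef 1 (by norm_num)) (hcoef 0 (by norm_num))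
    · simpa [b50] using a50
    · rw [shearCoeff_add_mul, ht]
      field_simp
      ring
  · have hz' := fun h0 => hz (hiff.mpr h0)
    obtain ⟨x0, x, y, V⟩ := h1.resolve_left hz
    obtain ⟨x0', x', y', V'⟩ := h2.resolve_left hz'
    exact not_vertical_pencil h hf hg hne' V V'

theorem not_bad_of_quintics (h : Bad f g) (hf : IsQuintic f a) (hg : IsQuintic g b)
    (a50 : a 5 0 ≠ 0) : False := by
  obtain ⟨a', hf', hfd, ha⟩ := DegLE.five hf
  rw [← ha 5 0 (by norm_num)] at a50
  set t := -(b 5 0 / a' 5 0) with ht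
  obtain ⟨b', hg', hgd, hb⟩ := DegLE.five (hg.add_mul hf' t)
  refine not_bad_of_reduced_quintics (h.swap.add_mul t).swap hf' hg' hfd hgd a50 ?_
  rw [hb 5 0 (by norm_num), ht]
  field_simp
  ring

theorem totalDegree_sub₂_le {φ ψ : MvPolynomial (Fin 2) ℝ} (hφ : φ.totalDegree ≤ 1)
    (hψ : ψ.totalDegree ≤ 1) (f : MvPolynomial (Fin 2) ℝ) :
    (sub₂ φ ψ f).totalDegree ≤ f.totalDegree := by
  rw [sub₂, bind₁, aeval_def, eval₂_eq']
  refine totalDegree_finsetSum_le fun d hd => ?_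
  refine (totalDegree_mul _ _).trans ?_
  rw [algebraMap_eq, totalDegree_C, zero_add, Fin.prod_univ_two]
  refine (totalDegree_mul _ _).trans ?_
  have h1 := (totalDegree_pow φ (d 0)).trans (Nat.mul_le_mul_left (d 0) hφ)
  have h2 := (totalDegree_pow ψ (d 1)).trans (Nat.mul_le_mul_left (d 1) hψ)
  have h3 := le_totalDegree hd
  rw [Finsupp.sum_fintype _ _ (by simp), Fin.sum_univ_two] at h3
  simp only [Matrix.cons_val_zero, Matrix.cons_val_one]
  omega

theorem not_bad_of_totalDegree_le (hf : f.totalDegree ≤ 5) (hg : g.totalDegree ≤ 6) : ¬ Bad f g := by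
  intro h
  obtain ⟨a, ha, had⟩ := IsQuintic.of_degree hf le_rfl
  by_cases hne : ∃ i ≤ 5, a i (5 - i) ≠ 0
  · obtain ⟨m, hm⟩ := exists_shearCoeff'_ne_zero hne
    have hg' : (shear' m g).totalDegree ≤ 6 := by
      refine (totalDegree_sub₂_le (totalDegree_X _).le ((totalDegree_add _ _).trans ?_) g).trans hg
      refine max_le (totalDegree_X _).le ((totalDegree_mul _ _).trans ?_)
      simp
    rcases hg'.eq_or_lt with h6 | h6
    · exact not_bad_of_totalDegree_eq_six (h.shear' m) (ha.shear' m) (had.shear' m) hm h6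
    · obtain ⟨b, hb, -⟩ := IsQuintic.of_degree (Nat.lt_succ_iff.1 h6) le_rfl
      exact not_bad_of_quintics (h.shear' m) (ha.shear' m) hb hm
  · push Not at hne
    refine not_bad_of_degLE_four le_rfl h ha fun i j hij => ?_
    rcases (show 5 ≤ i + j from hij).eq_or_lt with h1 | h1
    · rw [show j = 5 - i by omega]
      exact hne i (by omega)
    · exact had i j h1

end quintics

theorem real_jacobian_low_degrees (f g : MvPolynomial (Fin 2) ℝ)
    (hf : f.totalDegree ≤ 5) (hg : g.totalDegree ≤ 6)
    (hJ : ∀ p : Fin 2 → ℝ, eval p (Jac f g) ≠ 0) :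
    Function.Injective (fun p : Fin 2 → ℝ => (eval p f, eval p g)) := by
  have hB := not_bad_of_totalDegree_le hf hg
  rw [Bad, not_and_not_right] at hB
  intro p q hpq
  have h : (p 0, p 1) = (q 0, q 1) := hB (fun x y => hJ _) (by
    simpa only [planeMap, ev_eq_eval] using hpq)
  rw [Prod.mk.injEq] at h
  ext i
  fin_cases i
  exacts [h.1, h.2]
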